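/- Let χ be an extreme unipotent trace of A(GLU), normalized so that χ(I_U) = 1. Then there exists a unique Borel probability measure ϱ on 𝕌 such that for every n and every unipotent upper-triangular matrix g ∈ GL(n,q), χ(I_g^U) = ϱ(Cyl_g). (Theorem 4.2: identification of unipotent traces with probability measures on the group of unipotent upper-triangular infinite matrices.) -/

import Mathlib

/-!
STATEMENT 0 (Theorem 3.3, multiplicativity of extreme unipotent traces of A(GLB)).
-/

open scoped ComplexOrder

variable (F : Type) [Field F] [Fintype F] [DecidableEq F]

/-- `GL(n,q)`, the group of invertible `n × n` matrices over the finite field `F` (`q = |F|`). -/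
abbrev GLn (n : ℕ) := GL (Fin n) F

/-- The complex group algebra `ℂ[GL(n,q)]`. -/
abbrev GA (n : ℕ) := MonoidAlgebra ℂ (GLn F n)

/-- `b` is an invertible upper-triangular matrix, i.e. an element of the Borel subgroup `B_n`. -/
def IsUT {n : ℕ} (b : GLn F n) : Prop :=
  ∀ i j : Fin n, j < i → (b : Matrix (Fin n) (Fin n) F) i j = 0

open scoped Classical in
/-- `Ext_U(g)`: the set of `h ∈ GL(n+1,q)` whose top-left `n × n` corner is `g` and whose last
row is `(0,...,0,1)`. -/
noncomputable def ExtUSet {n : ℕ} (g : GLn F n) : Finset (GLn F (n + 1)) :=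
  Finset.univ.filter (fun h =>
    (∀ i j : Fin n, (h : Matrix (Fin (n + 1)) (Fin (n + 1)) F) i.castSucc j.castSucc
        = (g : Matrix (Fin n) (Fin n) F) i j) ∧
    (∀ j : Fin n, (h : Matrix (Fin (n + 1)) (Fin (n + 1)) F) (Fin.last n) j.castSucc = 0) ∧
    (h : Matrix (Fin (n + 1)) (Fin (n + 1)) F) (Fin.last n) (Fin.last n) = 1)

/-- The embedding `j_n : ℂ[GL(n,q)] → ℂ[GL(n+1,q)]`, `e_g ↦ q^{-n} ∑_{h ∈ Ext_U(g)} e_h`. -/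
noncomputable def paraEmbU (n : ℕ) : GA F n →ₗ[ℂ] GA F (n + 1) :=
  (Finsupp.lsum ℂ (fun g => LinearMap.toSpanSingleton ℂ (GA F (n + 1))
    (((Fintype.card F : ℂ) ^ n)⁻¹ • ∑ h ∈ ExtUSet F g, MonoidAlgebra.single h (1 : ℂ)))).comp
    (MonoidAlgebra.coeffLinearEquiv ℂ).toLinearMap

/-- Character of a matrix representation, as a linear functional on the group algebra. -/
noncomputable def charFun {n d : ℕ} (ρ : Representation ℂ (GLn F n) (Fin d → ℂ))
    (a : GA F n) : ℂ :=
  Finsupp.sum a.coeff (fun g c => c * LinearMap.trace ℂ (Fin d → ℂ) (ρ g))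

/-- `ρ` is an irreducible representation of `GL(n,q)` which is unipotent, i.e. possesses a
nonzero `B_n`-invariant vector. -/
def IsUnipotentIrrep {n d : ℕ} (ρ : Representation ℂ (GLn F n) (Fin d → ℂ)) : Prop :=
  (∀ W : Submodule ℂ (Fin d → ℂ), (∀ (g : GLn F n), ∀ v ∈ W, ρ g v ∈ W) → W = ⊥ ∨ W = ⊤) ∧
  (∃ v : Fin d → ℂ, v ≠ 0 ∧ ∀ b : GLn F n, IsUT F b → ρ b v = v)

/-- A functional on `ℂ[GL(n,q)]` is unipotent if it is a linear combination of characters of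
irreducible unipotent representations of `GL(n,q)`. -/
def IsUnipotentFunctional {n : ℕ} (φ : GA F n → ℂ) : Prop :=
  ∃ (k : ℕ) (c : Fin k → ℂ) (d : Fin k → ℕ)
    (ρ : (i : Fin k) → Representation ℂ (GLn F n) (Fin (d i) → ℂ)),
    (∀ i, IsUnipotentIrrep F (ρ i)) ∧ ∀ a : GA F n, φ a = ∑ i, c i * charFun F (ρ i) a

section Abstract
variable {A : Type} [NonUnitalRing A] [Module ℂ A] [SMulCommClass ℂ A A] [IsScalarTower ℂ A A]
  [StarRing A] [StarModule ℂ A]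

/-- A trace of a non-unital `*`-algebra: a central positive-definite linear functional. -/
def IsTrace (χ : A →ₗ[ℂ] ℂ) : Prop :=
  (∀ x y : A, χ (x * y) = χ (y * x)) ∧ (∀ x : A, 0 ≤ χ (star x * x))

/-- A nonzero trace is extreme if any decomposition into a sum of two traces is trivial. -/
def IsExtremeTrace (χ : A →ₗ[ℂ] ℂ) : Prop :=
  IsTrace χ ∧ χ ≠ 0 ∧ ∀ χ₁ χ₂ : A →ₗ[ℂ] ℂ, IsTrace χ₁ → IsTrace χ₂ → χ = χ₁ + χ₂ →
    ∃ c₁ c₂ : ℝ, 0 ≤ c₁ ∧ 0 ≤ c₂ ∧ χ₁ = (c₁ : ℂ) • χ ∧ χ₂ = (c₂ : ℂ) • χ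
end Abstract


open MeasureTheory

/-- The group `𝕌` of infinite unipotent upper-triangular matrices over `F` (indexed by `ℕ`). -/
def UU : Type := {X : ℕ → ℕ → F // (∀ i j : ℕ, j < i → X i j = 0) ∧ ∀ i : ℕ, X i i = 1}

/-- The Borel σ-algebra of `𝕌` (the product σ-algebra of the discrete finite field `F`,
which coincides with the Borel σ-algebra of the compact product topology). -/
noncomputable instance : MeasurableSpace (UU F) := by
  letI : MeasurableSpace F := ⊤
  exact Subtype.instMeasurableSpace

/-- `g` is a unipotent upper-triangular matrix. -/
def IsUUT {n : ℕ} (g : GLn F n) : Prop :=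
  (∀ i j : Fin n, j < i → (g : Matrix (Fin n) (Fin n) F) i j = 0) ∧
  (∀ i : Fin n, (g : Matrix (Fin n) (Fin n) F) i i = 1)

/-- The cylinder set `Cyl_g ⊆ 𝕌` of the matrix `g ∈ GL(n,q)`: infinite matrices whose
top-left `n × n` corner equals `g`. -/
def CylU {n : ℕ} (g : GLn F n) : Set (UU F) :=
  {X | ∀ i j : Fin n, X.1 i j = (g : Matrix (Fin n) (Fin n) F) i j}


/- part P1 -/

set_option linter.unusedSectionVars false
set_option linter.unusedSimpArgs false

namespace UT

@[simp] theorem sc_refl {X : Type} (σ : Equiv.Perm X) (a : X) : σ.SameCycle a a :=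
  Equiv.Perm.SameCycle.refl _ _

section cyc
open scoped Classical
open Equiv Equiv.Perm Finset

variable {X Y : Type} [Fintype X] [Fintype Y] {M R : Type} [AddCommMonoid M] [CommMonoid R]

/-- cycles (orbits) of a permutation -/
def CQ (σ : Perm X) : Type := Quotient (SameCycle.setoid σ)

def cmk (σ : Perm X) (a : X) : CQ σ := Quotient.mk (SameCycle.setoid σ) a

theorem cmk_eq (σ : Perm X) (a b : X) : cmk σ a = cmk σ b ↔ SameCycle σ a b := Quotient.eq

theorem cmk_surj (σ : Perm X) (o : CQ σ) : ∃ a, cmk σ a = o := Quotient.exists_rep o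

noncomputable instance (σ : Perm X) : Fintype (CQ σ) :=
  Fintype.ofSurjective (cmk σ) (cmk_surj σ)

noncomputable def cycProd (p : M → R) (w : X → M) (σ : Perm X) : R :=
  ∏ o : CQ σ, p (∑ j with cmk σ j = o, w j)

theorem sameCycle_of_step {σ : Perm X} {τ : Perm Y} (r : X → Y)
    (h : ∀ a, SameCycle τ (r a) (r (σ a))) {a b : X} (hab : SameCycle σ a b) :
    SameCycle τ (r a) (r b) := by
  obtain ⟨k, rfl⟩ := hab
  induction k using Int.induction_on with
  | zero => simp [SameCycle.refl]
  | succ n ih =>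
    rw [add_comm, zpow_add, zpow_one, Perm.mul_apply]
    exact ih.trans (h _)
  | pred n ih =>
    refine ih.trans ?_
    have := h ((σ ^ (-(n:ℤ) - 1)) a)
    rw [← Perm.mul_apply, ← zpow_one_add] at this
    have e : (1 + (-(n:ℤ) - 1)) = -n := by ring
    rw [e] at this
    exact this.symm

theorem cycProd_of_map {σ : Perm X} {τ : Perm Y} (r : X → Y) (p : M → R) (w : X → M) (w' : Y → M)
    (h : ∀ a b, SameCycle σ a b ↔ SameCycle τ (r a) (r b))
    (hw : ∀ a, ∑ b with SameCycle σ b a, w b = ∑ c with SameCycle τ c (r a), w' c)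
    (hout : ∀ c, (∀ a, ¬ SameCycle τ (r a) c) → p (∑ c' with SameCycle τ c' c, w' c') = 1) :
    cycProd p w σ = cycProd p w' τ := by
  unfold cycProd
  have hl : ∀ a b, (SameCycle.setoid σ) a b → (SameCycle.setoid τ) (r a) (r b) :=
    fun a b hab => (h a b).1 hab
  let e : CQ σ → CQ τ := Quotient.map' r hl
  have he : ∀ a, e (cmk σ a) = cmk τ (r a) := fun a => rfl
  refine Fintype.prod_of_injective e ?_ _ _ ?_ ?_
  · intro o o' hoo
    obtain ⟨a, rfl⟩ := cmk_surj σ o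
    obtain ⟨b, rfl⟩ := cmk_surj σ o'
    rw [he, he, cmk_eq] at hoo
    rw [cmk_eq, h]; exact hoo
  · intro o ho
    obtain ⟨c, rfl⟩ := cmk_surj τ o
    simp only [cmk_eq]
    apply hout
    intro a ha
    apply ho
    exact ⟨cmk σ a, by rw [he, cmk_eq]; exact ha⟩
  · intro o
    obtain ⟨a, rfl⟩ := cmk_surj σ o
    rw [he]
    simp only [cmk_eq]
    rw [hw]

theorem cycProd_inv (p : M → R) (w : X → M) (σ : Perm X) :
    cycProd p w σ⁻¹ = cycProd p w σ := by
  refine cycProd_of_map id p w w (fun a b => sameCycle_inv) ?_ ?_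
  · intro a; simp only [sameCycle_inv, id]
  · intro c hc; exact absurd (SameCycle.refl _ _) (hc c)

theorem cycProd_equiv (e : X ≃ Y) (p : M → R) (w : Y → M) (σ : Perm X) :
    cycProd p w (e.permCongr σ) = cycProd p (w ∘ e) σ := by
  symm
  have h : ∀ a b, SameCycle σ a b ↔ SameCycle (e.permCongr σ) (e a) (e b) := by
    intro a b
    constructor
    · apply sameCycle_of_step
      intro a
      have : e (σ a) = e.permCongr σ (e a) := by simp
      rw [this, sameCycle_apply_right]
    · intro hh
      have := sameCycle_of_step (σ := e.permCongr σ) (τ := σ) e.symm (by intro a; simp) hh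
      simpa using this
  refine cycProd_of_map e p _ w h ?_ ?_
  · intro a
    refine Finset.sum_equiv e ?_ ?_
    · intro b; simp [h]
    · intro b _; rfl
  · intro c hc
    exact absurd (by simp) (hc (e.symm c))

theorem cycProd_conj (p : M → R) (σ τ : Perm X) (w : X → M) (hw : ∀ a, w (τ a) = w a) :
    cycProd p w (τ * σ * τ⁻¹) = cycProd p w σ := by
  have h1 : τ * σ * τ⁻¹ = Equiv.permCongr τ σ := by ext; simp [Equiv.permCongr_apply]
  rw [h1, cycProd_equiv]
  congr 1
  ext a; exact hw a

theorem cycProd_sumCongr (p : M → R) (w : X → M) (w' : Y → M) (σ : Perm X) (τ : Perm Y) :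
    cycProd p (Sum.elim w w') (Perm.sumCongr σ τ) = cycProd p w σ * cycProd p w' τ := by
  have hll : ∀ a b, SameCycle (Perm.sumCongr σ τ) (Sum.inl a) (Sum.inl b) ↔ SameCycle σ a b := by
    intro a b
    constructor
    · intro h
      have := sameCycle_of_step (σ := Perm.sumCongr σ τ) (τ := σ) (Sum.elim id (fun _ => a)) ?_ h
      · simpa using this
      · rintro (x | x) <;> simp
    · apply sameCycle_of_step
      intro x
      have : (Sum.inl (σ x) : X ⊕ Y) = Perm.sumCongr σ τ (Sum.inl x) := by simp
      rw [this, sameCycle_apply_right]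
  have hrr : ∀ a b, SameCycle (Perm.sumCongr σ τ) (Sum.inr a) (Sum.inr b) ↔ SameCycle τ a b := by
    intro a b
    constructor
    · intro h
      have := sameCycle_of_step (σ := Perm.sumCongr σ τ) (τ := τ) (Sum.elim (fun _ => a) id) ?_ h
      · simpa using this
      · rintro (x | x) <;> simp
    · apply sameCycle_of_step
      intro x
      have : (Sum.inr (τ x) : X ⊕ Y) = Perm.sumCongr σ τ (Sum.inr x) := by simp
      rw [this, sameCycle_apply_right]
  have hlr : ∀ a b, ¬ SameCycle (Perm.sumCongr σ τ) (Sum.inl a) (Sum.inr b) := by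
    intro a b h
    have := sameCycle_of_step (σ := Perm.sumCongr σ τ) (τ := (1 : Perm Bool))
      (Sum.elim (fun _ => false) (fun _ => true)) ?_ h
    · simp at this
    · rintro (x | x) <;> simp
  have hrl : ∀ a b, ¬ SameCycle (Perm.sumCongr σ τ) (Sum.inr a) (Sum.inl b) :=
    fun a b h => hlr _ _ h.symm
  unfold cycProd
  let e1 : CQ σ → CQ (Perm.sumCongr σ τ) := Quotient.map' Sum.inl (fun a b h => (hll a b).2 h)
  let e2 : CQ τ → CQ (Perm.sumCongr σ τ) := Quotient.map' Sum.inr (fun a b h => (hrr a b).2 h)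
  have h1 : ∀ a, e1 (cmk σ a) = cmk _ (Sum.inl a) := fun a => rfl
  have h2 : ∀ a, e2 (cmk τ a) = cmk _ (Sum.inr a) := fun a => rfl
  have hbij : Function.Bijective (Sum.elim e1 e2) := by
    constructor
    · rintro (o | o) (o' | o') h
      · obtain ⟨a, rfl⟩ := cmk_surj σ o
        obtain ⟨b, rfl⟩ := cmk_surj σ o'
        simp only [Sum.elim_inl, h1, cmk_eq, hll] at h
        rw [(cmk_eq _ _ _).2 h]
      · obtain ⟨a, rfl⟩ := cmk_surj σ o
        obtain ⟨b, rfl⟩ := cmk_surj τ o'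
        simp only [Sum.elim_inl, Sum.elim_inr, h1, h2, cmk_eq, hlr] at h
      · obtain ⟨a, rfl⟩ := cmk_surj τ o
        obtain ⟨b, rfl⟩ := cmk_surj σ o'
        simp only [Sum.elim_inl, Sum.elim_inr, h1, h2, cmk_eq, hrl] at h
      · obtain ⟨a, rfl⟩ := cmk_surj τ o
        obtain ⟨b, rfl⟩ := cmk_surj τ o'
        simp only [Sum.elim_inr, h2, cmk_eq, hrr] at h
        rw [(cmk_eq _ _ _).2 h]
    · intro o
      obtain ⟨a | a, rfl⟩ := cmk_surj _ o
      · exact ⟨Sum.inl (cmk σ a), h1 a⟩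
      · exact ⟨Sum.inr (cmk τ a), h2 a⟩
  rw [← Fintype.prod_bijective (Sum.elim e1 e2) hbij _ _ (fun _ => rfl), Fintype.prod_sum_type]
  congr 1
  · refine Finset.prod_congr rfl ?_
    intro o _
    obtain ⟨a, rfl⟩ := cmk_surj σ o
    simp only [Sum.elim_inl, h1, cmk_eq]
    rw [Finset.sum_filter, Fintype.sum_sum_type]
    simp [hll, hrl, Finset.sum_filter]
  · refine Finset.prod_congr rfl ?_
    intro o _
    obtain ⟨a, rfl⟩ := cmk_surj τ o
    simp only [Sum.elim_inr, h2, cmk_eq]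
    rw [Finset.sum_filter, Fintype.sum_sum_type]
    simp [hlr, hrr, Finset.sum_filter]

theorem cycProd_mul_swap' (p : M → R) (hp : p 0 = 1) (w : X → M) (σ : Perm X) (i z : X)
    (hz : σ z = z) (hi : i ≠ z) :
    cycProd p w (σ * swap i z) =
      cycProd p (Function.update (Function.update w i (w i + w z)) z 0) σ := by
  have hfix : ∀ a, SameCycle σ a z ↔ a = z := by
    intro a
    constructor
    · intro h
      have h2 : SameCycle σ z a := h.symm
      obtain ⟨k, hk⟩ := h2
      rw [zpow_apply_eq_self_of_apply_eq_self hz] at hk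
      exact hk.symm
    · rintro rfl; exact SameCycle.refl _ _
  set r : X → X := Function.update id z i with hr
  have rz : r z = i := by simp [hr]
  have rne : ∀ a, a ≠ z → r a = a := fun a ha => by simp [hr, ha]
  have hrz : ∀ a, r a ≠ z := by
    intro a
    by_cases ha : a = z
    · rw [ha, rz]; exact hi
    · rw [rne a ha]; exact ha
  set σ' := σ * swap i z with hσ'
  have s_i : σ' i = z := by simp [hσ', hz]
  have s_z : σ' z = σ i := by simp [hσ']
  have s_o : ∀ a, a ≠ i → a ≠ z → σ' a = σ a := by
    intro a h1 h2; simp [hσ', swap_apply_of_ne_of_ne h1 h2]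
  have σne : ∀ a, a ≠ z → σ a ≠ z := by
    intro a ha h; exact ha (σ.injective (h.trans hz.symm))
  have hra : ∀ a, SameCycle σ' (r a) a := by
    intro a
    by_cases ha : a = z
    · rw [ha, rz, ← s_i, sameCycle_apply_right]
    · rw [rne a ha]
  have h : ∀ a b, SameCycle σ' a b ↔ SameCycle σ (r a) (r b) := by
    intro a b
    constructor
    · apply sameCycle_of_step
      intro a
      by_cases ha : a = z
      · subst ha
        rw [s_z, rz, rne _ (σne i hi)]; simp
      · by_cases hai : a = i
        · subst hai
          rw [s_i, rz, rne _ ha]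
        · rw [s_o a hai ha, rne _ ha, rne _ (σne a ha)]; simp
    · intro hh
      have : SameCycle σ' (r (r a)) (r (r b)) := by
        refine sameCycle_of_step (σ := σ) (τ := σ') r ?_ hh
        intro a
        by_cases ha : a = z
        · subst ha; rw [hz]
        · rw [rne a ha, rne _ (σne a ha)]
          by_cases hai : a = i
          · subst hai
            rw [← s_z, ← s_i]; simp
          · rw [← s_o a hai ha]; simp
      exact ((hra a).symm.trans (hra (r a)).symm).trans (this.trans ((hra (r b)).trans (hra b)))
  refine cycProd_of_map r p w _ h ?_ ?_
  · intro a
    rw [Finset.sum_filter, Finset.sum_filter, ← Finset.sum_erase_add _ _ (Finset.mem_univ z),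
      ← Finset.sum_erase_add _ _ (Finset.mem_univ z),
      ← Finset.sum_erase_add _ _ (Finset.mem_erase.2 ⟨hi, Finset.mem_univ i⟩),
      ← Finset.sum_erase_add _ _ (Finset.mem_erase.2 ⟨hi, Finset.mem_univ i⟩)]
    have e1 : ∀ x ∈ (univ.erase z).erase i,
        (if SameCycle σ' x a then w x else 0) = if SameCycle σ x (r a) then
          (Function.update (Function.update w i (w i + w z)) z 0) x else 0 := by
      intro x hx
      simp only [Finset.mem_erase, Finset.mem_univ, and_true] at hx
      simp [h, rne x hx.2, hx.1, hx.2]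
    rw [Finset.sum_congr rfl e1]
    simp only [h, rz, rne i hi]
    simp [hi]
    by_cases hc : SameCycle σ i (r a) <;> simp [hc, add_assoc]
  · intro c hc
    have : c = z := by
      by_contra hcz
      exact hc c (by rw [rne c hcz])
    rw [this]
    have e : (univ.filter fun c' => SameCycle σ c' z) = {z} := by
      ext a; simp [hfix]
    rw [e]; simp [hp]

theorem cycProd_swap_mul' (p : M → R) (hp : p 0 = 1) (w : X → M) (σ : Perm X) (i z : X)
    (hz : σ z = z) (hi : i ≠ z) :
    cycProd p w (swap i z * σ) =
      cycProd p (Function.update (Function.update w i (w i + w z)) z 0) σ := by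
  rw [← cycProd_inv p w (swap i z * σ), mul_inv_rev, swap_inv,
    cycProd_mul_swap' p hp w _ i z (by rw [Perm.inv_eq_iff_eq, hz]) hi, cycProd_inv]

theorem cycProd_mul_swap [inst : DecidableEq X] (p : M → R) (hp : p 0 = 1) (w : X → M) (σ : Perm X)
    (i z : X) (hz : σ z = z) (hi : i ≠ z) :
    cycProd p w (σ * swap i z) =
      cycProd p (Function.update (Function.update w i (w i + w z)) z 0) σ := by
  have := cycProd_mul_swap' p hp w σ i z hz hi
  convert this

theorem cycProd_swap_mul [inst : DecidableEq X] (p : M → R) (hp : p 0 = 1) (w : X → M) (σ : Perm X)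
    (i z : X) (hz : σ z = z) (hi : i ≠ z) :
    cycProd p w (swap i z * σ) =
      cycProd p (Function.update (Function.update w i (w i + w z)) z 0) σ := by
  have := cycProd_swap_mul' p hp w σ i z hz hi
  convert this

/-- cycle type including fixed points -/
noncomputable def ct (σ : Perm X) : Multiset ℕ :=
  (univ : Finset (CQ σ)).val.map (fun o => ∑ j with cmk σ j = o, 1)

theorem cycProd_one_eq (p : ℕ → R) (σ : Perm X) :
    cycProd p (fun _ => 1) σ = ((ct σ).map p).prod := by
  unfold cycProd ct
  rw [Multiset.map_map]; rfl

theorem ct_eq_cycProd (σ : Perm X) :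
    ct σ = Multiplicative.toAdd
      (cycProd (fun k : ℕ => Multiplicative.ofAdd ({k} : Multiset ℕ)) (fun _ => 1) σ) := by
  unfold cycProd ct
  rw [toAdd_prod]
  simp only [toAdd_ofAdd]
  rw [Finset.sum, ← Multiset.sum_map_singleton (Multiset.map _ _), Multiset.map_map]
  rfl

theorem ct_inv (σ : Perm X) : ct σ⁻¹ = ct σ := by
  rw [ct_eq_cycProd, ct_eq_cycProd, cycProd_inv]

theorem ct_equiv (e : X ≃ Y) (σ : Perm X) : ct (e.permCongr σ) = ct σ := by
  rw [ct_eq_cycProd, ct_eq_cycProd, cycProd_equiv]; rfl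

theorem ct_conj (σ τ : Perm X) : ct (τ * σ * τ⁻¹) = ct σ := by
  rw [ct_eq_cycProd, ct_eq_cycProd, cycProd_conj]; intro; rfl

theorem ct_sumCongr (σ : Perm X) (τ : Perm Y) : ct (Perm.sumCongr σ τ) = ct σ + ct τ := by
  rw [ct_eq_cycProd, ct_eq_cycProd, ct_eq_cycProd, ← toAdd_mul, ← cycProd_sumCongr]
  congr 2
  ext (a | a) <;> rfl

theorem ct_sum (σ : Perm X) : (ct σ).sum = Fintype.card X := by
  unfold ct
  change ∑ o : CQ σ, ∑ j with cmk σ j = o, 1 = _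
  simp only [Finset.sum_filter]
  rw [Finset.sum_comm]; simp

theorem ct_pos (σ : Perm X) : 0 ∉ ct σ := by
  unfold ct
  simp only [Multiset.mem_map, not_exists, not_and]
  intro o _ h
  obtain ⟨a, rfl⟩ := cmk_surj σ o
  rw [Finset.sum_eq_zero_iff] at h
  have := h a (by simp)
  simp at this

theorem ct_one : ct (1 : Perm X) = Multiset.replicate (Fintype.card X) 1 := by
  have h : ∀ k ∈ ct (1 : Perm X), k = 1 := by
    intro k hk
    unfold ct at hk
    simp only [Multiset.mem_map] at hk
    obtain ⟨o, _, rfl⟩ := hk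
    obtain ⟨a, rfl⟩ := cmk_surj _ o
    have e : (univ.filter fun c' => cmk (1 : Perm X) c' = cmk 1 a) = {a} := by
      ext b; simp [cmk_eq]
    rw [e]; simp
  rw [Multiset.eq_replicate]
  refine ⟨?_, h⟩
  have h1 := ct_sum (1 : Perm X)
  rw [Multiset.eq_replicate_of_mem h] at h1
  simpa using h1

theorem cycProd_ext (p : M → R) {w w' : X → M} (h : ∀ a, w a = w' a) (σ : Perm X) :
    cycProd p w σ = cycProd p w' σ := by
  rw [funext h]

theorem cycProd_id (p : M → R) (w : X → M) : cycProd p w (1 : Perm X) = ∏ a, p (w a) := by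
  unfold cycProd
  symm
  refine Fintype.prod_bijective (cmk (1 : Perm X)) ⟨?_, cmk_surj _⟩ _ _ ?_
  · intro a b h; simpa [cmk_eq] using h
  · intro a
    have e : (univ.filter fun c' => cmk (1 : Perm X) c' = cmk 1 a) = {a} := by
      ext b; simp [cmk_eq]
    rw [e]; simp

theorem ct_finRotate (k : ℕ) : ct (finRotate (k + 1)) = {k + 1} := by
  have h0 : ∀ i : Fin (k + 1), SameCycle (finRotate (k + 1)) 0 i := by
    intro i
    induction i using Fin.induction with
    | zero => simp
    | succ i ih =>
      refine ih.trans ?_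
      have : i.succ = finRotate (k + 1) i.castSucc := by simp
      rw [this, sameCycle_apply_right]
  have hs : ∀ o : CQ (finRotate (k + 1)), o = cmk _ 0 := by
    intro o
    obtain ⟨a, rfl⟩ := cmk_surj _ o
    rw [cmk_eq]; exact (h0 a).symm
  have hu : (univ : Finset (CQ (finRotate (k + 1)))) = {cmk _ 0} := by
    ext o; simp [hs o]
  have h1 := ct_sum (finRotate (k + 1))
  have : ∃ a, ct (finRotate (k + 1)) = {a} := by
    unfold ct; rw [hu]; simp
  obtain ⟨a, ha⟩ := this
  rw [ha] at h1 ⊢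
  simp at h1
  rw [h1]

theorem ct_realize (m : Multiset ℕ) (hm : 0 ∉ m) : ∃ (n : ℕ) (σ : Perm (Fin n)), ct σ = m := by
  induction m using Multiset.induction_on with
  | empty => exact ⟨0, 1, by rw [ct_one]; simp⟩
  | cons k m ih =>
    simp only [Multiset.mem_cons, not_or] at hm
    obtain ⟨n, σ, hσ⟩ := ih hm.2
    obtain ⟨k, rfl⟩ := Nat.exists_eq_succ_of_ne_zero (Ne.symm hm.1)
    refine ⟨_, finSumFinEquiv.permCongr (Perm.sumCongr (finRotate (k + 1)) σ), ?_⟩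
    rw [ct_equiv, ct_sumCongr, ct_finRotate, hσ, Multiset.singleton_add]

theorem cycProd_optionCongr (p : M → R) (w : Option X → M) (τ : Perm X) :
    cycProd p w (optionCongr τ) = cycProd p (w ∘ some) τ * p (w none) := by
  have h : (Equiv.optionEquivSumPUnit.{0} X).permCongr (optionCongr τ) =
      Perm.sumCongr τ (1 : Perm (PUnit.{1})) := by
    ext (a | a) <;> simp
  have h2 : w = (Sum.elim (w ∘ some) (fun _ : PUnit.{1} => w none)) ∘
      (Equiv.optionEquivSumPUnit.{0} X) := by
    ext (_ | a) <;> simp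
  conv_lhs => rw [h2]
  rw [← cycProd_equiv, h, cycProd_sumCongr, cycProd_id]
  simp

/-- generating polynomial for the number of cycles, with sign `e = 1` or `-1` -/
theorem sum_cycles (e : ℤˣ) (t : ℝ) (m : ℕ) :
    ∑ σ : Perm (Fin m), (if e = 1 then 1 else ((sign σ : ℤ) : ℝ)) *
      cycProd (fun _ : ℕ => t) (fun _ => 1) σ = ∏ i ∈ Finset.range m, (t + (e : ℤ) * i) := by
  set p : ℕ → ℝ := fun k => if k = 0 then 1 else t with hp
  have hpt : ∀ (n : ℕ) (w : Fin n → ℕ) (hw : ∀ i, w i ≠ 0) (σ : Perm (Fin n)),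
      cycProd p w σ = cycProd (fun _ : ℕ => t) (fun _ => 1) σ := by
    intro n w hw σ
    unfold cycProd
    refine Finset.prod_congr rfl ?_
    intro o _
    obtain ⟨a, rfl⟩ := cmk_surj _ o
    rw [hp]; simp only
    rw [if_neg]
    intro h
    rw [Finset.sum_eq_zero_iff] at h
    exact hw a (h a (by simp))
  induction m with
  | zero =>
    simp [cycProd]
    have : IsEmpty (CQ (1 : Perm (Fin 0))) := ⟨fun o => by
      obtain ⟨a, _⟩ := cmk_surj _ o; exact a.elim0⟩
    simp
  | succ n ih =>
    rw [Finset.prod_range_succ, ← ih, ← Equiv.sum_comp ((finSuccEquiv n).symm.permCongr),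
      ← Equiv.sum_comp (Equiv.Perm.decomposeOption.symm),
      Fintype.sum_prod_type, Fintype.sum_option]
    simp only [sign_permCongr, cycProd_equiv]
    have key0 : ∀ τ : Perm (Fin n), cycProd (fun _ : ℕ => t) ((fun _ => 1) ∘ (finSuccEquiv n).symm)
        (decomposeOption.symm (none, τ)) = cycProd (fun _ : ℕ => t) (fun _ => 1) τ * t := by
      intro τ
      have : decomposeOption.symm (none, τ) = optionCongr τ := by simp; rfl
      rw [this, cycProd_optionCongr]; rfl
    have key : ∀ (i : Fin n) (τ : Perm (Fin n)), cycProd (fun _ : ℕ => t)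
        ((fun _ => 1) ∘ (finSuccEquiv n).symm)
        (decomposeOption.symm (some i, τ)) = cycProd (fun _ : ℕ => t) (fun _ => 1) τ := by
      intro i τ
      have h1 : decomposeOption.symm (some i, τ) = swap (some i) none * optionCongr τ := by
        rw [swap_comm]; rfl
      rw [h1]
      have h3 := hpt (n + 1) (fun _ => 1) (by simp)
        ((finSuccEquiv n).symm.permCongr (swap (some i) none * optionCongr τ))
      rw [cycProd_equiv, cycProd_equiv] at h3
      rw [← h3, cycProd_swap_mul p (by simp [hp]) _ _ _ _ (by simp) (by simp),
        cycProd_optionCongr, hpt]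
      · simp [hp]
      · intro j
        by_cases hj : j = i
        · subst hj; simp
        · simp [hj]
    have hs0 : ∀ τ : Perm (Fin n), sign (decomposeOption.symm (none, τ)) = sign τ := by
      intro τ; exact decomposeOption_symm_sign τ
    have hs : ∀ (i : Fin n) (τ : Perm (Fin n)),
        sign (decomposeOption.symm (some i, τ)) = - sign τ := by
      intro i τ; simp [sign_swap]
    simp only [key0, key, hs0, hs]
    rw [mul_add, Finset.sum_const]
    congr 1
    · rw [Finset.sum_mul]
      exact Finset.sum_congr rfl (fun _ _ => by ring)
    · simp only [card_univ, Fintype.card_fin, nsmul_eq_mul, Finset.mul_sum, Finset.sum_mul]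
      refine Finset.sum_congr rfl (fun τ _ => ?_)
      rcases Int.units_eq_one_or e with rfl | rfl
      · simp; ring
      · have : ¬ ((-1 : ℤˣ) = 1) := by decide
        simp [this]; ring

end cyc
end UT

/- part P2 -/

set_option linter.unusedSectionVars false
set_option linter.unusedSimpArgs false
namespace UT
section kk
open scoped Classical
open Equiv Equiv.Perm Finset

def PD (f : Multiset ℕ → ℝ) : Prop :=
  ∀ (n : ℕ) (x : Perm (Fin n) → ℝ), 0 ≤ ∑ σ, ∑ τ, x σ * x τ * f (ct (σ⁻¹ * τ))

structure CK (f : Multiset ℕ → ℝ) : Prop where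
  cons_one : ∀ m, f (1 ::ₘ m) = f m
  zero_mem : ∀ m, 0 ∈ m → f m = 0
  pd : PD f

def KK : Set (Multiset ℕ → ℝ) := {f | f 0 = 1 ∧ CK f}

theorem PD.gen {f : Multiset ℕ → ℝ} (hf : PD f) {X ι : Type} [Fintype X] [Fintype ι]
    (s : ι → Perm X) (x : ι → ℝ) :
    0 ≤ ∑ a, ∑ b, x a * x b * f (ct ((s a)⁻¹ * s b)) := by
  let e := Fintype.equivFin X
  let t : ι → Perm (Fin (Fintype.card X)) := fun a => e.permCongr (s a)
  have ht : ∀ a b, ct ((s a)⁻¹ * s b) = ct ((t a)⁻¹ * t b) := by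
    intro a b
    rw [← ct_equiv e]
    congr 1
    rw [eq_inv_mul_iff_mul_eq]
    ext y; simp [t]
  have h := hf _ (fun σ => ∑ a with t a = σ, x a)
  have h2 : ∀ g : Perm (Fin (Fintype.card X)) → ℝ,
      ∑ σ, (∑ a with t a = σ, x a) * g σ = ∑ a, x a * g (t a) := by
    intro g
    simp only [Finset.sum_mul, Finset.sum_filter]
    rw [Finset.sum_comm]
    refine Finset.sum_congr rfl (fun a _ => ?_)
    simp
  have h3 : ∑ a, ∑ b, x a * x b * f (ct ((s a)⁻¹ * s b)) =
      ∑ σ, ∑ τ, (∑ a with t a = σ, x a) * (∑ a with t a = τ, x a) * f (ct (σ⁻¹ * τ)) := by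
    simp only [mul_assoc, ← Finset.mul_sum]
    rw [h2 (fun σ => ∑ τ, (∑ a with t a = τ, x a) * f (ct (σ⁻¹ * τ)))]
    refine Finset.sum_congr rfl (fun a _ => ?_)
    rw [h2 (fun τ => f (ct ((t a)⁻¹ * τ)))]
    simp only [ht]
  rw [h3]; exact h

theorem CK.ones {f : Multiset ℕ → ℝ} (hf : CK f) (k : ℕ) (m : Multiset ℕ) :
    f (Multiset.replicate k 1 + m) = f m := by
  induction k with
  | zero => simp
  | succ k ih => rw [Multiset.replicate_succ, Multiset.cons_add, hf.cons_one, ih]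

theorem CK.bound {f : Multiset ℕ → ℝ} (hf : CK f) (m : Multiset ℕ) : |f m| ≤ f 0 := by
  have h1 : ∀ {n : ℕ} , f (ct (1 : Perm (Fin n))) = f 0 := by
    intro n
    rw [ct_one]
    have := hf.ones (Fintype.card (Fin n)) 0
    simpa using this
  by_cases hm : 0 ∈ m
  · rw [hf.zero_mem m hm, abs_zero]
    have := hf.pd.gen (X := Fin 0) (ι := Unit) (fun _ => 1) (fun _ => 1)
    simp at this
    rwa [h1] at this
  · obtain ⟨n, σ, hσ⟩ := ct_realize m hm
    have key : ∀ e : ℝ, e * e = 1 → 0 ≤ 2 * f 0 + 2 * e * f m := by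
      intro e he
      have := hf.pd.gen (X := Fin n) (ι := Bool) (fun b => if b then σ else 1)
        (fun b => if b then e else 1)
      simp only [Fintype.sum_bool] at this
      simp [h1, ct_inv, hσ, he] at this
      linarith
    rw [abs_le]
    constructor
    · linarith [key 1 (by norm_num)]
    · linarith [key (-1) (by norm_num)]

theorem KK_convex : Convex ℝ KK := by
  intro f hf g hg a b ha hb hab
  refine ⟨?_, ?_, ?_, ?_⟩
  · simp [hf.1, hg.1, hab]
  · intro m; simp [hf.2.cons_one, hg.2.cons_one]
  · intro m hm; simp [hf.2.zero_mem m hm, hg.2.zero_mem m hm]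
  · intro n x
    have h1 := hf.2.pd n x
    have h2 := hg.2.pd n x
    have : ∑ σ, ∑ τ, x σ * x τ * (a • f + b • g) (ct (σ⁻¹ * τ)) =
      a * (∑ σ, ∑ τ, x σ * x τ * f (ct (σ⁻¹ * τ))) + b * ∑ σ, ∑ τ, x σ * x τ * g (ct (σ⁻¹ * τ)) := by
      simp only [Finset.mul_sum, ← Finset.sum_add_distrib]
      refine Finset.sum_congr rfl (fun _ _ => Finset.sum_congr rfl (fun _ _ => ?_))
      simp; ring
    rw [this]; positivity

theorem KK_compact : IsCompact KK := by
  have h1 : KK ⊆ Set.pi Set.univ (fun _ : Multiset ℕ => Set.Icc (-1 : ℝ) 1) := by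
    intro f hf m _
    have := hf.2.bound m
    rw [hf.1] at this
    exact abs_le.1 this
  refine IsCompact.of_isClosed_subset (isCompact_univ_pi (fun _ => isCompact_Icc)) ?_ h1
  have : KK = {f | f 0 = 1} ∩ ((⋂ m, {f | f (1 ::ₘ m) = f m}) ∩ ((⋂ m, ⋂ (_ : 0 ∈ m), {f | f m = 0}) ∩
      ⋂ n, ⋂ x : Perm (Fin n) → ℝ, {f | 0 ≤ ∑ σ, ∑ τ, x σ * x τ * f (ct (σ⁻¹ * τ))})) := by
    ext f
    simp only [KK, Set.mem_ofPred_eq, Set.mem_inter_iff, Set.mem_iInter]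
    constructor
    · rintro ⟨a, b, c, d⟩; exact ⟨a, b, c, d⟩
    · rintro ⟨a, b, c, d⟩; exact ⟨a, b, c, d⟩
  rw [this]
  refine IsClosed.inter ?_ (IsClosed.inter ?_ (IsClosed.inter ?_ ?_))
  · exact isClosed_eq (continuous_apply _) continuous_const
  · exact isClosed_iInter fun m => isClosed_eq (continuous_apply _) (continuous_apply _)
  · exact isClosed_iInter fun m => isClosed_iInter fun _ =>
      isClosed_eq (continuous_apply _) continuous_const
  · exact isClosed_iInter fun n => isClosed_iInter fun x =>
      isClosed_le continuous_const (by fun_prop)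

theorem CK_pm {f : Multiset ℕ → ℝ} (hf : CK f) (m' : Multiset ℕ) (hm' : 0 ∉ m') (e : ℝ)
    (he : e * e = 1) : CK (fun m => f m + e * f (m + m')) := by
  obtain ⟨k, τ0, hτ0⟩ := ct_realize m' hm'
  refine ⟨?_, ?_, ?_⟩
  · intro m
    simp only [Multiset.cons_add, hf.cons_one]
  · intro m hm
    simp [hf.zero_mem m hm, hf.zero_mem (m + m') (by simp [hm])]
  · intro n x
    have h := hf.pd.gen (X := Fin n ⊕ Fin k) (ι := Perm (Fin n) × Bool)
      (fun a => Perm.sumCongr a.1 (if a.2 then τ0 else 1)) (fun a => x a.1 * (if a.2 then e else 1))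
    simp only [Fintype.sum_prod_type, Fintype.sum_bool, Perm.sumCongr_inv, Perm.sumCongr_mul,
      ct_sumCongr] at h
    have h1 : ∀ m, f (m + ct (1 : Perm (Fin k))) = f m := by
      intro m; rw [ct_one, add_comm, hf.ones]
    simp [ct_sumCongr, h1, ct_inv, hτ0, ← Finset.sum_add_distrib] at h
    have h2 : ∑ σ, ∑ τ, x σ * x τ * (f (ct (σ⁻¹ * τ)) + e * f (ct (σ⁻¹ * τ) + m')) = (1/2) *
       ∑ σ, ∑ τ, (x σ * e * (x τ * e) * f (ct (σ⁻¹ * τ)) + x σ * e * x τ * f (ct (σ⁻¹ * τ) + m') +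
         (x σ * (x τ * e) * f (ct (σ⁻¹ * τ) + m') + x σ * x τ * f (ct (σ⁻¹ * τ)))) := by
      simp only [Finset.mul_sum]
      refine Finset.sum_congr rfl (fun σ _ => Finset.sum_congr rfl (fun τ _ => ?_))
      linear_combination (-(1/2)) * (x σ * x τ * f (ct (σ⁻¹ * τ))) * he
    rw [h2]
    linarith

theorem KK_mult {f : Multiset ℕ → ℝ} (hf : f ∈ KK.extremePoints ℝ) (m m' : Multiset ℕ)
    (hm' : 0 ∉ m') : f (m + m') = f m * f m' := by
  have hK := hf.1
  set c := f m' with hc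
  have hb : |c| ≤ 1 := by have := hK.2.bound m'; rwa [hK.1] at this
  have hp := CK_pm hK.2 m' hm' 1 (by norm_num)
  have hn := CK_pm hK.2 m' hm' (-1) (by norm_num)
  have bp := hp.bound m
  have bn := hn.bound m
  simp only [zero_add, hK.1, ← hc] at bp bn
  rcases eq_or_ne c 1 with h1 | h1
  · rw [h1] at bn ⊢
    norm_num at bn
    linarith
  rcases eq_or_ne c (-1) with h2 | h2
  · rw [h2] at bp ⊢
    norm_num at bp
    linarith
  have hpos1 : 0 < 1 + c := by
    rcases lt_or_eq_of_le (abs_le.1 hb).1 with h | h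
    · linarith
    · exact absurd h.symm h2
  have hpos2 : 0 < 1 - c := by
    rcases lt_or_eq_of_le (abs_le.1 hb).2 with h | h
    · linarith
    · exact absurd h h1
  have scale : ∀ (g : Multiset ℕ → ℝ) (a : ℝ), 0 < a → g 0 = a → CK g → a⁻¹ • g ∈ KK := by
    intro g a ha hg hCK
    refine ⟨by simp [hg, ha.ne'], ?_, ?_, ?_⟩
    · intro m; simp [hCK.cons_one]
    · intro m hm; simp [hCK.zero_mem m hm]
    · intro n x
      have := hCK.pd n x
      have h3 : ∑ σ, ∑ τ, x σ * x τ * (a⁻¹ • g) (ct (σ⁻¹ * τ)) =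
        a⁻¹ * ∑ σ, ∑ τ, x σ * x τ * g (ct (σ⁻¹ * τ)) := by
        simp only [Finset.mul_sum]
        refine Finset.sum_congr rfl (fun _ _ => Finset.sum_congr rfl (fun _ _ => ?_))
        simp; ring
      rw [h3]; positivity
  have m1 := scale _ (1 + c) hpos1 (by simp [hK.1, ← hc]) hp
  have m2 := scale _ (1 - c) hpos2 (by simp [hK.1, ← hc]; ring) hn
  have hseg : f ∈ openSegment ℝ ((1 + c)⁻¹ • fun m => f m + 1 * f (m + m'))
      ((1 - c)⁻¹ • fun m => f m + (-1) * f (m + m')) := by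
    refine ⟨(1 + c) / 2, (1 - c) / 2, by positivity, by positivity, by ring, ?_⟩
    ext m
    simp
    field_simp
    ring
  have := hf.2 m1 m2 hseg
  have h5 := congrFun this m
  simp at h5
  field_simp at h5
  linarith

end kk
end UT

/- part P3 -/

set_option linter.unusedSectionVars false
set_option linter.unusedSimpArgs false
namespace UT
section ee
open scoped Classical
open Equiv Equiv.Perm Finset

variable {m : ℕ} {Z : Type} [Fintype Z]

/-- product of the transpositions listed in `l` -/
noncomputable def swl (l : List (Fin m × Z)) : Perm (Fin m ⊕ Z) :=
  (l.map (fun p => swap (Sum.inl p.1) (Sum.inr p.2))).prod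

noncomputable def wl : List (Fin m × Z) → (Fin m ⊕ Z → ℕ) → (Fin m ⊕ Z → ℕ)
  | [], w => w
  | p :: l, w => Function.update (Function.update (wl l w) (Sum.inl p.1)
      (wl l w (Sum.inl p.1) + wl l w (Sum.inr p.2))) (Sum.inr p.2) 0

theorem swl_fix (l : List (Fin m × Z)) (z : Z) (hz : z ∉ l.map Prod.snd) :
    swl l (Sum.inr z) = Sum.inr z := by
  induction l with
  | nil => simp [swl]
  | cons p l ih =>
    simp only [List.map_cons, List.mem_cons, not_or] at hz
    have : swl (p :: l) = swap (Sum.inl p.1) (Sum.inr p.2) * swl l := by simp [swl]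
    rw [this, Perm.mul_apply, ih hz.2, swap_apply_of_ne_of_ne (by simp) (by simpa using hz.1)]

theorem wl_inr (l : List (Fin m × Z)) (w : Fin m ⊕ Z → ℕ) (z : Z) :
    wl l w (Sum.inr z) = if z ∈ l.map Prod.snd then 0 else w (Sum.inr z) := by
  induction l with
  | nil => simp [wl]
  | cons p l ih =>
    simp only [wl]
    by_cases h : z = p.2
    · subst h; simp
    · rw [Function.update_of_ne (by simpa using h), Function.update_of_ne (by simp), ih]
      simp only [List.map_cons, List.mem_cons, h, false_or]

theorem wl_inl (l : List (Fin m × Z)) (hl : (l.map Prod.snd).Nodup) (w : Fin m ⊕ Z → ℕ)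
    (hw : ∀ z ∈ l.map Prod.snd, w (Sum.inr z) = 1) (i : Fin m) :
    wl l w (Sum.inl i) = w (Sum.inl i) + l.countP (fun p => p.1 = i) := by
  induction l with
  | nil => simp [wl]
  | cons p l ih =>
    simp only [List.map_cons, List.nodup_cons] at hl
    have ih' := ih hl.2 (fun z hz => hw z (by simp only [List.map_cons, List.mem_cons, hz, or_true]))
    simp only [wl]
    rw [Function.update_of_ne (by simp), List.countP_cons]
    by_cases h : p.1 = i
    · subst h
      simp only [Function.update_self, ih', wl_inr, hl.1, if_false]
      rw [hw p.2 (by simp)]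
      simp
      ring
    · rw [Function.update_of_ne (by simpa using fun h' => h h'.symm), ih']
      simp [h]

theorem cycProd_mul_swl {R : Type} [CommMonoid R] (P : ℕ → R) (hP : P 0 = 1)
    (l : List (Fin m × Z)) (hl : (l.map Prod.snd).Nodup)
    (w : Fin m ⊕ Z → ℕ) (σ : Perm (Fin m ⊕ Z))
    (hσ : ∀ z ∈ l.map Prod.snd, σ (Sum.inr z) = Sum.inr z) :
    cycProd P w (σ * swl l) = cycProd P (wl l w) σ := by
  induction l generalizing σ with
  | nil => simp [swl, wl]
  | cons p l ih =>
    have : swl (p :: l) = swap (Sum.inl p.1) (Sum.inr p.2) * swl l := by simp [swl]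
    simp only [List.map_cons, List.nodup_cons] at hl
    rw [this, ← mul_assoc, ih hl.2, cycProd_mul_swap P hP _ _ _ _ _ (by simp)]
    · rfl
    · exact hσ _ (by simp)
    · intro z hz
      have hne : z ≠ p.2 := fun h => hl.1 (h ▸ hz)
      rw [Perm.mul_apply, swap_apply_of_ne_of_ne (by simp) (by simpa using hne)]
      exact hσ z (by simp only [List.map_cons, List.mem_cons, hz, or_true])

theorem cycProd_sandwich {R : Type} [CommMonoid R] (P : ℕ → R) (hP : P 0 = 1) (hP1 : P 1 = 1)
    (l l' : List (Fin m × Z)) (hl : (l.map Prod.snd).Nodup) (hl' : (l'.map Prod.snd).Nodup)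
    (hd : ∀ z ∈ l.map Prod.snd, z ∉ l'.map Prod.snd) (α : Perm (Fin m)) :
    cycProd P (fun _ => 1) ((swl l)⁻¹ * Perm.sumCongr α 1 * swl l') =
      cycProd P (fun i => 1 + l.countP (fun p => p.1 = i) + l'.countP (fun p => p.1 = i)) α := by
  rw [cycProd_mul_swl P hP l' hl', ← cycProd_inv, mul_inv_rev, inv_inv, cycProd_mul_swl P hP l hl,
    cycProd_inv]
  · have : wl l (wl l' fun _ => 1) = Sum.elim (fun i => 1 + l.countP (fun p => p.1 = i)
        + l'.countP (fun p => p.1 = i)) (fun z => wl l (wl l' fun _ => 1) (Sum.inr z)) := by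
      ext (i | z)
      · rw [wl_inl l hl, wl_inl l' hl']
        · simp; ring
        · intro z _; rfl
        · intro z hz
          rw [wl_inr, if_neg (hd z hz)]
      · rfl
    rw [this, cycProd_sumCongr, cycProd_id]
    convert mul_one _
    apply Finset.prod_eq_one
    intro z _
    rw [wl_inr, wl_inr]
    split_ifs <;> simp [hP, hP1]
  · intro z _
    rw [Perm.sumCongr_inv]; simp
  · intro z hz
    have h1 : z ∉ l.map Prod.snd := fun h => hd z h hz
    rw [Perm.mul_apply]
    simp only [Perm.sumCongr_apply, Sum.map_inr, Perm.one_apply]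
    rw [Perm.inv_eq_iff_eq, swl_fix l z h1]

noncomputable def lkd {D : ℕ} {K : ℕ} (k : Fin K) (d : Fin m → Fin (D + 1)) :
    List (Fin m × (Fin K × Fin m × Fin D)) :=
  (univ.filter (fun ij : Fin m × Fin D => (ij.2 : ℕ) < d ij.1)).toList.map
    (fun ij => (ij.1, (k, ij.1, ij.2)))

theorem lkd_nodup {D K : ℕ} (k : Fin K) (d : Fin m → Fin (D + 1)) :
    ((lkd k d).map Prod.snd).Nodup := by
  unfold lkd
  rw [List.map_map]
  refine List.Nodup.map ?_ (Finset.nodup_toList _)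
  rintro ⟨a, b⟩ ⟨c, e⟩ h
  simpa using h

theorem lkd_disj {D K : ℕ} {k k' : Fin K} (hk : k ≠ k') (d d' : Fin m → Fin (D + 1)) :
    ∀ z ∈ (lkd k d).map Prod.snd, z ∉ (lkd k' d').map Prod.snd := by
  intro z hz hz'
  unfold lkd at hz hz'
  rw [List.map_map, List.mem_map] at hz hz'
  obtain ⟨a, _, rfl⟩ := hz
  obtain ⟨b, _, hb⟩ := hz'
  simp at hb
  exact hk hb.1.symm

theorem lkd_count {D K : ℕ} (k : Fin K) (d : Fin m → Fin (D + 1)) (i : Fin m) :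
    (lkd k d).countP (fun p => p.1 = i) = d i := by
  unfold lkd
  rw [List.countP_map, List.countP_eq_length_filter]
  have h1 : ((univ.filter (fun ij : Fin m × Fin D => (ij.2 : ℕ) < d ij.1)).toList.filter
    ((fun p : Fin m × (Fin K × Fin m × Fin D) => decide (p.1 = i)) ∘ fun ij => (ij.1, (k, ij.1, ij.2)))).length =
      ((univ.filter (fun ij : Fin m × Fin D => (ij.2 : ℕ) < d ij.1)).filter (fun ij => ij.1 = i)).card := by
    have e0 : ((fun p : Fin m × (Fin K × Fin m × Fin D) => decide (p.1 = i)) ∘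
      fun ij : Fin m × Fin D => (ij.1, (k, ij.1, ij.2))) = fun ij => decide (ij.1 = i) := rfl
    rw [e0, ← Multiset.coe_card, ← Multiset.filter_coe, Finset.coe_toList]
    rw [Finset.card_def, Finset.filter_val, Finset.filter_val, Finset.filter_val]
  rw [h1, Finset.filter_filter]
  have h2 : (univ.filter (fun ij : Fin m × Fin D => (ij.2 : ℕ) < d ij.1 ∧ ij.1 = i)) =
      (univ.filter (fun j : Fin D => (j : ℕ) < d i)).map ⟨fun j => (i, j), fun a b h => by simpa using h⟩ := by
    ext ⟨a, b⟩
    simp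
    constructor
    · rintro ⟨h, rfl⟩; exact ⟨b, h, rfl⟩
    · rintro ⟨x, h, h'⟩
      have h2 : (i, x) = (a, b) := h'
      rw [Prod.mk.injEq] at h2
      obtain ⟨rfl, rfl⟩ := h2
      exact ⟨h, rfl⟩
  rw [h2, Finset.card_map]
  have := (d i).2
  rw [Fin.card_filter_val_lt]
  omega

theorem copies_nonneg (c C : ℝ) (H : ∀ K : ℕ, 0 ≤ K * C + K * (K - 1) * c) : 0 ≤ c := by
  by_contra hc
  push Not at hc
  obtain ⟨N, hN⟩ := exists_nat_gt (C / (-c) + 1)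
  have h := H (N + 1)
  push_cast at h
  have h1 : 0 ≤ ((N:ℝ) + 1) * (C + N * c) := by linarith
  have h2 : 0 ≤ C + N * c := by
    by_contra h3
    push Not at h3
    have : (0:ℝ) < N + 1 := by positivity
    nlinarith
  have h3 : C / (-c) < N := by linarith
  rw [div_lt_iff₀ (by linarith)] at h3
  linarith

noncomputable def sg (e : ℤˣ) (σ : Perm (Fin m)) : ℝ := if e = 1 then 1 else ((sign σ : ℤ) : ℝ)

theorem sg_mul (e : ℤˣ) (σ τ : Perm (Fin m)) : sg e (σ * τ) = sg e σ * sg e τ := by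
  unfold sg; split_ifs <;> simp

theorem sg_inv (e : ℤˣ) (σ : Perm (Fin m)) : sg e σ⁻¹ = sg e σ := by
  unfold sg; split_ifs <;> simp

theorem E_nonneg {f : Multiset ℕ → ℝ} (hf : f ∈ KK) (P : ℕ → ℝ) (hP : P 0 = 1) (hP1 : P 1 = 1)
    (hfP : ∀ (n : ℕ) (σ : Perm (Fin n)), f (ct σ) = cycProd P (fun _ => 1) σ)
    (e : ℤˣ) (m D : ℕ) (a : Fin (D + 1) → ℝ) :
    0 ≤ ∑ α : Perm (Fin m), sg e α * ∑ d : Fin m → Fin (D + 1), ∑ d' : Fin m → Fin (D + 1),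
      (∏ i, a (d i)) * (∏ i, a (d' i)) * cycProd P (fun i => 1 + (d i : ℕ) + d' i) α := by
  set E := ∑ α : Perm (Fin m), sg e α * ∑ d : Fin m → Fin (D + 1), ∑ d' : Fin m → Fin (D + 1),
      (∏ i, a (d i)) * (∏ i, a (d' i)) * cycProd P (fun i => 1 + (d i : ℕ) + d' i) α with hE
  have hfP' : ∀ (X : Type) [Fintype X] (σ : Perm X), f (ct σ) = cycProd P (fun _ => 1) σ := by
    intro X _ σ
    rw [← ct_equiv (Fintype.equivFin X), hfP, cycProd_equiv]; rfl
  let ι := Perm (Fin m) × (Fin m → Fin (D + 1))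
  let x : ι → ℝ := fun b => sg e b.1 * ∏ i, a (b.2 i)
  -- off diagonal sum
  have hc : ∑ b : ι, ∑ b' : ι, x b * x b' *
      cycProd P (fun i => 1 + (b.2 i : ℕ) + b'.2 i) (b.1⁻¹ * b'.1) = (m.factorial : ℝ) * E := by
    simp only [ι, Fintype.sum_prod_type, x]
    have step : ∀ β : Perm (Fin m), ∑ d : Fin m → Fin (D + 1), ∑ β' : Perm (Fin m),
        ∑ d' : Fin m → Fin (D + 1),
        sg e β * (∏ i, a (d i)) * (sg e β' * ∏ i, a (d' i)) *
          cycProd P (fun i => 1 + (d i : ℕ) + d' i) (β⁻¹ * β') = E := by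
      intro β
      rw [Finset.sum_comm, ← Equiv.sum_comp (Equiv.mulLeft β), hE]
      refine Finset.sum_congr rfl (fun α _ => ?_)
      simp only [Equiv.coe_mulLeft, inv_mul_cancel_left, sg_mul, Finset.mul_sum]
      refine Finset.sum_congr rfl (fun d _ => Finset.sum_congr rfl (fun d' _ => ?_))
      have : sg e β * sg e β = 1 := by
        unfold sg
        split_ifs
        · norm_num
        · rcases Int.units_eq_one_or (sign β) with h | h <;> simp [h]
      linear_combination (sg e α * (∏ i, a (d i)) * (∏ i, a (d' i)) *
        cycProd P (fun i => 1 + (d i : ℕ) + d' i) α) * this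
    simp only [step]
    rw [Finset.sum_const, Finset.card_univ, Fintype.card_perm, Fintype.card_fin, nsmul_eq_mul]
  suffices h : 0 ≤ (m.factorial : ℝ) * E by
    have hm : (0 : ℝ) < m.factorial := by exact_mod_cast Nat.factorial_pos m
    exact nonneg_of_mul_nonneg_right h hm
  refine copies_nonneg _ (∑ b : ι, ∑ b' : ι, |x b * x b'|) ?_
  intro K
  have h := hf.2.pd.gen (X := Fin m ⊕ (Fin K × Fin m × Fin D)) (ι := Fin K × ι)
    (fun q => Perm.sumCongr q.2.1 1 * swl (lkd q.1 q.2.2)) (fun q => x q.2)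
  rw [Fintype.sum_prod_type] at h
  refine h.trans ?_
  have hterm : ∀ k : Fin K, ∑ b : ι, ∑ q : Fin K × ι, x b * x q.2 * f (ct ((Perm.sumCongr b.1 1 * swl (lkd k b.2))⁻¹ *
      (Perm.sumCongr q.2.1 1 * swl (lkd q.1 q.2.2)))) ≤
      (∑ b : ι, ∑ b' : ι, |x b * x b'|) + ((K : ℝ) - 1) * (m.factorial * E) := by
    intro k
    simp only [Fintype.sum_prod_type (α₁ := Fin K)]
    rw [Finset.sum_comm, ← Finset.add_sum_erase _ _ (Finset.mem_univ k)]
    apply add_le_add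
    · refine Finset.sum_le_sum (fun b _ => Finset.sum_le_sum (fun b' _ => ?_))
      refine (le_abs_self _).trans ?_
      rw [abs_mul]
      have := hf.2.bound (ct ((Perm.sumCongr b.1 1 * swl (lkd k b.2))⁻¹ *
        (Perm.sumCongr b'.1 1 * swl (lkd k b'.2))))
      rw [hf.1] at this
      exact mul_le_of_le_one_right (abs_nonneg _) this
    · rw [← hc]
      have : ∀ k' ∈ univ.erase k, ∑ b : ι, ∑ b' : ι, x b * x b' * f (ct ((Perm.sumCongr b.1 1 * swl (lkd k b.2))⁻¹ *
          (Perm.sumCongr b'.1 1 * swl (lkd k' b'.2)))) = ∑ b : ι, ∑ b' : ι, x b * x b' *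
            cycProd P (fun i => 1 + (b.2 i : ℕ) + b'.2 i) (b.1⁻¹ * b'.1) := by
        intro k' hk'
        refine Finset.sum_congr rfl (fun b _ => Finset.sum_congr rfl (fun b' _ => ?_))
        congr 1
        rw [hfP']
        have e1 : (Perm.sumCongr b.1 1 * swl (lkd k b.2))⁻¹ *
          (Perm.sumCongr b'.1 1 * swl (lkd k' b'.2)) = (swl (lkd k b.2))⁻¹ *
            Perm.sumCongr (b.1⁻¹ * b'.1) 1 * swl (lkd k' b'.2) := by
          have : Perm.sumCongr (b.1⁻¹ * b'.1) (1 : Perm (Fin K × Fin m × Fin D)) =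
              (Perm.sumCongr b.1 1)⁻¹ * Perm.sumCongr b'.1 1 := by
            rw [Perm.sumCongr_inv, Perm.sumCongr_mul]; simp
          rw [this]; group
        rw [e1, cycProd_sandwich P hP hP1 _ _ (lkd_nodup _ _) (lkd_nodup _ _)
          (lkd_disj (Ne.symm (Finset.mem_erase.1 hk').1) _ _)]
        apply cycProd_ext
        intro i
        rw [lkd_count, lkd_count]
      rw [Finset.sum_congr rfl this, Finset.sum_const, Finset.card_erase_of_mem (Finset.mem_univ _)]
      have hK : 1 ≤ K := Nat.one_le_iff_ne_zero.2 (by rintro rfl; exact k.elim0)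
      simp [Nat.cast_sub hK]
  refine (Finset.sum_le_sum (fun k _ => hterm k)).trans ?_
  rw [Finset.sum_const]
  simp
  apply le_of_eq; ring

end ee
end UT

/- part P4 -/

set_option linter.unusedSectionVars false
set_option linter.unusedSimpArgs false
namespace UT
section mom
open scoped Polynomial Topology
open Finset MeasureTheory Filter

/-- moment functional -/
noncomputable def LL (P : ℕ → ℝ) : ℝ[X] →ₗ[ℝ] ℝ :=
  Polynomial.lsum (fun k => (P (k + 1)) • LinearMap.id)

theorem LL_X (P : ℕ → ℝ) (k : ℕ) : LL P (Polynomial.X ^ k) = P (k + 1) := by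
  rw [Polynomial.X_pow_eq_monomial]
  simp [LL, Polynomial.lsum_apply, Polynomial.sum_monomial_index]

variable {P : ℕ → ℝ}

theorem LL_sq (hpos : ∀ (D : ℕ) (a : Fin (D + 1) → ℝ), 0 ≤ ∑ d, ∑ d', a d * a d' * P (1 + d + d'))
    (g : ℝ[X]) : 0 ≤ LL P (g * g) := by
  have h := hpos g.natDegree (fun d => g.coeff d)
  convert h using 1
  conv_lhs => rw [g.as_sum_range_C_mul_X_pow, Finset.sum_mul_sum, map_sum]
  rw [Finset.sum_range]
  refine Finset.sum_congr rfl (fun d _ => ?_)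
  rw [map_sum, Finset.sum_range]
  refine Finset.sum_congr rfl (fun d' _ => ?_)
  have : Polynomial.C (g.coeff d) * Polynomial.X ^ (d : ℕ) * (Polynomial.C (g.coeff d') * Polynomial.X ^ (d' : ℕ))
    = (g.coeff d * g.coeff d') • (Polynomial.X ^ ((d : ℕ) + d') : ℝ[X]) := by
    rw [Polynomial.smul_eq_C_mul, pow_add, Polynomial.C_mul]; ring
  rw [this, map_smul, LL_X, smul_eq_mul]
  congr 2
  ring

theorem LL_bdd (hb : ∀ k, |P k| ≤ 1) (g : ℝ[X]) : ∃ C, ∀ k, LL P (Polynomial.X ^ k * g) ≤ C := by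
  refine ⟨∑ i ∈ range (g.natDegree + 1), |g.coeff i|, fun k => ?_⟩
  conv_lhs => rw [g.as_sum_range_C_mul_X_pow, Finset.mul_sum, map_sum]
  refine Finset.sum_le_sum (fun i _ => ?_)
  have : (Polynomial.X ^ k * (Polynomial.C (g.coeff i) * Polynomial.X ^ i) : ℝ[X]) =
    (g.coeff i) • (Polynomial.X ^ (k + i) : ℝ[X]) := by
    rw [Polynomial.smul_eq_C_mul, pow_add]; ring
  rw [this, map_smul, LL_X, smul_eq_mul]
  refine (le_abs_self _).trans ?_
  rw [abs_mul]
  exact mul_le_of_le_one_right (abs_nonneg _) (hb _)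

theorem cs_aux (A B C : ℝ) (h : ∀ s t : ℝ, 0 ≤ s * s * A + 2 * s * t * B + t * t * C) : B ^ 2 ≤ A * C := by
  have hA : 0 ≤ A := by simpa using h 1 0
  rcases hA.eq_or_lt with h0 | h0
  · subst h0
    by_contra hB
    push Not at hB
    have hB0 : B ≠ 0 := by rintro rfl; simp at hB
    have h2 := h (-(C + 1) / (B)) 1
    have e : 2 * (-(C + 1) / B) * 1 * B = -2 * (C + 1) := by field_simp
    rw [e] at h2
    have h3 := h 0 1
    linarith
  · have := h (-B) A
    nlinarith

theorem logconvex_le (a : ℕ → ℝ) (h0 : ∀ k, 0 ≤ a k) (h : ∀ k, a (k + 1) ^ 2 ≤ a k * a (k + 2))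
    (C : ℝ) (hC : ∀ k, a k ≤ C) : a 1 ≤ a 0 := by
  by_contra hlt
  push Not at hlt
  rcases (h0 0).eq_or_lt with h1 | h1
  · have := h 0
    rw [← h1] at this hlt
    simp at this
    nlinarith
  · have step : ∀ k, 0 < a k ∧ a k * a 1 ≤ a (k + 1) * a 0 := by
      intro k
      induction k with
      | zero => exact ⟨h1, by linarith⟩
      | succ k ih =>
        obtain ⟨ha, hb⟩ := ih
        have h2 : 0 < a (k + 1) := by
          by_contra hh
          push Not at hh
          nlinarith
        refine ⟨h2, ?_⟩
        have h3 := h k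
        have : a k * (a (k + 1) * a 1) ≤ a k * (a (k + 2) * a 0) := by
          nlinarith
        exact le_of_mul_le_mul_left this ha
    have grow : ∀ k, a 0 * (a 1 / a 0) ^ k ≤ a k := by
      intro k
      induction k with
      | zero => simp
      | succ k ih =>
        have := (step k).2
        have h4 : a k * (a 1 / a 0) ≤ a (k + 1) := by
          rw [← mul_div_assoc, div_le_iff₀ h1]; exact this
        refine le_trans ?_ h4
        rw [pow_succ, ← mul_assoc]
        exact mul_le_mul_of_nonneg_right ih (div_nonneg (h0 1) (h0 0))
    have h5 : 1 < a 1 / a 0 := by rw [lt_div_iff₀ h1]; linarith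
    obtain ⟨k, hk⟩ := pow_unbounded_of_one_lt (C / a 0) h5
    rw [div_lt_iff₀ h1] at hk
    have := grow k
    have := hC k
    linarith


theorem LL_cs
    (hpos : ∀ (D : ℕ) (a : Fin (D + 1) → ℝ), 0 ≤ ∑ d, ∑ d', a d * a d' * P (1 + d + d'))
    (g h : ℝ[X]) : LL P (g * h) ^ 2 ≤ LL P (g * g) * LL P (h * h) := by
  apply cs_aux
  intro s t
  have := LL_sq hpos (s • g + t • h)
  have e : (s • g + t • h) * (s • g + t • h) = (s * s) • (g * g) + (2 * s * t) • (g * h) + (t * t) • (h * h) := by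
    simp only [Polynomial.smul_eq_C_mul, map_mul, map_ofNat]
    ring
  rw [e] at this
  simpa using this

theorem LL_x2
    (hpos : ∀ (D : ℕ) (a : Fin (D + 1) → ℝ), 0 ≤ ∑ d, ∑ d', a d * a d' * P (1 + d + d'))
    (hb : ∀ k, |P k| ≤ 1) (g : ℝ[X]) : LL P (Polynomial.X ^ 2 * (g * g)) ≤ LL P (g * g) := by
  have := logconvex_le (fun k => LL P (Polynomial.X ^ (2 * k) * (g * g))) ?_ ?_ _ (fun k => (LL_bdd hb (g * g)).choose_spec (2 * k))
  · simpa using this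
  · intro k
    have := LL_sq hpos (Polynomial.X ^ k * g)
    convert this using 2
    ring
  · intro k
    have := LL_cs hpos (Polynomial.X ^ k * g) (Polynomial.X ^ (k + 2) * g)
    convert this using 3 <;> ring

theorem LL_x
    (hpos : ∀ (D : ℕ) (a : Fin (D + 1) → ℝ), 0 ≤ ∑ d, ∑ d', a d * a d' * P (1 + d + d'))
    (hb : ∀ k, |P k| ≤ 1) (g : ℝ[X]) : |LL P (Polynomial.X * (g * g))| ≤ LL P (g * g) := by
  have h := LL_cs hpos g (Polynomial.X * g)
  have h2 := LL_x2 hpos hb g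
  have h0 := LL_sq hpos g
  apply abs_le_of_sq_le_sq _ h0
  have e1 : g * (Polynomial.X * g) = Polynomial.X * (g * g) := by ring
  have e2 : (Polynomial.X * g) * (Polynomial.X * g) = Polynomial.X ^ 2 * (g * g) := by ring
  rw [e1, e2] at h
  nlinarith

theorem LL_bern
    (hpos : ∀ (D : ℕ) (a : Fin (D + 1) → ℝ), 0 ≤ ∑ d, ∑ d', a d * a d' * P (1 + d + d'))
    (hb : ∀ k, |P k| ≤ 1) (i j : ℕ) : 0 ≤ LL P ((1 + Polynomial.X) ^ i * (1 - Polynomial.X) ^ j) := by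
  set X : ℝ[X] := Polynomial.X with hX
  obtain ⟨a, ha⟩ := Nat.even_or_odd' i
  obtain ⟨b, hb'⟩ := Nat.even_or_odd' j
  set g : ℝ[X] := (1 + X) ^ a * (1 - X) ^ b with hg
  have h0 := LL_sq hpos g
  have h1 := abs_le.1 (LL_x hpos hb g)
  have h2 := LL_x2 hpos hb g
  rcases ha with rfl | rfl <;> rcases hb' with rfl | rfl
  · convert h0 using 2; rw [hg]; ring
  · have : (1 + X) ^ (2 * a) * (1 - X) ^ (2 * b + 1) = g * g - X * (g * g) := by rw [hg]; ring
    rw [this, map_sub]; linarith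
  · have : (1 + X) ^ (2 * a + 1) * (1 - X) ^ (2 * b) = g * g + X * (g * g) := by rw [hg]; ring
    rw [this, map_add]; linarith
  · have : (1 + X) ^ (2 * a + 1) * (1 - X) ^ (2 * b + 1) = g * g - X ^ 2 * (g * g) := by rw [hg]; ring
    rw [this, map_sub]; linarith

theorem desc_sum (T S : ℝ[X]) (hTS : T + S = 1) (j n : ℕ) :
    ∑ k ∈ range (n + 1), ((n.choose k * k.descFactorial j : ℕ) : ℝ[X]) * (T ^ k * S ^ (n - k)) =
      ((n.descFactorial j : ℕ) : ℝ[X]) * T ^ j := by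
  induction j generalizing n with
  | zero =>
    have := add_pow T S n
    rw [hTS, one_pow] at this
    simp only [Nat.descFactorial_zero, mul_one, Nat.cast_one, pow_zero]
    rw [this]
    refine Finset.sum_congr rfl (fun k _ => by ring)
  | succ j ih =>
    cases n with
    | zero => simp
    | succ n =>
      rw [Finset.sum_range_succ']
      simp only [Nat.zero_descFactorial_succ, mul_zero, Nat.cast_zero, zero_mul, add_zero]
      rw [Nat.succ_descFactorial_succ, pow_succ]
      have := ih n
      calc _ = ∑ k ∈ range (n + 1), ((n + 1 : ℕ) : ℝ[X]) * T *
            (((n.choose k * k.descFactorial j : ℕ) : ℝ[X]) * (T ^ k * S ^ (n - k))) := by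
              refine Finset.sum_congr rfl (fun k _ => ?_)
              rw [Nat.succ_descFactorial_succ, Nat.add_sub_add_right]
              have : (n + 1).choose (k + 1) * ((k + 1) * k.descFactorial j) =
                  (n + 1) * (n.choose k * k.descFactorial j) := by
                rw [← mul_assoc, ← Nat.add_one_mul_choose_eq, mul_assoc]
              rw [this]; push_cast; ring
        _ = _ := by rw [← Finset.mul_sum, this]; push_cast; ring

theorem desc_ratio (n k j : ℕ) (hk : k ≤ n) (hj : j ≤ n) (hn : 0 < n) :
    |((k.descFactorial j : ℝ) / n.descFactorial j) - ((k : ℝ) / n) ^ j| ≤ (j : ℝ) ^ 2 / n := by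
  have hn' : (0:ℝ) < n := by exact_mod_cast hn
  have hkn : (k : ℝ) ≤ n := by exact_mod_cast hk
  induction j with
  | zero => simp
  | succ j ih =>
    have ih := ih (by omega)
    have hjn : (j : ℝ) + 1 ≤ n := by exact_mod_cast hj
    have e : ((k.descFactorial (j + 1) : ℝ) / n.descFactorial (j + 1)) =
      (((k - j : ℕ) : ℝ) / (n - j : ℕ)) * (k.descFactorial j / n.descFactorial j) := by
      rw [Nat.descFactorial_succ, Nat.descFactorial_succ]; push_cast
      rw [mul_div_mul_comm]
    have hr : |(k.descFactorial j : ℝ) / n.descFactorial j| ≤ 1 := by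
      rw [abs_of_nonneg (by positivity)]
      apply div_le_one_of_le₀ _ (by positivity)
      exact_mod_cast Nat.descFactorial_le j hk
    have hb : |(k : ℝ) / n| ≤ 1 := by
      rw [abs_of_nonneg (by positivity)]
      exact div_le_one_of_le₀ hkn (by positivity)
    have hab : |(((k - j : ℕ) : ℝ) / (n - j : ℕ)) - k / n| ≤ j / n := by
      have hnj : (0:ℝ) < (n : ℝ) - j := by linarith
      rw [Nat.cast_sub (by omega : j ≤ n)]
      by_cases h : j ≤ k
      · rw [Nat.cast_sub h]
        have hjk : (j : ℝ) ≤ k := by exact_mod_cast h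
        have : ((k : ℝ) - j) / (n - j) - k / n = - ((j / n) * ((n - k) / (n - j))) := by
          field_simp; ring
        rw [this, abs_neg, abs_of_nonneg (mul_nonneg (by positivity) (div_nonneg (by linarith) hnj.le))]
        apply mul_le_of_le_one_right (by positivity)
        apply div_le_one_of_le₀ (by linarith) hnj.le
      · push Not at h
        have : (k : ℝ) ≤ j := by exact_mod_cast h.le
        rw [Nat.sub_eq_zero_of_le h.le]
        simp
        rw [abs_of_nonneg (by positivity)]
        gcongr
    rw [e, pow_succ]
    set a := (((k - j : ℕ) : ℝ) / (n - j : ℕ))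
    set r := (k.descFactorial j : ℝ) / n.descFactorial j
    set b := (k : ℝ) / n
    have : a * r - b ^ j * b = (a - b) * r + b * (r - b ^ j) := by ring
    rw [this]
    refine (abs_add_le _ _).trans ?_
    rw [abs_mul, abs_mul]
    have h1 : |a - b| * |r| ≤ j / n := (mul_le_of_le_one_right (abs_nonneg _) hr).trans hab
    have h2 : |b| * |r - b ^ j| ≤ (j : ℝ) ^ 2 / n := (mul_le_of_le_one_left (abs_nonneg _) hb).trans ih
    refine (add_le_add h1 h2).trans ?_
    rw [← add_div]
    gcongr
    push_cast
    nlinarith [(Nat.cast_nonneg j : (0:ℝ) ≤ j)]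

/-- the interval -/
abbrev JJ : Type := Set.Icc (-1 : ℝ) 1

noncomputable def gridpt (n k : ℕ) : JJ :=
  ⟨2 * (min 1 ((k : ℝ) / n)) - 1, by
    have h0 : (0 : ℝ) ≤ min 1 ((k : ℝ) / n) := le_min (by norm_num) (by positivity)
    have h1 : min 1 ((k : ℝ) / n) ≤ 1 := min_le_left _ _
    constructor <;> linarith⟩

theorem moment (hP1 : P 1 = 1)
    (hpos : ∀ (D : ℕ) (a : Fin (D + 1) → ℝ), 0 ≤ ∑ d, ∑ d', a d * a d' * P (1 + d + d'))
    (hb : ∀ k, |P k| ≤ 1) :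
    ∃ μ : Measure JJ, IsProbabilityMeasure μ ∧ ∀ k : ℕ, ∫ x, (x : ℝ) ^ k ∂μ = P (k + 1) := by
  set T : ℝ[X] := Polynomial.C (1 / 2) * (1 + Polynomial.X) with hT
  set S : ℝ[X] := Polynomial.C (1 / 2) * (1 - Polynomial.X) with hS
  have hTS : T + S = 1 := by
    have : T + S = Polynomial.C (1 / 2 * 2) := by rw [hT, hS, Polynomial.C_mul, Polynomial.C_ofNat]; ring
    rw [this]; norm_num
  set w : ℕ → ℕ → ℝ := fun n k => LL P ((n.choose k : ℝ[X]) * (T ^ k * S ^ (n - k))) with hw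
  have hw0 : ∀ n k, 0 ≤ w n k := by
    intro n k
    have : (n.choose k : ℝ[X]) * (T ^ k * S ^ (n - k)) =
      ((n.choose k : ℝ) * ((1 / 2) ^ k * (1 / 2) ^ (n - k))) • ((1 + Polynomial.X) ^ k * (1 - Polynomial.X) ^ (n - k)) := by
      rw [hT, hS, mul_pow, mul_pow, Polynomial.smul_eq_C_mul]
      simp only [Polynomial.C_mul, Polynomial.C_pow, map_natCast]
      ring
    simp only [hw]
    rw [this, map_smul, smul_eq_mul]
    exact mul_nonneg (by positivity) (LL_bern hpos hb k (n - k))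
  have hLT : ∀ j n, j ≤ n → LL P (T ^ j) = ∑ k ∈ range (n + 1), w n k * (k.descFactorial j / n.descFactorial j) := by
    intro j n hj
    have hne : (n.descFactorial j : ℝ) ≠ 0 := by
      exact_mod_cast (Nat.descFactorial_pos.2 hj).ne'
    have h := congrArg (LL P) (desc_sum T S hTS j n)
    rw [map_sum] at h
    have e1 : ((n.descFactorial j : ℕ) : ℝ[X]) * T ^ j = (n.descFactorial j : ℝ) • T ^ j := by
      rw [Polynomial.smul_eq_C_mul, map_natCast]
    rw [e1, map_smul, smul_eq_mul] at h
    have : LL P (T ^ j) = (n.descFactorial j : ℝ)⁻¹ * ((n.descFactorial j : ℝ) * LL P (T ^ j)) := by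
      field_simp
    rw [this, ← h, Finset.mul_sum]
    refine Finset.sum_congr rfl (fun k _ => ?_)
    have e2 : ((n.choose k * k.descFactorial j : ℕ) : ℝ[X]) * (T ^ k * S ^ (n - k)) =
      (k.descFactorial j : ℝ) • ((n.choose k : ℝ[X]) * (T ^ k * S ^ (n - k))) := by
      rw [Polynomial.smul_eq_C_mul, map_natCast]; push_cast; ring
    rw [e2, map_smul, smul_eq_mul]
    simp only [hw]
    field_simp
  have hw1 : ∀ n, ∑ k ∈ range (n + 1), w n k = 1 := by
    intro n
    have := hLT 0 n (Nat.zero_le _)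
    have h1 := LL_X P 0
    simp only [pow_zero, zero_add, hP1] at h1
    simp only [pow_zero, Nat.descFactorial_zero, Nat.cast_one, div_one, mul_one] at this
    rw [← this, h1]
  let μ : ℕ → Measure JJ := fun n => ∑ k ∈ range (n + 1), (ENNReal.ofReal (w n k)) • Measure.dirac (gridpt n k)
  have hμp : ∀ n, IsProbabilityMeasure (μ n) := by
    intro n
    constructor
    simp only [μ, Measure.coe_finsetSum, Finset.sum_apply, Measure.smul_apply, measure_univ, smul_eq_mul, mul_one]
    rw [← ENNReal.ofReal_sum_of_nonneg (fun k _ => hw0 n k), hw1, ENNReal.ofReal_one]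
  have hμi : ∀ n (h : JJ → ℝ), ∫ x, h x ∂(μ n) = ∑ k ∈ range (n + 1), w n k * h (gridpt n k) := by
    intro n h
    simp only [μ]
    rw [integral_finsetSum_measure]
    · refine Finset.sum_congr rfl (fun k _ => ?_)
      rw [integral_smul_measure, integral_dirac, ENNReal.toReal_ofReal (hw0 n k), smul_eq_mul]
    · intro k _
      exact (integrable_dirac (by simp)).smul_measure ENNReal.ofReal_ne_top
  let ν : ℕ → ProbabilityMeasure JJ := fun n => ⟨μ n, hμp n⟩
  obtain ⟨ρ, hρ⟩ : ∃ ρ : ProbabilityMeasure JJ, MapClusterPt ρ atTop ν := exists_clusterPt_of_compactSpace _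
  refine ⟨ρ, inferInstance, ?_⟩
  have key : ∀ j, ∫ x : JJ, ((1 + (x : ℝ)) / 2) ^ j ∂(ρ : Measure JJ) = LL P (T ^ j) := by
    intro j
    let φ : BoundedContinuousFunction JJ ℝ := BoundedContinuousFunction.mkOfCompact ⟨fun x => ((1 + (x : ℝ)) / 2) ^ j, by fun_prop⟩
    have hc : Continuous (fun ν : ProbabilityMeasure JJ => ∫ x, φ x ∂(ν : Measure JJ)) :=
      ProbabilityMeasure.continuous_integral_boundedContinuousFunction φ
    have h1 : MapClusterPt (∫ x, φ x ∂(ρ : Measure JJ)) atTop (fun n => ∫ x, φ x ∂(ν n : Measure JJ)) :=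
      hρ.continuousAt_comp hc.continuousAt
    have h2 : Tendsto (fun n => ∫ x, φ x ∂(ν n : Measure JJ)) atTop (𝓝 (LL P (T ^ j))) := by
      rw [tendsto_iff_norm_sub_tendsto_zero]
      refine squeeze_zero' (Eventually.of_forall fun _ => norm_nonneg _) ?_
        (tendsto_const_div_atTop_nhds_zero_nat ((j : ℝ) ^ 2))
      filter_upwards [eventually_ge_atTop (j + 1)] with n hn
      have e1 : ∫ x, φ x ∂(ν n : Measure JJ) = ∑ k ∈ range (n + 1), w n k * ((k : ℝ) / n) ^ j := by
        rw [show (ν n : Measure JJ) = μ n from rfl, hμi]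
        refine Finset.sum_congr rfl (fun k hk => ?_)
        have hkn : (k : ℝ) / n ≤ 1 := div_le_one_of_le₀ (by exact_mod_cast Nat.lt_succ_iff.1 (Finset.mem_range.1 hk)) (by positivity)
        congr 1
        change ((1 + (2 * (min 1 ((k : ℝ) / n)) - 1)) / 2) ^ j = _
        rw [min_eq_right hkn]; ring
      rw [e1, hLT j n (by omega), ← Finset.sum_sub_distrib, Real.norm_eq_abs]
      refine (Finset.abs_sum_le_sum_abs _ _).trans ?_
      calc _ ≤ ∑ k ∈ range (n + 1), w n k * ((j : ℝ) ^ 2 / n) := by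
            refine Finset.sum_le_sum (fun k hk => ?_)
            rw [← mul_sub, abs_mul, abs_of_nonneg (hw0 n k), abs_sub_comm]
            exact mul_le_mul_of_nonneg_left (desc_ratio n k j (Nat.lt_succ_iff.1 (Finset.mem_range.1 hk)) (by omega) (by omega)) (hw0 n k)
        _ = _ := by rw [← Finset.sum_mul, hw1, one_mul]
    exact eq_of_nhds_neBot (ClusterPt.mono h1 h2)
  intro k
  rw [← LL_X P k]
  have hX : (Polynomial.X : ℝ[X]) = Polynomial.C 2 * T + Polynomial.C (-1) := by
    have : Polynomial.C 2 * T + Polynomial.C (-1) = Polynomial.C (2 * (1 / 2)) * (1 + Polynomial.X) - 1 := by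
      rw [hT, Polynomial.C_mul]; simp; ring
    rw [this]; norm_num
  rw [hX, add_pow, map_sum]
  have e3 : ∀ x : JJ, (x : ℝ) ^ k = ∑ m ∈ range (k + 1), (2 ^ m * (-1) ^ (k - m) * (k.choose m)) * ((1 + (x : ℝ)) / 2) ^ m := by
    intro x
    have : (x : ℝ) = 2 * ((1 + (x : ℝ)) / 2) + (-1) := by ring
    conv_lhs => rw [this, add_pow]
    refine Finset.sum_congr rfl (fun m _ => by rw [mul_pow]; ring)
  simp_rw [e3]
  rw [integral_finsetSum]
  · refine Finset.sum_congr rfl (fun m _ => ?_)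
    rw [integral_const_mul, key, ← smul_eq_mul, ← map_smul]
    congr 1
    rw [Polynomial.smul_eq_C_mul]
    clear_value T
    simp only [Polynomial.C_mul, Polynomial.C_pow, map_natCast]
    ring
  · intro m _
    refine Integrable.const_mul ?_ _
    have hc : Continuous fun x : JJ => ((1 + (x : ℝ)) / 2) ^ m := by fun_prop
    exact (BoundedContinuousFunction.mkOfCompact ⟨_, hc⟩).integrable _

end mom
end UT

/- part P5 -/

set_option linter.unusedSectionVars false
set_option linter.unusedSimpArgs false
namespace UT
section thoma
open scoped Classical Topology
open Equiv Equiv.Perm Finset MeasureTheory Filter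

noncomputable def pk (μ : Measure JJ) (h : JJ → ℝ) (k : ℕ) : ℝ := ∫ x, h x ^ k * (x : ℝ) ^ (k - 1) ∂μ

theorem fiber_pos {m : ℕ} (α : Perm (Fin m)) (o : CQ α) : 0 < (univ.filter (fun j => cmk α j = o)).card := by
  obtain ⟨j, hj⟩ := cmk_surj α o
  exact Finset.card_pos.2 ⟨j, by simpa using hj⟩

theorem E_int (μ : Measure JJ) [IsProbabilityMeasure μ] (P : ℕ → ℝ) (hμ : ∀ k : ℕ, ∫ x, (x : ℝ) ^ k ∂μ = P (k + 1))
    {m D : ℕ} (a : Fin (D + 1) → ℝ) (α : Perm (Fin m)) :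
    ∑ d : Fin m → Fin (D + 1), ∑ d' : Fin m → Fin (D + 1),
      (∏ i, a (d i)) * (∏ i, a (d' i)) * cycProd P (fun i => 1 + (d i : ℕ) + d' i) α =
    cycProd (pk μ (fun x => (∑ d : Fin (D + 1), a d * (x : ℝ) ^ (d : ℕ)) ^ 2)) (fun _ => 1) α := by
  set g : JJ → ℝ := fun x => ∑ d : Fin (D + 1), a d * (x : ℝ) ^ (d : ℕ) with hg
  let n : CQ α → ℕ := fun o => (univ.filter (fun j => cmk α j = o)).card
  have hn : ∀ o, 0 < n o := fiber_pos α
  have hR : cycProd (pk μ (fun x => (g x) ^ 2)) (fun _ => 1) α =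
      ∫ y : CQ α → JJ, ∏ o, ((g (y o) ^ 2) ^ n o * (y o : ℝ) ^ (n o - 1)) ∂(Measure.pi fun _ => μ) := by
    rw [integral_fintype_prod_eq_prod (f := fun o (x : JJ) => ((g x ^ 2) ^ n o * (x : ℝ) ^ (n o - 1)))]
    unfold cycProd
    refine Finset.prod_congr rfl (fun o _ => ?_)
    simp only [Finset.sum_const, smul_eq_mul, mul_one]
    rfl
  have hLt : ∀ (d d' : Fin m → Fin (D + 1)), cycProd P (fun i => 1 + (d i : ℕ) + d' i) α =
      ∫ y : CQ α → JJ, (∏ o, (y o : ℝ) ^ (n o - 1)) * ((∏ i, (y (cmk α i) : ℝ) ^ (d i : ℕ)) *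
        ∏ i, (y (cmk α i) : ℝ) ^ (d' i : ℕ)) ∂(Measure.pi fun _ => μ) := by
    intro d d'
    have e1 : ∀ y : CQ α → JJ, (∏ o, (y o : ℝ) ^ (n o - 1)) * ((∏ i, (y (cmk α i) : ℝ) ^ (d i : ℕ)) *
        ∏ i, (y (cmk α i) : ℝ) ^ (d' i : ℕ)) = ∏ o, (y o : ℝ) ^ (∑ j with cmk α j = o, (1 + (d j : ℕ) + d' j) - 1) := by
      intro y
      rw [← Finset.prod_mul_distrib, ← Finset.prod_fiberwise (s := univ) (g := cmk α)
        (f := fun i => (y (cmk α i) : ℝ) ^ (d i : ℕ) * (y (cmk α i) : ℝ) ^ (d' i : ℕ)), ← Finset.prod_mul_distrib]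
      refine Finset.prod_congr rfl (fun o _ => ?_)
      have : ∏ i with cmk α i = o, ((y (cmk α i) : ℝ) ^ (d i : ℕ) * (y (cmk α i) : ℝ) ^ (d' i : ℕ)) =
         ∏ i with cmk α i = o, (y o : ℝ) ^ ((d i : ℕ) + d' i) := by
        refine Finset.prod_congr rfl (fun i hi => ?_)
        rw [(Finset.mem_filter.1 hi).2, pow_add]
      rw [this, Finset.prod_pow_eq_pow_sum, ← pow_add]
      congr 1
      simp only [add_assoc]
      simp only [Finset.sum_add_distrib, Finset.sum_const, smul_eq_mul, mul_one]
      have := hn o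
      simp only [n] at this ⊢
      omega
    simp_rw [e1]
    rw [integral_fintype_prod_eq_prod (f := fun o (x : JJ) => (x : ℝ) ^ (∑ j with cmk α j = o, (1 + (d j : ℕ) + d' j) - 1))]
    unfold cycProd
    refine Finset.prod_congr rfl (fun o _ => ?_)
    rw [hμ, Nat.sub_add_cancel]
    refine le_trans (hn o) ?_
    simp only [n]
    rw [Finset.card_eq_sum_ones]
    exact Finset.sum_le_sum (fun j _ => by omega)
  rw [hR]
  simp_rw [hLt, ← integral_const_mul]
  have hIntg : ∀ (d d' : Fin m → Fin (D + 1)), Integrable (fun y : CQ α → JJ => ((∏ i, a (d i)) * (∏ i, a (d' i))) *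
      ((∏ o, (y o : ℝ) ^ (n o - 1)) * ((∏ i, (y (cmk α i) : ℝ) ^ (d i : ℕ)) *
        ∏ i, (y (cmk α i) : ℝ) ^ (d' i : ℕ)))) (Measure.pi fun _ => μ) := by
    intro d d'
    have hc : Continuous (fun y : CQ α → JJ => ((∏ i, a (d i)) * (∏ i, a (d' i))) *
      ((∏ o, (y o : ℝ) ^ (n o - 1)) * ((∏ i, (y (cmk α i) : ℝ) ^ (d i : ℕ)) *
        ∏ i, (y (cmk α i) : ℝ) ^ (d' i : ℕ)))) := by fun_prop
    exact (BoundedContinuousFunction.mkOfCompact ⟨_, hc⟩).integrable _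
  have : ∀ d : Fin m → Fin (D + 1), ∑ d' : Fin m → Fin (D + 1), ∫ y : CQ α → JJ, ((∏ i, a (d i)) * (∏ i, a (d' i))) *
      ((∏ o, (y o : ℝ) ^ (n o - 1)) * ((∏ i, (y (cmk α i) : ℝ) ^ (d i : ℕ)) *
        ∏ i, (y (cmk α i) : ℝ) ^ (d' i : ℕ))) ∂(Measure.pi fun _ => μ) =
      ∫ y : CQ α → JJ, ∑ d' : Fin m → Fin (D + 1), ((∏ i, a (d i)) * (∏ i, a (d' i))) *
      ((∏ o, (y o : ℝ) ^ (n o - 1)) * ((∏ i, (y (cmk α i) : ℝ) ^ (d i : ℕ)) *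
        ∏ i, (y (cmk α i) : ℝ) ^ (d' i : ℕ))) ∂(Measure.pi fun _ => μ) := by
    intro d
    rw [integral_finsetSum _ (fun d' _ => hIntg d d')]
  simp_rw [this]
  rw [← integral_finsetSum _ (fun d _ => integrable_finsetSum _ (fun d' _ => hIntg d d'))]
  refine integral_congr_ae (Eventually.of_forall fun y => ?_)
  have hgp : ∏ i, g (y (cmk α i)) = ∑ d : Fin m → Fin (D + 1), (∏ i, a (d i)) * ∏ i, (y (cmk α i) : ℝ) ^ (d i : ℕ) := by
    simp only [hg]
    rw [Finset.prod_univ_sum, Fintype.piFinset_univ]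
    simp only [Finset.prod_mul_distrib]
  have hg2 : ∏ o, (g (y o) ^ 2) ^ n o = (∏ i, g (y (cmk α i))) * (∏ i, g (y (cmk α i))) := by
    rw [← Finset.prod_mul_distrib, ← Finset.prod_fiberwise (s := univ) (g := cmk α)
        (f := fun i => g (y (cmk α i)) * g (y (cmk α i)))]
    refine Finset.prod_congr rfl (fun o _ => ?_)
    have : ∏ i with cmk α i = o, (g (y (cmk α i)) * g (y (cmk α i))) =
         ∏ i with cmk α i = o, (g (y o) ^ 2) := by
      refine Finset.prod_congr rfl (fun i hi => ?_)
      rw [(Finset.mem_filter.1 hi).2, sq]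
    rw [this, Finset.prod_const]
  simp only
  rw [Finset.prod_mul_distrib, hg2, hgp, Finset.sum_mul_sum, Finset.sum_mul]
  refine Finset.sum_congr rfl (fun d _ => ?_)
  rw [Finset.sum_mul]
  refine Finset.sum_congr rfl (fun d' _ => by ring)


noncomputable def EE (μ : Measure JJ) (e : ℤˣ) (m : ℕ) (h : JJ → ℝ) : ℝ :=
  ∑ α : Perm (Fin m), sg e α * cycProd (pk μ h) (fun _ => 1) α

theorem EE_lim (μ : Measure JJ) [IsProbabilityMeasure μ] (e : ℤˣ) (m : ℕ) (hs : ℕ → JJ → ℝ) (h : JJ → ℝ) (C : ℝ)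
    (hm : ∀ n, Measurable (hs n)) (hC : ∀ n x, |hs n x| ≤ C) (hl : ∀ x, Tendsto (fun n => hs n x) atTop (𝓝 (h x)))
    (hp : ∀ n, 0 ≤ EE μ e m (hs n)) : 0 ≤ EE μ e m h := by
  have h1 : ∀ k, Tendsto (fun n => pk μ (hs n) k) atTop (𝓝 (pk μ h k)) := by
    intro k
    apply tendsto_integral_of_dominated_convergence (fun _ => C ^ k)
    · intro n
      exact (((hm n).pow_const k).mul (measurable_subtype_coe.pow_const _)).aestronglyMeasurable
    · exact integrable_const _
    · intro n
      refine Eventually.of_forall (fun x => ?_)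
      have hx : |(x : ℝ)| ≤ 1 := abs_le.2 x.2
      rw [Real.norm_eq_abs, abs_mul, abs_pow, abs_pow]
      have h2 : |hs n x| ^ k ≤ C ^ k := pow_le_pow_left₀ (abs_nonneg _) (hC n x) k
      have h3 : |(x : ℝ)| ^ (k - 1) ≤ 1 := pow_le_one₀ (abs_nonneg _) hx
      have h4 : 0 ≤ |hs n x| ^ k := by positivity
      exact (mul_le_of_le_one_right h4 h3).trans h2
    · exact Eventually.of_forall (fun x => ((hl x).pow k).mul tendsto_const_nhds)
  have h2 : Tendsto (fun n => EE μ e m (hs n)) atTop (𝓝 (EE μ e m h)) := by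
    unfold EE
    refine tendsto_finsetSum _ (fun α _ => ?_)
    refine Tendsto.const_mul _ ?_
    unfold cycProd
    exact tendsto_finsetProd _ (fun o _ => h1 _)
  exact ge_of_tendsto' h2 hp

theorem EE_cont (μ : Measure JJ) [IsProbabilityMeasure μ] (e : ℤˣ) (m : ℕ)
    (hE : ∀ (D : ℕ) (a : Fin (D + 1) → ℝ), 0 ≤ EE μ e m (fun x => (∑ d : Fin (D + 1), a d * (x : ℝ) ^ (d : ℕ)) ^ 2))
    (h : JJ → ℝ) (hc : Continuous h) (h0 : ∀ x, 0 ≤ h x) : 0 ≤ EE μ e m h := by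
  let r : C(JJ, ℝ) := ⟨fun x => Real.sqrt (h x), by fun_prop⟩
  have hpoly : ∀ n : ℕ, ∃ p : Polynomial ℝ, ‖p.toContinuousMapOn _ - r‖ < 1 / ((n : ℝ) + 1) :=
    fun n => exists_polynomial_near_continuousMap _ _ r _ (by positivity)
  choose p hp using hpoly
  have hpx : ∀ n (x : JJ), |(p n).eval (x : ℝ) - r x| ≤ 1 / ((n : ℝ) + 1) := by
    intro n x
    have := ((p n).toContinuousMapOn (Set.Icc (-1 : ℝ) 1) - r).norm_coe_le_norm x
    exact this.trans (hp n).le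
  refine EE_lim μ e m (fun n x => ((p n).eval (x : ℝ)) ^ 2) h ((‖r‖ + 1) ^ 2) ?_ ?_ ?_ ?_
  · intro n
    exact (((p n).continuous).measurable.comp measurable_subtype_coe).pow_const 2
  · intro n x
    rw [abs_pow]
    refine pow_le_pow_left₀ (abs_nonneg _) ?_ 2
    have h1 := hpx n x
    have h2 : |r x| ≤ ‖r‖ := r.norm_coe_le_norm x
    have h3 : 1 / ((n : ℝ) + 1) ≤ 1 := by
      apply div_le_one_of_le₀ _ (by positivity)
      linarith [(Nat.cast_nonneg n : (0:ℝ) ≤ n)]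
    have h4 : (p n).eval (x : ℝ) = ((p n).eval (x : ℝ) - r x) + r x := by ring
    rw [h4]
    exact (abs_add_le _ _).trans (by linarith)
  · intro x
    have : Tendsto (fun n => (p n).eval (x : ℝ)) atTop (𝓝 (r x)) := by
      rw [tendsto_iff_norm_sub_tendsto_zero]
      exact squeeze_zero (fun _ => norm_nonneg _) (fun n => hpx n x) tendsto_one_div_add_atTop_nhds_zero_nat
    have h2 := this.pow 2
    have h3 : (r x) ^ 2 = h x := Real.sq_sqrt (h0 x)
    rwa [h3] at h2
  · intro n
    have := hE (p n).natDegree (fun d => (p n).coeff d)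
    convert this using 3 with x
    rw [Polynomial.eval_eq_sum_range, Finset.sum_range]

theorem natural_of_prod (t : ℝ) (h : ∀ m : ℕ, 0 ≤ ∏ i ∈ range m, (t - (i : ℝ))) : ∃ n : ℕ, t = n := by
  have h0 : 0 ≤ t := by simpa using h 1
  by_contra hn
  push Not at hn
  have hlt : (⌊t⌋₊ : ℝ) < t := lt_of_le_of_ne (Nat.floor_le h0) (Ne.symm (hn _))
  have hlt2 : t < (⌊t⌋₊ : ℝ) + 1 := Nat.lt_floor_add_one t
  have := h (⌊t⌋₊ + 2)
  rw [Finset.prod_range_succ] at this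
  have hpos : 0 < ∏ i ∈ range (⌊t⌋₊ + 1), (t - (i : ℝ)) := by
    refine Finset.prod_pos (fun i hi => ?_)
    have : (i : ℝ) ≤ ⌊t⌋₊ := by exact_mod_cast Nat.lt_succ_iff.1 (Finset.mem_range.1 hi)
    linarith
  push_cast at this
  nlinarith

noncomputable def TT (c : ℝ) (N : ℕ) (y : ℝ) : ℝ := min 1 (max 0 (1 + N * (y - c)))

theorem TT_lim (c y : ℝ) : Tendsto (fun N : ℕ => TT c N y) atTop (𝓝 (if c ≤ y then 1 else 0)) := by
  split_ifs with h
  · have : ∀ N, TT c N y = 1 := by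
      intro N
      unfold TT
      apply min_eq_left
      apply le_max_of_le_right
      have : 0 ≤ (N : ℝ) * (y - c) := mul_nonneg (Nat.cast_nonneg _) (by linarith)
      linarith
    simp only [this]; exact tendsto_const_nhds
  · push Not at h
    apply tendsto_const_nhds.congr'
    obtain ⟨M, hM⟩ := exists_nat_gt (1 / (c - y))
    filter_upwards [eventually_ge_atTop M] with N hN
    unfold TT
    have h1 : (M : ℝ) ≤ N := by exact_mod_cast hN
    have h2 : 0 < c - y := by linarith
    rw [div_lt_iff₀ h2] at hM
    have h3 : (M : ℝ) * (c - y) ≤ N * (c - y) := mul_le_mul_of_nonneg_right h1 h2.le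
    rw [max_eq_left (by nlinarith), min_eq_right (by norm_num)]

theorem TT_range (c : ℝ) (N : ℕ) (y : ℝ) : 0 ≤ TT c N y ∧ TT c N y ≤ 1 :=
  ⟨le_min (by norm_num) (le_max_left _ _), min_le_left _ _⟩

theorem TT_anti (c c' : ℝ) (h : c ≤ c') (N : ℕ) (y : ℝ) : TT c' N y ≤ TT c N y := by
  unfold TT; gcongr

theorem TT_cont (c : ℝ) (N : ℕ) : Continuous (TT c N) := by unfold TT; fun_prop

/-- the function which is `1/(s x)` when `s x ∈ [a,b)` -/
noncomputable def hI (s a b : ℝ) (x : JJ) : ℝ := if a ≤ s * x ∧ s * x < b then (s * x)⁻¹ else 0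

theorem EE_hI (μ : Measure JJ) [IsProbabilityMeasure μ] (e : ℤˣ) (m : ℕ)
    (hE : ∀ (D : ℕ) (a : Fin (D + 1) → ℝ), 0 ≤ EE μ e m (fun x => (∑ d : Fin (D + 1), a d * (x : ℝ) ^ (d : ℕ)) ^ 2))
    (s a b : ℝ) (ha : 0 < a) (hab : a ≤ b) : 0 ≤ EE μ e m (hI s a b) := by
  have hcont : ∀ N, Continuous fun x : JJ => (TT a N (s * x) - TT b N (s * x)) * (max (s * x) a)⁻¹ := by
    intro N
    have h1 := TT_cont a N
    have h2 := TT_cont b N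
    have h3 : ∀ x : JJ, max (s * (x:ℝ)) a ≠ 0 := fun x => (lt_max_of_lt_right ha).ne'
    fun_prop (disch := exact h3)
  have hnn : ∀ N (x : JJ), 0 ≤ (TT a N (s * x) - TT b N (s * x)) * (max (s * x) a)⁻¹ := by
    intro N x
    apply mul_nonneg
    · linarith [TT_anti a b hab N (s * x)]
    · exact inv_nonneg.2 (lt_max_of_lt_right ha).le
  refine EE_lim μ e m (fun N x => (TT a N (s * x) - TT b N (s * x)) * (max (s * x) a)⁻¹) _ (a⁻¹) ?_ ?_ ?_ ?_
  · exact fun n => (hcont n).measurable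
  · intro n x
    rw [abs_of_nonneg (hnn n x)]
    have h1 : (max (s * (x:ℝ)) a)⁻¹ ≤ a⁻¹ := inv_anti₀ ha (le_max_right _ _)
    have h2 : TT a n (s * x) - TT b n (s * x) ≤ 1 := by linarith [TT_range a n (s * x), TT_range b n (s * x)]
    have h3 : 0 ≤ (max (s * (x:ℝ)) a)⁻¹ := inv_nonneg.2 (lt_max_of_lt_right ha).le
    exact (mul_le_of_le_one_left h3 h2).trans h1
  · intro x
    have := ((TT_lim a (s * x)).sub (TT_lim b (s * x))).mul_const (max (s * (x:ℝ)) a)⁻¹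
    convert this using 2
    unfold hI
    by_cases h1 : a ≤ s * x
    · by_cases h2 : b ≤ s * x
      · simp [h1, h2]
      · push Not at h2
        simp [h1, h2, not_le.2 h2]
    · have h2 : ¬ b ≤ s * x := fun h => h1 (hab.trans h)
      simp [h1, h2]
  · exact fun n => EE_cont μ e m hE _ (hcont n) (hnn n)

theorem cycProd_congr_pos {m : ℕ} (p p' : ℕ → ℝ) (h : ∀ k, 0 < k → p k = p' k) (α : Perm (Fin m)) :
    cycProd p (fun _ => 1) α = cycProd p' (fun _ => 1) α := by
  unfold cycProd
  refine Finset.prod_congr rfl (fun o _ => h _ ?_)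
  have := fiber_pos α o
  simpa using this

theorem hI_nat (μ : Measure JJ) [IsProbabilityMeasure μ]
    (hE : ∀ (e : ℤˣ) (m D : ℕ) (a : Fin (D + 1) → ℝ), 0 ≤ EE μ e m (fun x => (∑ d : Fin (D + 1), a d * (x : ℝ) ^ (d : ℕ)) ^ 2))
    (s : ℝ) (hs : s = 1 ∨ s = -1) (a b : ℝ) (ha : 0 < a) (hab : a ≤ b) :
    ∃ n : ℕ, ∫ x, hI s a b x ∂μ = n := by
  apply natural_of_prod
  intro m
  set t := ∫ x, hI s a b x ∂μ with ht
  have hpk : ∀ k, 0 < k → pk μ (hI s a b) k = s ^ (k - 1) * t := by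
    intro k hk
    obtain ⟨k, rfl⟩ : ∃ j, k = j + 1 := ⟨k - 1, by omega⟩
    rw [ht, ← integral_const_mul]
    unfold pk
    congr 1
    ext x
    unfold hI
    split_ifs with h
    · have hx : s * (x : ℝ) ≠ 0 := by linarith [h.1]
      have h2 : (x : ℝ) = s * (s * x) := by rcases hs with rfl | rfl <;> ring
      have h3 : (x : ℝ) ^ k = s ^ k * (s * x) ^ k := by
        conv_lhs => rw [h2]
        rw [mul_pow]
      rw [Nat.add_sub_cancel, h3]
      generalize s * (x : ℝ) = y at hx
      rw [pow_succ, inv_pow]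
      field_simp
    · simp
  rcases hs with rfl | rfl
  · have h := EE_hI μ (-1) m (hE (-1) m) 1 a b ha hab
    unfold EE at h
    have h2 := sum_cycles (-1) t m
    simp only [cycProd_congr_pos (pk μ (hI 1 a b)) (fun _ => t) (fun k hk => by rw [hpk k hk]; simp)] at h
    unfold sg at h
    rw [h2] at h
    convert h using 3
    simp; ring
  · have h := EE_hI μ 1 m (hE 1 m) (-1) a b ha hab
    unfold EE at h
    have h2 := sum_cycles 1 (-t) m
    have h3 : ∀ α : Perm (Fin m), cycProd (pk μ (hI (-1) a b)) (fun _ => 1) α =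
        (-1) ^ m * cycProd (fun _ : ℕ => -t) (fun _ => 1) α := by
      intro α
      rw [cycProd_congr_pos _ (fun k => (-1) ^ k * (-t)) (fun k hk => by
        rw [hpk k hk]
        obtain ⟨k, rfl⟩ : ∃ j, k = j + 1 := ⟨k - 1, by omega⟩
        rw [Nat.add_sub_cancel, pow_succ]; ring)]
      unfold cycProd
      rw [Finset.prod_mul_distrib, Finset.prod_pow_eq_pow_sum]
      congr 2
      have := Finset.sum_fiberwise (s := (univ : Finset (Fin m))) (g := cmk α) (f := fun _ => 1)
      simpa using this
    simp only [h3] at h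
    unfold sg at h
    have h4 : ∑ α : Perm (Fin m), (if (1:ℤˣ) = 1 then (1:ℝ) else ((sign α : ℤ) : ℝ)) *
       ((-1) ^ m * cycProd (fun _ : ℕ => -t) (fun _ => 1) α) = (-1) ^ m * ∏ i ∈ range m, (-t + ((1 : ℤˣ) : ℤ) * (i : ℝ)) := by
      rw [← h2, Finset.mul_sum]
      refine Finset.sum_congr rfl (fun α _ => by ring)
    rw [h4] at h
    have h5 : (-1 : ℝ) ^ m = ∏ i ∈ range m, (-1 : ℝ) := by simp
    rw [h5, ← Finset.prod_mul_distrib] at h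
    convert h using 3
    simp; ring


noncomputable def PP (f : Multiset ℕ → ℝ) (k : ℕ) : ℝ := if k = 0 then 1 else f {k}

theorem PP_prod {f : Multiset ℕ → ℝ} (hf : f ∈ KK.extremePoints ℝ) (m : Multiset ℕ) (hm : 0 ∉ m) :
    f m = (m.map (PP f)).prod := by
  induction m using Multiset.induction_on with
  | empty => simpa using hf.1.1
  | cons a m ih =>
    simp only [Multiset.mem_cons, not_or] at hm
    rw [Multiset.map_cons, Multiset.prod_cons, ← ih hm.2, ← Multiset.singleton_add,
      KK_mult hf _ _ hm.2, PP, if_neg (Ne.symm hm.1)]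

theorem grid_sum (N : ℕ) (hN : 0 < N) (c : ℕ → ℝ) (z : ℝ) (hz : z ≤ 1) :
    ∑ j ∈ Finset.Icc N (N ^ 2), c j * (if (j : ℝ) / N ^ 2 ≤ z ∧ z < ((j : ℝ) + 1) / N ^ 2 then z⁻¹ else 0) =
      if 1 / (N : ℝ) ≤ z then c ⌊(N : ℝ) ^ 2 * z⌋₊ * z⁻¹ else 0 := by
  have hN' : (0 : ℝ) < N := by exact_mod_cast hN
  have hN2 : (0 : ℝ) < (N : ℝ) ^ 2 := by positivity
  split_ifs with h
  · have hz0 : 0 < z := lt_of_lt_of_le (by positivity) h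
    have hM0 : 0 ≤ (N : ℝ) ^ 2 * z := by positivity
    rw [Finset.sum_eq_single ⌊(N : ℝ) ^ 2 * z⌋₊]
    · rw [if_pos]
      constructor
      · rw [div_le_iff₀ hN2, mul_comm z]; exact Nat.floor_le hM0
      · rw [lt_div_iff₀ hN2, mul_comm]; exact Nat.lt_floor_add_one _
    · intro j _ hj
      rw [if_neg, mul_zero]
      rintro ⟨h1, h2⟩
      rw [div_le_iff₀ hN2, mul_comm] at h1
      rw [lt_div_iff₀ hN2, mul_comm] at h2
      exact hj ((Nat.floor_eq_iff hM0).2 ⟨h1, h2⟩).symm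
    · intro hj
      exfalso
      apply hj
      rw [Finset.mem_Icc]
      constructor
      · apply Nat.le_floor
        rw [div_le_iff₀ hN'] at h
        nlinarith
      · have : ⌊(N : ℝ) ^ 2 * z⌋₊ ≤ ⌊((N ^ 2 : ℕ) : ℝ)⌋₊ := by
          apply Nat.floor_mono
          push_cast
          nlinarith
        rwa [Nat.floor_natCast] at this
  · apply Finset.sum_eq_zero
    intro j hj
    rw [if_neg, mul_zero]
    rintro ⟨h1, _⟩
    apply h
    refine le_trans ?_ h1
    have : (N : ℝ) ≤ j := by exact_mod_cast (Finset.mem_Icc.1 hj).1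
    rw [div_le_div_iff₀ hN' hN2]
    nlinarith

theorem pow_sub_le (a y : ℝ) (ha : 0 ≤ a) (hay : a ≤ y) (hy : y ≤ 1) (k : ℕ) : y ^ k - a ^ k ≤ k * (y - a) := by
  induction k with
  | zero => simp
  | succ k ih =>
    have h1 : y ^ (k + 1) - a ^ (k + 1) = y * (y ^ k - a ^ k) + (y - a) * a ^ k := by ring
    have h2 : a ^ k ≤ 1 := pow_le_one₀ ha (hay.trans hy)
    have h3 : 0 ≤ y ^ k - a ^ k := by linarith [pow_le_pow_left₀ ha hay k]
    rw [h1]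
    push_cast
    have h4 : y * (y ^ k - a ^ k) ≤ y ^ k - a ^ k := mul_le_of_le_one_left h3 hy
    have h5 : (y - a) * a ^ k ≤ y - a := mul_le_of_le_one_right (by linarith) h2
    linarith

theorem grid_est (N : ℕ) (hN : 0 < N) (k : ℕ) (y : ℝ) (hy : 1 / (N : ℝ) ≤ y) (hy1 : y ≤ 1) :
    |y ^ k - ((⌊(N : ℝ) ^ 2 * y⌋₊ : ℝ) / N ^ 2) ^ (k + 1) * y⁻¹| ≤ ((k + 1 : ℕ) : ℝ) / N := by
  have hN' : (0 : ℝ) < N := by exact_mod_cast hN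
  have hN2 : (0 : ℝ) < (N : ℝ) ^ 2 := by positivity
  have hy0 : 0 < y := lt_of_lt_of_le (by positivity) hy
  have hM0 : 0 ≤ (N : ℝ) ^ 2 * y := by positivity
  set a := (⌊(N : ℝ) ^ 2 * y⌋₊ : ℝ) / N ^ 2 with ha
  have ha0 : 0 ≤ a := by positivity
  have hay : a ≤ y := by rw [ha, div_le_iff₀ hN2, mul_comm y]; exact Nat.floor_le hM0
  have hya : y - a ≤ 1 / N ^ 2 := by
    have := Nat.lt_floor_add_one ((N : ℝ) ^ 2 * y)
    have h2 : y < ((⌊(N : ℝ) ^ 2 * y⌋₊ : ℝ) + 1) / N ^ 2 := by rw [lt_div_iff₀ hN2, mul_comm]; exact this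
    rw [add_div] at h2
    linarith
  have e : y ^ k - a ^ (k + 1) * y⁻¹ = (y ^ (k + 1) - a ^ (k + 1)) * y⁻¹ := by
    rw [sub_mul, pow_succ y, mul_assoc, mul_inv_cancel₀ hy0.ne', mul_one]
  have h3 : 0 ≤ y ^ (k + 1) - a ^ (k + 1) := by linarith [pow_le_pow_left₀ ha0 hay (k + 1)]
  rw [e, abs_of_nonneg (mul_nonneg h3 (inv_nonneg.2 hy0.le))]
  have h4 := pow_sub_le a y ha0 hay hy1 (k + 1)
  have h5 : y⁻¹ ≤ N := by
    rw [inv_le_comm₀ hy0 hN']; simpa using hy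
  calc _ ≤ (((k + 1 : ℕ) : ℝ) * (1 / N ^ 2)) * N := by
        apply mul_le_mul (h4.trans (mul_le_mul_of_nonneg_left hya (by positivity))) h5 (inv_nonneg.2 hy0.le) (by positivity)
    _ = _ := by field_simp

end thoma
end UT

/- part P6 -/

set_option linter.unusedSectionVars false
set_option linter.unusedSimpArgs false
namespace UT
section thoma
open scoped Classical Topology
open Equiv Equiv.Perm Finset MeasureTheory Filter

theorem hI_bdd (s a b : ℝ) (ha : 0 < a) (x : JJ) : |hI s a b x| ≤ a⁻¹ := by
  unfold hI
  split_ifs with h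
  · rw [abs_of_nonneg (inv_nonneg.2 (ha.le.trans h.1))]
    exact inv_anti₀ ha h.1
  · simpa using ha.le

theorem hI_meas (s a b : ℝ) : Measurable (hI s a b) := by
  unfold hI
  refine Measurable.ite ?_ ?_ measurable_const
  · have h1 : Measurable fun x : JJ => s * (x : ℝ) := by fun_prop
    exact (measurableSet_le measurable_const h1).inter (measurableSet_lt h1 measurable_const)
  · fun_prop

theorem hI_int (μ : Measure JJ) [IsProbabilityMeasure μ] (s a b : ℝ) (ha : 0 < a) : Integrable (hI s a b) μ :=
  Integrable.of_bound (hI_meas s a b).aestronglyMeasurable a⁻¹ (Eventually.of_forall (hI_bdd s a b ha))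

theorem point_est (N : ℕ) (hN : 0 < N) (k : ℕ) (x : JJ) :
    |(x : ℝ) ^ k - (if k = 0 then (if |(x : ℝ)| < 1 / N then 1 else 0) else 0) -
      (∑ j ∈ Finset.Icc N (N ^ 2), ((j : ℝ) / N ^ 2) ^ (k + 1) * hI 1 ((j : ℝ) / N ^ 2) (((j : ℝ) + 1) / N ^ 2) x +
        (-1) ^ k * ∑ j ∈ Finset.Icc N (N ^ 2), ((j : ℝ) / N ^ 2) ^ (k + 1) * hI (-1) ((j : ℝ) / N ^ 2) (((j : ℝ) + 1) / N ^ 2) x)|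
      ≤ ((k + 1 : ℕ) : ℝ) / N := by
  have hN' : (0 : ℝ) < N := by exact_mod_cast hN
  have hx := x.2
  unfold hI
  rw [grid_sum N hN (fun j => ((j : ℝ) / N ^ 2) ^ (k + 1)) (1 * x) (by linarith [hx.2]),
    grid_sum N hN (fun j => ((j : ℝ) / N ^ 2) ^ (k + 1)) (-1 * x) (by linarith [hx.1])]
  have hN1 : 0 < 1 / (N : ℝ) := by positivity
  rcases lt_or_ge (|(x : ℝ)|) (1 / N) with h | h
  · have h' := abs_lt.1 h
    rw [if_neg (show ¬ (1 / (N : ℝ) ≤ 1 * (x : ℝ)) by linarith), if_neg (show ¬ (1 / (N : ℝ) ≤ -1 * (x : ℝ)) by linarith)]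
    by_cases hk : k = 0
    · subst hk; rw [if_pos rfl, if_pos h]; simp
    · simp only [hk, if_false, mul_zero, add_zero, sub_zero]
      rw [abs_pow]
      have hle : |(x : ℝ)| ≤ 1 := abs_le.2 hx
      calc |(x : ℝ)| ^ k ≤ |(x : ℝ)| ^ 1 := pow_le_pow_of_le_one (abs_nonneg _) hle (by omega)
        _ ≤ 1 / N := by rw [pow_one]; exact h.le
        _ ≤ _ := by gcongr; push_cast; linarith [(Nat.cast_nonneg k : (0:ℝ) ≤ k)]
  · rw [if_neg (not_lt.2 h)]
    rw [ite_self, sub_zero]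
    rcases le_or_gt 0 (x : ℝ) with h0 | h0
    · rw [abs_of_nonneg h0] at h
      rw [if_pos (by linarith), if_neg (by linarith), mul_zero, add_zero, one_mul]
      exact grid_est N hN k x h hx.2
    · rw [abs_of_neg h0] at h
      rw [if_neg (by linarith), if_pos (by linarith), zero_add]
      have := grid_est N hN k (-x) h (by linarith [hx.1])
      have e : (x : ℝ) ^ k = (-1) ^ k * (-x : ℝ) ^ k := by rw [← mul_pow]; simp
      rw [e, ← mul_sub, abs_mul, abs_pow, abs_neg, abs_one, one_pow, one_mul, neg_one_mul]
      exact this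

theorem thoma_approx {f : Multiset ℕ → ℝ} (hf : f ∈ KK.extremePoints ℝ) (n : ℕ) (ε : ℝ) (hε : 0 < ε) :
    ∃ A B : Multiset ℝ, (∀ a ∈ A, 0 ≤ a) ∧ (∀ b ∈ B, 0 ≤ b) ∧ ∀ k < n,
      |PP f (k + 1) - ((A.map (fun a => a ^ (k + 1))).sum + (-1) ^ k * (B.map (fun b => b ^ (k + 1))).sum)| < ε := by
  have hfK : f ∈ KK := hf.1
  have hP0 : PP f 0 = 1 := by simp [PP]
  have hP1 : PP f 1 = 1 := by
    have := hfK.2.cons_one 0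
    simp only [PP, one_ne_zero, if_false]
    rw [← hfK.1]; simpa using this
  have hb : ∀ k, |PP f k| ≤ 1 := by
    intro k
    unfold PP
    split_ifs
    · simp
    · rw [← hfK.1]; exact hfK.2.bound _
  have hfP : ∀ (n : ℕ) (σ : Perm (Fin n)), f (ct σ) = cycProd (PP f) (fun _ => 1) σ := by
    intro n σ
    rw [cycProd_one_eq, PP_prod hf _ (ct_pos σ)]
  have hEn := E_nonneg hfK (PP f) hP0 hP1 hfP
  have hpos : ∀ (D : ℕ) (a : Fin (D + 1) → ℝ), 0 ≤ ∑ d, ∑ d', a d * a d' * PP f (1 + d + d') := by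
    intro D a
    have := hEn 1 1 D a
    rw [Fintype.sum_unique, ← Equiv.sum_comp (Equiv.funUnique (Fin 1) (Fin (D + 1))).symm] at this
    simp only [← Equiv.sum_comp (Equiv.funUnique (Fin 1) (Fin (D + 1))).symm (fun d' : Fin 1 → Fin (D + 1) => _)] at this
    simp [sg] at this
    refine this.trans (le_of_eq ?_)
    refine Finset.sum_congr rfl (fun d _ => Finset.sum_congr rfl (fun d' _ => ?_))
    congr 1
    have h2 := cycProd_id (X := Fin 1) (PP f) (fun _ => 1 + (d : ℕ) + d')
    simpa using h2
  obtain ⟨μ, hμ, hm⟩ := moment hP1 hpos hb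
  have hE : ∀ (e : ℤˣ) (m D : ℕ) (a : Fin (D + 1) → ℝ), 0 ≤ EE μ e m (fun x => (∑ d : Fin (D + 1), a d * (x : ℝ) ^ (d : ℕ)) ^ 2) := by
    intro e m D a
    have := hEn e m D a
    simp_rw [E_int μ (PP f) hm] at this
    exact this
  obtain ⟨N, hN⟩ := exists_nat_gt ((n + 2 : ℝ) / ε)
  have hN0 : 0 < N := by
    rw [Nat.pos_iff_ne_zero]; rintro rfl
    have : (0:ℝ) < (n + 2 : ℝ) / ε := by positivity
    simp at hN; linarith
  have hN' : (0 : ℝ) < N := by exact_mod_cast hN0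
  rw [div_lt_iff₀ hε] at hN
  have hnat : ∀ (s : ℝ) (hs : s = 1 ∨ s = -1) (j : ℕ), ∃ r : ℕ, 0 < j → ∫ x, hI s ((j : ℝ) / N ^ 2) (((j : ℝ) + 1) / N ^ 2) x ∂μ = r := by
    intro s hs j
    by_cases hj : 0 < j
    · have hj' : (0 : ℝ) < j := by exact_mod_cast hj
      obtain ⟨r, hr⟩ := hI_nat μ hE s hs ((j : ℝ) / N ^ 2) (((j : ℝ) + 1) / N ^ 2) (by positivity) (by gcongr; linarith)
      exact ⟨r, fun _ => hr⟩
    · exact ⟨0, fun h => absurd h hj⟩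
  choose rp hrp using hnat 1 (Or.inl rfl)
  choose rm hrm using hnat (-1) (Or.inr rfl)
  set γ := ∫ x : JJ, (if |(x : ℝ)| < 1 / N then (1 : ℝ) else 0) ∂μ with hγ
  have hγm : Measurable fun x : JJ => (if |(x : ℝ)| < 1 / N then (1 : ℝ) else 0) := by
    refine Measurable.ite ?_ measurable_const measurable_const
    exact measurableSet_lt (by fun_prop) measurable_const
  have hγi : Integrable (fun x : JJ => (if |(x : ℝ)| < 1 / N then (1 : ℝ) else 0)) μ := by
    refine Integrable.of_bound hγm.aestronglyMeasurable 1 (Eventually.of_forall fun x => ?_)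
    split_ifs <;> simp
  have hγ0 : 0 ≤ γ := integral_nonneg (fun x => by dsimp only; split_ifs <;> simp)
  have hγ1 : γ ≤ 1 := by
    have : γ ≤ ∫ x : JJ, (1 : ℝ) ∂μ := integral_mono hγi (integrable_const _) (fun x => by dsimp only; split_ifs <;> simp)
    simpa using this
  refine ⟨∑ j ∈ Finset.Icc N (N ^ 2), Multiset.replicate (rp j) ((j : ℝ) / N ^ 2) + Multiset.replicate N (γ / N),
    ∑ j ∈ Finset.Icc N (N ^ 2), Multiset.replicate (rm j) ((j : ℝ) / N ^ 2), ?_, ?_, ?_⟩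
  · intro a ha
    rw [Multiset.mem_add, Multiset.mem_sum] at ha
    rcases ha with ⟨j, _, hj⟩ | ha
    · rw [Multiset.eq_of_mem_replicate hj]; positivity
    · rw [Multiset.eq_of_mem_replicate ha]; positivity
  · intro a ha
    rw [Multiset.mem_sum] at ha
    obtain ⟨j, _, hj⟩ := ha
    rw [Multiset.eq_of_mem_replicate hj]; positivity
  · intro k hk
    have hsum : ∀ r : ℕ → ℕ, ((∑ j ∈ Finset.Icc N (N ^ 2), Multiset.replicate (r j) ((j : ℝ) / N ^ 2)).map (fun a => a ^ (k + 1))).sum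
        = ∑ j ∈ Finset.Icc N (N ^ 2), ((j : ℝ) / N ^ 2) ^ (k + 1) * r j := by
      intro r
      have := map_sum (Multiset.mapAddMonoidHom (fun a : ℝ => a ^ (k + 1))) (fun j : ℕ => Multiset.replicate (r j) ((j : ℝ) / N ^ 2)) (Finset.Icc N (N ^ 2))
      simp only [Multiset.coe_mapAddMonoidHom] at this
      rw [this, Multiset.sum_sum]
      refine Finset.sum_congr rfl (fun j _ => ?_)
      simp [mul_comm]
    rw [Multiset.map_add, Multiset.sum_add, hsum, hsum, Multiset.map_replicate, Multiset.sum_replicate]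
    have hjpos : ∀ j ∈ Finset.Icc N (N ^ 2), (0 : ℝ) < (j : ℝ) / N ^ 2 := by
      intro j hj
      have : (0 : ℝ) < j := by exact_mod_cast lt_of_lt_of_le hN0 (Finset.mem_Icc.1 hj).1
      positivity
    have hIntg : ∀ s : ℝ, ∀ j ∈ Finset.Icc N (N ^ 2), Integrable (fun x => ((j : ℝ) / N ^ 2) ^ (k + 1) * hI s ((j : ℝ) / N ^ 2) (((j : ℝ) + 1) / N ^ 2) x) μ :=
      fun s j hj => (hI_int μ s _ _ (hjpos j hj)).const_mul _
    have hsi : ∀ (s : ℝ) (r : ℕ → ℕ), (∀ j : ℕ, 0 < j → ∫ x, hI s ((j : ℝ) / N ^ 2) (((j : ℝ) + 1) / N ^ 2) x ∂μ = r j) →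
        ∑ j ∈ Finset.Icc N (N ^ 2), ((j : ℝ) / N ^ 2) ^ (k + 1) * r j =
        ∫ x, ∑ j ∈ Finset.Icc N (N ^ 2), ((j : ℝ) / N ^ 2) ^ (k + 1) * hI s ((j : ℝ) / N ^ 2) (((j : ℝ) + 1) / N ^ 2) x ∂μ := by
      intro s r hr
      rw [integral_finsetSum _ (hIntg s)]
      refine Finset.sum_congr rfl (fun j hj => ?_)
      rw [integral_const_mul, hr j (lt_of_lt_of_le hN0 (Finset.mem_Icc.1 hj).1)]
    rw [hsi 1 rp hrp, hsi (-1) rm hrm, ← hm k]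
    have hxi : Integrable (fun x : JJ => (x : ℝ) ^ k) μ := by
      have hc : Continuous (fun x : JJ => (x : ℝ) ^ k) := by fun_prop
      exact (BoundedContinuousFunction.mkOfCompact ⟨_, hc⟩).integrable _
    set S1 := fun x => ∑ j ∈ Finset.Icc N (N ^ 2), ((j : ℝ) / N ^ 2) ^ (k + 1) * hI 1 ((j : ℝ) / N ^ 2) (((j : ℝ) + 1) / N ^ 2) x with hS1
    set S2 := fun x => ∑ j ∈ Finset.Icc N (N ^ 2), ((j : ℝ) / N ^ 2) ^ (k + 1) * hI (-1) ((j : ℝ) / N ^ 2) (((j : ℝ) + 1) / N ^ 2) x with hS2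
    have hi1 : Integrable S1 μ := integrable_finsetSum _ (hIntg 1)
    have hi2 : Integrable S2 μ := integrable_finsetSum _ (hIntg (-1))
    set G := fun x : JJ => (if k = 0 then (if |(x : ℝ)| < 1 / N then (1:ℝ) else 0) else 0) with hG
    have hGi : Integrable G μ := by
      simp only [hG]
      split_ifs with h
      · exact hγi
      · exact integrable_zero _ _ _
    have hest : |∫ x, ((x : ℝ) ^ k - G x - (S1 x + (-1) ^ k * S2 x)) ∂μ| ≤ ((k + 1 : ℕ) : ℝ) / N := by
      have := norm_integral_le_of_norm_le_const (μ := μ) (f := fun x : JJ => ((x : ℝ) ^ k - G x - (S1 x + (-1) ^ k * S2 x)))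
        (C := ((k + 1 : ℕ) : ℝ) / N) (Eventually.of_forall fun x => point_est N hN0 k x)
      simpa using this
    have e1 : ∫ x, ((x : ℝ) ^ k - G x - (S1 x + (-1) ^ k * S2 x)) ∂μ = ∫ x : JJ, (x : ℝ) ^ k ∂μ - ∫ x, G x ∂μ -
        (∫ x, S1 x ∂μ + (-1) ^ k * ∫ x, S2 x ∂μ) := by
      have h2 := hi2.const_mul ((-1) ^ k)
      have a1 := integral_sub (μ := μ) (f := fun x : JJ => (x : ℝ) ^ k - G x) (g := fun x => S1 x + (-1) ^ k * S2 x) (hxi.sub hGi) (hi1.add h2)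
      rw [a1, integral_sub hxi hGi, integral_add hi1 h2, integral_const_mul]
    rw [e1] at hest
    have hrest : |∫ x, G x ∂μ - N • (γ / N) ^ (k + 1)| ≤ 1 / N := by
      by_cases hk0 : k = 0
      · subst hk0
        simp only [hG, if_true]
        rw [← hγ]
        have : γ - N • (γ / N) ^ (0 + 1) = 0 := by simp; field_simp; simp
        rw [this]; simp
      · simp only [hG, hk0, if_false, integral_zero, zero_sub, abs_neg, nsmul_eq_mul]
        rw [abs_of_nonneg (by positivity)]
        have h1 : (γ / N) ^ (k + 1) ≤ (γ / N) ^ 2 :=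
          pow_le_pow_of_le_one (by positivity) (by
            rw [div_le_one hN']
            have : (1 : ℝ) ≤ N := by exact_mod_cast hN0
            linarith) (by omega)
        calc (N : ℝ) * (γ / N) ^ (k + 1) ≤ N * (γ / N) ^ 2 := by gcongr
          _ = γ ^ 2 / N := by field_simp
          _ ≤ 1 / N := by gcongr; nlinarith
    have hfin : ((k + 1 : ℕ) : ℝ) / N + 1 / N < ε := by
      rw [← add_div, div_lt_iff₀ hN']
      have : ((k + 1 : ℕ) : ℝ) ≤ n := by exact_mod_cast hk
      linarith
    refine lt_of_le_of_lt ?_ hfin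
    refine le_trans (le_of_eq ?_) ((abs_add_le _ _).trans (add_le_add hest hrest))
    congr 1
    ring

end thoma
end UT

/- part P7 -/

set_option linter.unusedSectionVars false
set_option linter.unusedSimpArgs false
namespace UT
section reps
open scoped Classical ComplexOrder MatrixOrder Matrix.Norms.L2Operator
open Finset

variable {Γ : Type} [Group Γ] [Fintype Γ]

/-- normalised bilinear pairing of functions on a finite group -/
noncomputable def ip (φ ψ : Γ → ℂ) : ℂ := (Fintype.card Γ : ℂ)⁻¹ * ∑ g, φ g * ψ g⁻¹

/-- being the character of a (matrix) representation -/
def IsChar (φ : Γ → ℂ) : Prop :=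
  ∃ (d : ℕ) (ρ : Representation ℂ Γ (Fin d → ℂ)), ∀ g, φ g = ρ.character g

theorem IsChar.of {V : Type} [AddCommGroup V] [Module ℂ V] [FiniteDimensional ℂ V]
    (ρ : Representation ℂ Γ V) : IsChar ρ.character := by
  let b := (Module.finBasis ℂ V).equivFun
  refine ⟨Module.finrank ℂ V, (b.conjRingEquiv : Module.End ℂ V →* Module.End ℂ _).comp ρ, fun g => ?_⟩
  simp only [Representation.character]
  exact (LinearMap.trace_conj' (ρ g) b).symm

theorem IsChar.ip_nat {φ ψ : Γ → ℂ} (hφ : IsChar φ) (hψ : IsChar ψ) : ∃ k : ℕ, ip φ ψ = k := by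
  obtain ⟨d, ρ, h⟩ := hφ
  obtain ⟨d', ρ', h'⟩ := hψ
  have : Invertible (Nat.card Γ : ℂ) := invertibleOfNonzero (by simp)
  refine ⟨Module.finrank ℂ (Representation.IntertwiningMap ρ' ρ), ?_⟩
  rw [← Representation.card_inv_mul_sum_char_mul_char_eq_finrank]
  simp [ip, h, h']

theorem IsChar.cut {V : Type} [AddCommGroup V] [Module ℂ V] [FiniteDimensional ℂ V]
    (ρ : Representation ℂ Γ V) (E : V →ₗ[ℂ] V) (hE : E ∘ₗ E = E) (hc : ∀ g, E ∘ₗ ρ g = ρ g ∘ₗ E) :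
    IsChar (fun g => LinearMap.trace ℂ V (E ∘ₗ ρ g)) := by
  have hinv : ∀ g, ∀ v ∈ LinearMap.range E, ρ g v ∈ LinearMap.range E := by
    rintro g _ ⟨v, rfl⟩
    exact ⟨ρ g v, LinearMap.congr_fun (hc g) v⟩
  let σ : Representation ℂ Γ (LinearMap.range E) :=
    { toFun := fun g => (ρ g).restrict (hinv g)
      map_one' := by ext v; simp
      map_mul' := by intro g h; ext v; simp }
  have := IsChar.of σ
  convert this using 1
  funext g
  simp only [Representation.character]
  have e : E ∘ₗ ρ g = (LinearMap.range E).subtype ∘ₗ (σ g ∘ₗ E.rangeRestrict) := by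
    ext v
    have := LinearMap.congr_fun (hc g) v
    simpa [σ] using this
  rw [e, LinearMap.trace_comp_comm']
  congr 1
  ext ⟨v, w, rfl⟩
  have := LinearMap.congr_fun hE w
  simp at this
  simp [σ, this]

theorem exists_quasi {V W : Type} [AddCommGroup V] [Module ℂ V] [AddCommGroup W] [Module ℂ W]
    (T : V →ₗ[ℂ] W) : ∃ S : W →ₗ[ℂ] V, T ∘ₗ S ∘ₗ T = T := by
  obtain ⟨s, hs⟩ := T.rangeRestrict.exists_rightInverse_of_surjective T.range_rangeRestrict
  obtain ⟨S, hS⟩ := LinearMap.exists_extend s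
  refine ⟨S, ?_⟩
  ext v
  have h1 : S (T v) = s (T.rangeRestrict v) := by rw [← hS]; rfl
  have h2 := LinearMap.congr_fun hs (T.rangeRestrict v)
  simp only [LinearMap.comp_apply, h1]
  exact congrArg Subtype.val h2

theorem norm_one {φ ψ : Γ → ℂ} (hφ : IsChar φ) (hψ : IsChar ψ)
    (h1 : ip (φ - ψ) (φ - ψ) = 1) : IsChar (φ - ψ) ∨ IsChar (ψ - φ) := by
  obtain ⟨N, hN⟩ : ∃ N : ℕ, φ 1 = N := by
    obtain ⟨d, ρ, h⟩ := hφ; exact ⟨d, by simp [h]⟩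
  induction N using Nat.strong_induction_on generalizing φ ψ with
  | _ N ih =>
  obtain ⟨d, ρ, h⟩ := id hφ
  obtain ⟨d', ρ', h'⟩ := id hψ
  by_cases hT : ∃ T : Representation.IntertwiningMap ρ ρ', T ≠ 0
  · obtain ⟨T0, hT0⟩ := hT
    set T : (Fin d → ℂ) →ₗ[ℂ] (Fin d' → ℂ) := T0.toLinearMap with hTdef
    have hTi : ∀ g, T ∘ₗ ρ g = ρ' g ∘ₗ T := by
      intro g; ext1; ext1; simp [hTdef, T0.isIntertwining]
    have hTne : T ≠ 0 := by
      intro h0; apply hT0; apply Representation.IntertwiningMap.ext; rw [← hTdef, h0]; rfl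
    obtain ⟨S0, hS0⟩ := exists_quasi T
    have hcard : (Fintype.card Γ : ℂ) ≠ 0 := by simp
    let S : (Fin d' → ℂ) →ₗ[ℂ] (Fin d → ℂ) := (Fintype.card Γ : ℂ)⁻¹ • ∑ g, ρ g⁻¹ ∘ₗ S0 ∘ₗ ρ' g
    have hρ : ∀ (g k : Γ), ρ (g * k) = ρ g ∘ₗ ρ k := fun g k => map_mul ρ g k
    have hρ' : ∀ (g k : Γ), ρ' (g * k) = ρ' g ∘ₗ ρ' k := fun g k => map_mul ρ' g k
    have hSx : ∀ x, S x = (Fintype.card Γ : ℂ)⁻¹ • ∑ g, ρ g⁻¹ (S0 (ρ' g x)) := by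
      intro x; simp [S, LinearMap.sum_apply]
    have hSi : ∀ k, S ∘ₗ ρ' k = ρ k ∘ₗ S := by
      intro k
      refine LinearMap.ext fun x => ?_
      rw [LinearMap.comp_apply, LinearMap.comp_apply, hSx, hSx, map_smul, map_sum]
      congr 1
      rw [← Equiv.sum_comp (Equiv.mulRight k⁻¹)]
      refine Finset.sum_congr rfl (fun g _ => ?_)
      have e1 : ∀ y, ρ (g * k⁻¹)⁻¹ y = ρ k (ρ g⁻¹ y) := by
        intro y; rw [mul_inv_rev, inv_inv, hρ]; rfl
      have e2 : ρ' (g * k⁻¹) (ρ' k x) = ρ' g x := by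
        rw [← LinearMap.comp_apply, ← hρ', inv_mul_cancel_right]
      simp only [Equiv.coe_mulRight, e1, e2]
    have hST : T ∘ₗ S ∘ₗ T = T := by
      refine LinearMap.ext fun x => ?_
      rw [LinearMap.comp_apply, LinearMap.comp_apply, hSx, map_smul, map_sum]
      have : ∀ g : Γ, T (ρ g⁻¹ (S0 (ρ' g (T x)))) = T x := by
        intro g
        have a1 : ∀ g y, T (ρ g y) = ρ' g (T y) := fun g y => LinearMap.congr_fun (hTi g) y
        have a2 : ∀ y, T (S0 (T y)) = T y := fun y => LinearMap.congr_fun hS0 y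
        rw [← a1, a1, a2, ← a1, ← LinearMap.comp_apply (ρ g⁻¹), ← hρ]
        simp
      simp only [this, Finset.sum_const, Finset.card_univ, ← Nat.cast_smul_eq_nsmul ℂ, smul_smul, inv_mul_cancel₀ hcard, one_smul]
    have hSTa : ∀ x, T (S (T x)) = T x := fun x => LinearMap.congr_fun hST x
    have hTa : ∀ g x, T (ρ g x) = ρ' g (T x) := fun g x => LinearMap.congr_fun (hTi g) x
    have hSa : ∀ g x, S (ρ' g x) = ρ g (S x) := fun g x => LinearMap.congr_fun (hSi g) x
    let E := LinearMap.id - S ∘ₗ T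
    let E' := LinearMap.id - T ∘ₗ S
    have cA := IsChar.cut ρ E (by ext1; ext1; simp [E, hSTa]) (by intro g; ext1; ext1; simp [E, hTa, hSa])
    have cB := IsChar.cut ρ' E' (by ext1; ext1; simp [E', hSTa]) (by intro g; ext1; ext1; simp [E', hTa, hSa])
    have tr : ∀ g, LinearMap.trace ℂ _ ((S ∘ₗ T) ∘ₗ ρ g) = LinearMap.trace ℂ _ ((T ∘ₗ S) ∘ₗ ρ' g) := by
      intro g
      rw [LinearMap.comp_assoc, LinearMap.trace_comp_comm', LinearMap.comp_assoc, LinearMap.comp_assoc, hSi]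
    have hdiff : (fun g => LinearMap.trace ℂ _ (E ∘ₗ ρ g)) - (fun g => LinearMap.trace ℂ _ (E' ∘ₗ ρ' g)) = φ - ψ := by
      funext g
      simp only [Pi.sub_apply, E, E', LinearMap.sub_comp, map_sub, LinearMap.id_comp, h, h', Representation.character, tr]
      ring
    obtain ⟨M, hM⟩ : ∃ M : ℕ, (LinearMap.trace ℂ _ (E ∘ₗ ρ 1)) = M := by
      obtain ⟨d, ρ, h⟩ := cA; exact ⟨d, by have := h 1; simpa using this⟩
    have hMN : M < N := by
      have hidem : IsIdempotentElem (S ∘ₗ T : Module.End ℂ (Fin d → ℂ)) := by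
        show (S ∘ₗ T) ∘ₗ (S ∘ₗ T) = S ∘ₗ T
        ext1; ext1; simp [hSTa]
      have htr : LinearMap.trace ℂ _ (S ∘ₗ T) = Module.finrank ℂ (LinearMap.range (S ∘ₗ T)) :=
        (LinearMap.IsIdempotentElem.isProj_range _ hidem).trace
      have hpos : 0 < Module.finrank ℂ (LinearMap.range (S ∘ₗ T)) := by
        rw [Module.finrank_pos_iff, Submodule.nontrivial_iff_ne_bot, Ne, LinearMap.range_eq_bot]
        intro h0; apply hTne; rw [← hST, h0, LinearMap.comp_zero]
      have : (M : ℂ) + Module.finrank ℂ (LinearMap.range (S ∘ₗ T)) = N := by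
        rw [← hM, ← hN, ← htr, h, Representation.character, map_one]
        simp [E, Module.End.one_eq_id]
      have : M + Module.finrank ℂ (LinearMap.range (S ∘ₗ T)) = N := by exact_mod_cast this
      omega
    have := ih M hMN cA cB (by rw [hdiff, h1]) hM
    rw [hdiff] at this
    rcases this with h | h
    · exact Or.inl h
    · right; rw [← neg_sub, ← hdiff, neg_sub]; exact h
  · push Not at hT
    have : Invertible (Nat.card Γ : ℂ) := invertibleOfNonzero (by simp)
    have hz : ip ψ φ = 0 := by
      have := Representation.card_inv_mul_sum_char_mul_char_eq_finrank ρ ρ'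
      have hs : Subsingleton (Representation.IntertwiningMap ρ ρ') := ⟨fun a b => by rw [hT a, hT b]⟩
      rw [Module.finrank_zero_of_subsingleton] at this
      simpa [ip, h, h'] using this
    have hz' : ip φ ψ = 0 := by
      rw [← hz]; unfold ip; congr 1
      rw [← Equiv.sum_comp (Equiv.inv Γ)]
      simp [mul_comm]
    have e : ip (φ - ψ) (φ - ψ) = ip φ φ - ip φ ψ - ip ψ φ + ip ψ ψ := by
      simp only [ip, Pi.sub_apply, ← mul_sub, ← mul_add, ← Finset.sum_sub_distrib, ← Finset.sum_add_distrib]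
      congr 1; refine Finset.sum_congr rfl (fun g _ => ?_); ring
    obtain ⟨a, ha⟩ := hφ.ip_nat hφ
    obtain ⟨b, hb⟩ := hψ.ip_nat hψ
    rw [e, hz, hz', ha, hb, sub_zero, sub_zero] at h1
    have h2 : a + b = 1 := by exact_mod_cast h1
    have zero_of : ∀ (d : ℕ) (ρ : Representation ℂ Γ (Fin d → ℂ)) (φ : Γ → ℂ) (_ : ∀ g, φ g = ρ.character g),
        ip φ φ = 0 → φ = 0 := by
      intro d ρ φ h h0
      have h3 := Representation.card_inv_mul_sum_char_mul_char_eq_finrank ρ ρ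
      have h4 : Module.finrank ℂ (Representation.IntertwiningMap ρ ρ) = 0 := by
        have : ((Module.finrank ℂ (Representation.IntertwiningMap ρ ρ) : ℕ) : ℂ) = 0 := by
          rw [← h3, ← h0]; simp [ip, h]
        exact_mod_cast this
      have hfd : FiniteDimensional ℂ (Representation.IntertwiningMap ρ ρ) := inferInstance
      have hs := Module.finrank_zero_iff.1 h4
      have hid : (Representation.IntertwiningMap.id ρ) = 0 := Subsingleton.elim _ _
      have hid' : ∀ v : Fin d → ℂ, v = 0 := fun v => DFunLike.congr_fun hid v
      funext g
      have : ρ g = 0 := by ext1; ext1; exact hid' _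
      simp [h, Representation.character, this]
    rcases Nat.eq_zero_or_pos a with h0 | h0
    · have : φ = 0 := zero_of d ρ φ h (by rw [ha, h0]; simp)
      right; rw [this, sub_zero]; exact hψ
    · have : ψ = 0 := zero_of d' ρ' ψ h' (by rw [hb, (by omega : b = 0)]; simp)
      left; rw [this, sub_zero]; exact hφ

end reps
end UT

/- part P8 -/

set_option linter.unusedSectionVars false
set_option linter.unusedSimpArgs false
namespace UT
section reps2
open scoped Classical ComplexOrder MatrixOrder Matrix Matrix.Norms.L2Operator
open Finset

variable {Γ : Type} [Group Γ] [Fintype Γ]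

theorem IsChar.unitary {φ : Γ → ℂ} (hφ : IsChar φ) :
    ∃ (d : ℕ) (U : Γ → Matrix (Fin d) (Fin d) ℂ), (∀ g h, U (g * h) = U g * U h) ∧
      (∀ g, U g⁻¹ = (U g)ᴴ) ∧ ∀ g, φ g = (U g).trace := by
  obtain ⟨d, ρ, h⟩ := hφ
  let R : Γ → Matrix (Fin d) (Fin d) ℂ := fun g => LinearMap.toMatrix' (ρ g)
  have hR : ∀ g h, R (g * h) = R g * R h := by
    intro g h; simp only [R, map_mul]; exact LinearMap.toMatrix'_comp _ _
  have hR1 : R 1 = 1 := by simp [R, Module.End.one_eq_id]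
  let P := ∑ g, (R g)ᴴ * R g
  have hP : P.PosDef := by
    have : P = (1 : Matrix (Fin d) (Fin d) ℂ) + ∑ g ∈ Finset.univ.erase 1, (R g)ᴴ * R g := by
      show ∑ g, (R g)ᴴ * R g = _
      rw [← Finset.add_sum_erase _ _ (Finset.mem_univ (1 : Γ))]; simp [hR1]
    rw [this]
    exact Matrix.PosDef.one.add_posSemidef (Matrix.posSemidef_sum _ fun g _ => Matrix.posSemidef_conjTranspose_mul_self _)
  have hPi : ∀ g, (R g)ᴴ * P * R g = P := by
    intro g
    simp only [P, Finset.mul_sum, Finset.sum_mul]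
    rw [← Equiv.sum_comp (Equiv.mulRight g) (fun k => (R k)ᴴ * R k)]
    refine Finset.sum_congr rfl (fun k _ => ?_)
    simp [hR, Matrix.mul_assoc]
  obtain ⟨S, hSu, hS⟩ := CStarAlgebra.isStrictlyPositive_iff_eq_star_mul_self.mp hP.isStrictlyPositive
  have hSd : IsUnit S.det := (Matrix.isUnit_iff_isUnit_det _).1 hSu
  have hS1 : S⁻¹ * S = 1 := Matrix.nonsing_inv_mul _ hSd
  have hS2 : S * S⁻¹ = 1 := Matrix.mul_nonsing_inv _ hSd
  have hm : ∀ g k, S * R (g * k) * S⁻¹ = S * R g * S⁻¹ * (S * R k * S⁻¹) := by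
    intro g k
    calc S * R (g * k) * S⁻¹ = S * R g * 1 * R k * S⁻¹ := by rw [hR]; simp [Matrix.mul_assoc]
      _ = _ := by rw [← hS1]; simp only [Matrix.mul_assoc]
  refine ⟨d, fun g => S * R g * S⁻¹, hm, ?_, ?_⟩
  · intro g
    have h1 : (S * R g * S⁻¹)ᴴ * (S * R g * S⁻¹) = 1 := by
      have e : (S * R g * S⁻¹)ᴴ * (S * R g * S⁻¹) = (S⁻¹)ᴴ * ((R g)ᴴ * P * R g) * S⁻¹ := by
        rw [hS, Matrix.star_eq_conjTranspose]; simp [Matrix.mul_assoc]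
      rw [e, hPi, hS, Matrix.star_eq_conjTranspose, ← Matrix.mul_assoc, ← Matrix.conjTranspose_mul, hS2]
      simp [hS2]
    have h2 : (S * R g * S⁻¹) * (S * R g⁻¹ * S⁻¹) = 1 := by
      rw [← hm, mul_inv_cancel, hR1]; simp [hS2]
    calc S * R g⁻¹ * S⁻¹ = ((S * R g * S⁻¹)ᴴ * (S * R g * S⁻¹)) * (S * R g⁻¹ * S⁻¹) := by rw [h1, one_mul]
      _ = _ := by rw [Matrix.mul_assoc, h2, mul_one]
  · intro g
    rw [Matrix.trace_mul_comm, ← Matrix.mul_assoc, hS1, one_mul, h, Representation.character]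
    exact (LinearMap.trace_eq_matrix_trace ℂ (Pi.basisFun ℂ (Fin d)) (ρ g)).trans (by rw [LinearMap.toMatrix_eq_toMatrix'])

theorem IsChar.inv {φ : Γ → ℂ} (hφ : IsChar φ) (g : Γ) : φ g⁻¹ = star (φ g) := by
  obtain ⟨d, U, _, h2, h3⟩ := hφ.unitary
  rw [h3, h3, h2, Matrix.trace_conjTranspose]

theorem IsChar.comm {φ : Γ → ℂ} (hφ : IsChar φ) (g h : Γ) : φ (g * h) = φ (h * g) := by
  obtain ⟨d, ρ, hh⟩ := hφ
  rw [hh, hh, ρ.char_mul_comm]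

theorem IsChar.pd {φ : Γ → ℂ} (hφ : IsChar φ) (x : Γ → ℂ) : 0 ≤ ∑ g, ∑ h, star (x g) * x h * φ (g⁻¹ * h) := by
  obtain ⟨d, U, h1, h2, h3⟩ := hφ.unitary
  have : ∑ g, ∑ h, star (x g) * x h * φ (g⁻¹ * h) = ((∑ g, x g • U g)ᴴ * (∑ g, x g • U g)).trace := by
    rw [Matrix.conjTranspose_sum, Finset.sum_mul, Matrix.trace_sum]
    refine Finset.sum_congr rfl fun g _ => ?_
    rw [Finset.mul_sum, Matrix.trace_sum]
    refine Finset.sum_congr rfl fun h _ => ?_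
    rw [h3, h1, h2]
    simp [Matrix.trace_smul, mul_assoc, mul_left_comm]
  rw [this]
  exact (Matrix.posSemidef_conjTranspose_mul_self _).trace_nonneg

/-- nonnegativity of Fourier coefficients of a positive definite class function -/
theorem ip_nonneg {χ φ : Γ → ℂ} (hφ : IsChar φ) (hχ : ∀ x : Γ → ℂ, 0 ≤ ∑ g, ∑ h, star (x g) * x h * χ (g⁻¹ * h)) :
    0 ≤ ip χ φ := by
  obtain ⟨d, U, h1, h2, h3⟩ := hφ.unitary
  have e : ∀ g h, ∑ i, ∑ j, U g i j * star (U h i j) = φ (h⁻¹ * g) := by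
    intro g h
    rw [hφ.comm, h3, h1, h2]
    simp [Matrix.trace, Matrix.mul_apply]
  have key : ∑ i, ∑ j, ∑ g, ∑ h, star (star (U g i j)) * star (U h i j) * χ (g⁻¹ * h) = ∑ g, ∑ h, φ (h⁻¹ * g) * χ (g⁻¹ * h) := by
    simp only [star_star, ← e, Finset.sum_mul]
    calc ∑ i, ∑ j, ∑ g, ∑ h, U g i j * star (U h i j) * χ (g⁻¹ * h)
        = ∑ i, ∑ g, ∑ j, ∑ h, U g i j * star (U h i j) * χ (g⁻¹ * h) := by
          refine Finset.sum_congr rfl fun i _ => Finset.sum_comm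
      _ = ∑ g, ∑ i, ∑ j, ∑ h, U g i j * star (U h i j) * χ (g⁻¹ * h) := Finset.sum_comm
      _ = ∑ g, ∑ i, ∑ h, ∑ j, U g i j * star (U h i j) * χ (g⁻¹ * h) := by
          refine Finset.sum_congr rfl fun g _ => Finset.sum_congr rfl fun i _ => Finset.sum_comm
      _ = _ := Finset.sum_congr rfl fun g _ => Finset.sum_comm
  have h4 : 0 ≤ ∑ g, ∑ h, φ (h⁻¹ * g) * χ (g⁻¹ * h) := by
    rw [← key]
    exact Finset.sum_nonneg fun i _ => Finset.sum_nonneg fun j _ => hχ (fun g => star (U g i j))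
  have h5 : ∑ g, ∑ h, φ (h⁻¹ * g) * χ (g⁻¹ * h) = (Fintype.card Γ : ℂ) * ∑ k, χ k * φ k⁻¹ := by
    have : ∀ g : Γ, ∑ h, φ (h⁻¹ * g) * χ (g⁻¹ * h) = ∑ k, χ k * φ k⁻¹ := by
      intro g
      rw [← Equiv.sum_comp (Equiv.mulLeft g)]
      refine Finset.sum_congr rfl fun k _ => ?_
      simp [mul_comm]
    simp [this]
  have hc : (0 : ℂ) ≤ (Fintype.card Γ : ℂ)⁻¹ := by
    rw [← Complex.ofReal_natCast, ← Complex.ofReal_inv]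
    exact Complex.zero_le_real.2 (by positivity)
  have : ip χ φ = (Fintype.card Γ : ℂ)⁻¹ * ((Fintype.card Γ : ℂ)⁻¹ * ∑ g, ∑ h, φ (h⁻¹ * g) * χ (g⁻¹ * h)) := by
    rw [h5, ip, inv_mul_cancel_left₀ (by simp)]
  rw [this]
  exact mul_nonneg hc (mul_nonneg hc h4)

section perm
variable {X : Type} [Fintype X] [MulAction Γ X]

/-- permutation representation on functions -/
noncomputable def permRep (Γ X : Type) [Group Γ] [Fintype X] [MulAction Γ X] : Representation ℂ Γ (X → ℂ) where
  toFun g := LinearMap.funLeft ℂ ℂ (fun x => g⁻¹ • x)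
  map_one' := by ext1; ext1; ext1; simp [LinearMap.funLeft]
  map_mul' := by intro g h; ext1; ext1; ext1; simp [LinearMap.funLeft, mul_smul]

theorem permRep_char (g : Γ) : (permRep Γ X).character g = ((univ.filter fun x : X => g • x = x).card : ℂ) := by
  rw [Representation.character, LinearMap.trace_eq_matrix_trace ℂ (Pi.basisFun ℂ X)]
  simp only [Matrix.trace, Matrix.diag, LinearMap.toMatrix_apply, Finset.card_filter, Nat.cast_sum]
  refine Finset.sum_congr rfl fun x _ => ?_
  simp [permRep, LinearMap.funLeft, Pi.single_apply, inv_smul_eq_iff]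
  simp only [eq_comm]

theorem perm_isChar : IsChar (fun g : Γ => ((univ.filter fun x : X => g • x = x).card : ℂ)) := by
  have := IsChar.of (permRep Γ X)
  convert this using 1
  funext g; rw [permRep_char]

theorem perm_pair {d : ℕ} (ρ : Representation ℂ Γ (Fin d → ℂ)) (x₀ : X) (v : Fin d → ℂ) (hv : v ≠ 0)
    (hfix : ∀ g : Γ, g • x₀ = x₀ → ρ g v = v) :
    ip ρ.character (fun g : Γ => ((univ.filter fun x : X => g • x = x).card : ℂ)) ≠ 0 := by
  have : Invertible (Nat.card Γ : ℂ) := invertibleOfNonzero (by simp)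
  have h := Representation.card_inv_mul_sum_char_mul_char_eq_finrank (permRep Γ X) ρ
  have h' : ip ρ.character (fun g : Γ => ((univ.filter fun x : X => g • x = x).card : ℂ)) = Module.finrank ℂ (Representation.IntertwiningMap (permRep Γ X) ρ) := by
    rw [← h]; simp [ip, permRep_char]
  rw [h']
  have hne : (Module.finrank ℂ (Representation.IntertwiningMap (permRep Γ X) ρ)) ≠ 0 := by
    intro h0
    have hfd : FiniteDimensional ℂ (Representation.IntertwiningMap (permRep Γ X) ρ) := inferInstance
    have hs := Module.finrank_zero_iff.1 h0
    let T : (X → ℂ) →ₗ[ℂ] (Fin d → ℂ) := ∑ g : Γ, (LinearMap.proj (g • x₀) : (X → ℂ) →ₗ[ℂ] ℂ).smulRight (ρ g v)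
    have hTa : ∀ f, T f = ∑ g : Γ, f (g • x₀) • ρ g v := by intro f; simp [T]
    have hT : ∀ (k : Γ) (f : X → ℂ), T (permRep Γ X k f) = ρ k (T f) := by
      intro k f
      rw [hTa, hTa, map_sum, ← Equiv.sum_comp (Equiv.mulLeft k)]
      refine Finset.sum_congr rfl fun g _ => ?_
      simp [permRep, LinearMap.funLeft, mul_smul]
    have h1 : (⟨T, fun g => LinearMap.ext fun f => hT g f⟩ : Representation.IntertwiningMap (permRep Γ X) ρ) = 0 := Subsingleton.elim _ _
    have h2 : T (Pi.single x₀ 1) = 0 := DFunLike.congr_fun h1 _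
    rw [hTa] at h2
    have h3 : ∀ g : Γ, (Pi.single x₀ (1 : ℂ) : X → ℂ) (g • x₀) • ρ g v = if g • x₀ = x₀ then v else 0 := by
      intro g
      by_cases hg : g • x₀ = x₀
      · simp [hg, hfix g hg]
      · simp [hg, Pi.single_apply]
    simp only [h3, Finset.sum_ite, Finset.sum_const_zero, add_zero, Finset.sum_const, ← Nat.cast_smul_eq_nsmul ℂ] at h2
    rcases smul_eq_zero.1 h2 with h4 | h4
    · have : (univ.filter fun g : Γ => g • x₀ = x₀).card = 0 := by exact_mod_cast h4
      rw [Finset.card_eq_zero] at this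
      have h1 : (1 : Γ) ∈ univ.filter fun g : Γ => g • x₀ = x₀ := by simp
      rw [this] at h1; simp at h1
    · exact hv h4
  exact_mod_cast hne

end perm

theorem irr_orth {d d' : ℕ} (ρ : Representation ℂ Γ (Fin d → ℂ)) (ρ' : Representation ℂ Γ (Fin d' → ℂ))
    (h : ∀ W : Submodule ℂ (Fin d → ℂ), (∀ (g : Γ), ∀ v ∈ W, ρ g v ∈ W) → W = ⊥ ∨ W = ⊤) (hd : d ≠ 0)
    (h' : ∀ W : Submodule ℂ (Fin d' → ℂ), (∀ (g : Γ), ∀ v ∈ W, ρ' g v ∈ W) → W = ⊥ ∨ W = ⊤) (hd' : d' ≠ 0) :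
    ip ρ.character ρ'.character = if ρ.character = ρ'.character then 1 else 0 := by
  have irr : ∀ {d : ℕ} (ρ : Representation ℂ Γ (Fin d → ℂ)) (_ : ∀ W : Submodule ℂ (Fin d → ℂ), (∀ (g : Γ), ∀ v ∈ W, ρ g v ∈ W) → W = ⊥ ∨ W = ⊤)
      (_ : d ≠ 0), Representation.IsIrreducible ρ := by
    intro d ρ h hd
    have : Nonempty (Fin d) := Fin.pos_iff_nonempty.1 (Nat.pos_of_ne_zero hd)
    refine { exists_pair_ne := ⟨⊥, ⊤, fun hbt => ?_⟩, eq_bot_or_eq_top := fun W => ?_ }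
    · have : (⊥ : Submodule ℂ (Fin d → ℂ)) = ⊤ := congrArg Subrepresentation.toSubmodule hbt
      exact bot_ne_top this
    · rcases h W.toSubmodule (fun g v hv => W.apply_mem_toSubmodule g hv) with h | h
      · left; exact Subrepresentation.toSubmodule_injective h
      · right; exact Subrepresentation.toSubmodule_injective h
  have := irr ρ h hd
  have := irr ρ' h' hd'
  have : Invertible (Nat.card Γ : ℂ) := invertibleOfNonzero (by simp)
  have key := Representation.char_orthonormal ρ ρ'
  have key2 := Representation.char_orthonormal ρ ρ
  have e : ∀ φ ψ : Γ → ℂ, ip φ ψ = (Nat.card Γ : ℂ)⁻¹ * ∑ g : Γ, φ g * ψ g⁻¹ := by intro φ ψ; simp [ip]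
  split_ifs with hh
  · rw [← hh, e, key2, if_pos ⟨Representation.Equiv.refl ρ⟩]
  · rw [e, key, if_neg]
    rintro ⟨i⟩
    exact hh (Representation.char_iso i).symm

end reps2
end UT

/- part P9 -/
set_option linter.unusedSectionVars false
set_option linter.unusedSimpArgs false
namespace UT
section adapted
open scoped Classical
open Finset

theorem adapted {K V : Type} [Field K] [AddCommGroup V] [Module K V] [Finite V]
    (S T : ℕ → Submodule K V) (hS : Monotone S) (hT : Monotone T) (N : ℕ)
    (hSN : S N = ⊤) (hTN : T N = ⊤) :
    ∃ B : Set V, LinearIndepOn K id B ∧ ∀ i j, ∀ v, v ∈ S i → v ∈ T j →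
      v ∈ Submodule.span K {w | w ∈ B ∧ w ∈ S i ∧ w ∈ T j} := by
  have lev : ∀ S : ℕ → Submodule K V, Monotone S → S N = ⊤ →
      ∃ l : V → ℕ, ∀ v i, v ∈ S i ↔ l v ≤ i := by
    intro S hS hN
    have hex : ∀ v, ∃ i, v ∈ S i := fun v => ⟨N, by rw [hN]; trivial⟩
    refine ⟨fun v => Nat.find (hex v), fun v i => ⟨fun h => Nat.find_min' _ h, fun h => ?_⟩⟩
    exact hS h (Nat.find_spec (hex v))
  obtain ⟨l, hl⟩ := lev S hS hSN
  obtain ⟨l', hl'⟩ := lev T hT hTN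
  obtain ⟨m, ⟨en⟩⟩ := Finite.exists_equiv_fin V
  let key : V → ℕ ×ₗ ℕ ×ₗ Fin m := fun v => toLex (l v, toLex (l' v, en v))
  have hkey : Function.Injective key := by
    intro v w h
    have h1 := congrArg (fun x => (ofLex (ofLex x).2).2) h
    exact en.injective h1
  let B : Set V := {v | v ∉ Submodule.span K {w | key w < key v}}
  have hB : ∀ v, v ∈ B ↔ v ∉ Submodule.span K {w | key w < key v} := fun v => Iff.rfl
  refine ⟨B, ?_, ?_⟩
  · rw [linearIndepOn_iff_linearIndepOn_finset]
    intro s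
    induction s using Finset.induction_on_max_value key with
    | empty => intro _; simp
    | insert a s ha hmax ih =>
      intro hs
      rw [Finset.coe_insert] at hs ⊢
      rw [linearIndepOn_insert (by simpa using ha)]
      refine ⟨ih ((Set.subset_insert _ _).trans hs), fun hmem => ?_⟩
      refine (hB a).1 (hs (Set.mem_insert _ _)) (Submodule.span_mono ?_ hmem)
      rintro w ⟨x, hx, rfl⟩
      refine lt_of_le_of_ne (hmax x hx) (fun h => ?_)
      have := hkey h
      exact ha (this ▸ hx)
  · have main : ∀ v, v ∈ Submodule.span K {w | w ∈ B ∧ l w ≤ l v ∧ l' w ≤ l' v} := by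
      intro v
      induction hk : key v using WellFoundedLT.induction generalizing v with
      | ind k ih =>
      subst hk
      by_cases hv : v ∈ B
      · exact Submodule.subset_span ⟨hv, le_rfl, le_rfl⟩
      rw [hB, not_not] at hv
      have hsub : {w | key w < key v} ⊆ {w | l w < l v} ∪ {w | l w = l v ∧ l' w ≤ l' v ∧ key w < key v} := by
        intro w hw
        have hw' : key w < key v := hw
        have h2 := hw'
        rw [Prod.Lex.lt_iff] at h2
        rcases h2 with h2 | ⟨h2, h3⟩
        · left; exact h2
        · right
          rw [Prod.Lex.lt_iff] at h3
          refine ⟨h2, ?_, hw'⟩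
          rcases h3 with h3 | ⟨h3, _⟩
          · exact le_of_lt h3
          · exact le_of_eq h3
      have h1 := Submodule.span_mono (R := K) hsub hv
      rw [Submodule.span_union, Submodule.mem_sup] at h1
      obtain ⟨a, ha, b, hb, hab⟩ := h1
      have hbT : b ∈ T (l' v) := by
        refine (Submodule.span_le.2 ?_) hb
        rintro w ⟨_, hw, _⟩
        exact (hl' _ _).2 hw
      have hbP : b ∈ Submodule.span K {w | w ∈ B ∧ l w ≤ l v ∧ l' w ≤ l' v} := by
        refine (Submodule.span_le.2 ?_) hb
        rintro w ⟨hw1, hw2, hw3⟩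
        refine Submodule.span_mono ?_ (ih _ hw3 w rfl)
        rintro x ⟨hx, hx1, hx2⟩
        exact ⟨hx, hx1.trans hw1.le, hx2.trans hw2⟩
      suffices haP : a ∈ Submodule.span K {w | w ∈ B ∧ l w ≤ l v ∧ l' w ≤ l' v} by
        have := Submodule.add_mem _ haP hbP
        rwa [hab] at this
      rcases Nat.eq_zero_or_pos (l v) with h0 | h0
      · have : {w | l w < l v} = (∅ : Set V) := by
          ext w; simp [h0]
        rw [this, Submodule.span_empty, Submodule.mem_bot] at ha
        rw [ha]; exact Submodule.zero_mem _
      · have haS : a ∈ S (l v - 1) := by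
          refine (Submodule.span_le.2 ?_) ha
          intro w hw
          exact (hl _ _).2 (Nat.le_sub_one_of_lt hw)
        have hal : l a < l v := by
          have := (hl _ _).1 haS; omega
        have haT : l' a ≤ l' v := by
          refine (hl' _ _).1 ?_
          have : a = v - b := by rw [← hab]; abel
          rw [this]
          exact Submodule.sub_mem _ ((hl' _ _).2 le_rfl) hbT
        have hka : key a < key v := by
          rw [Prod.Lex.lt_iff]; left; exact hal
        refine Submodule.span_mono ?_ (ih _ hka a rfl)
        rintro x ⟨hx, hx1, hx2⟩
        exact ⟨hx, hx1.trans hal.le, hx2.trans haT⟩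
    intro i j v hi hj
    refine Submodule.span_mono ?_ (main v)
    rintro w ⟨hw, h1, h2⟩
    exact ⟨hw, (hl _ _).2 (h1.trans ((hl _ _).1 hi)), (hl' _ _).2 (h2.trans ((hl' _ _).1 hj))⟩

end adapted

section flags
open scoped Classical
open Finset

theorem sum_Iic_inj {L : ℕ} {a b : Fin L → ℕ} (h : ∀ i, ∑ j ∈ Iic i, a j = ∑ j ∈ Iic i, b j) : a = b := by
  funext i
  induction hi : i.1 using Nat.strong_induction_on generalizing i with
  | _ k ih =>
    subst hi
    have h1 := h i
    rw [← Finset.Iio_insert, Finset.sum_insert (by simp), Finset.sum_insert (by simp)] at h1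
    have h2 : ∑ j ∈ Iio i, a j = ∑ j ∈ Iio i, b j :=
      Finset.sum_congr rfl fun j hj => ih j.1 (by simpa using hj) j rfl
    omega

/-- colourings -/
def Col (n : ℕ) {L : ℕ} (α : Fin L →₀ ℕ) : Type := {c : Fin n → Fin L // ∀ i, (univ.filter fun k => c k = i).card = α i}

noncomputable instance (n : ℕ) {L : ℕ} (α : Fin L →₀ ℕ) : Fintype (Col n α) := inferInstanceAs (Fintype {c : Fin n → Fin L // ∀ i, (univ.filter fun k => c k = i).card = α i})

theorem Col.ext {n L : ℕ} {α : Fin L →₀ ℕ} {c d : Col n α} (h : c.1 = d.1) : c = d := Subtype.ext h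

noncomputable instance (n : ℕ) {L : ℕ} (α : Fin L →₀ ℕ) : MulAction (Equiv.Perm (Fin n)) (Col n α) where
  smul σ c := ⟨fun k => c.1 (σ⁻¹ k), fun i => by
    rw [← c.2 i]
    refine Finset.card_bij (fun k _ => σ⁻¹ k) (by simp) (by simp) (fun b hb => ⟨σ b, by simpa using hb, by simp⟩)⟩
  one_smul c := Col.ext (by funext k; change c.1 ((1:Equiv.Perm (Fin n))⁻¹ k) = _; simp)
  mul_smul σ τ c := Col.ext (by funext k; change c.1 ((σ*τ)⁻¹ k) = c.1 (τ⁻¹ (σ⁻¹ k)); simp)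

theorem Col.smul_apply {n L : ℕ} {α : Fin L →₀ ℕ} (σ : Equiv.Perm (Fin n)) (c : Col n α) (k) : (σ • c).1 k = c.1 (σ⁻¹ k) := rfl

variable (K : Type) [Field K] [Fintype K]

/-- flags -/
def FlagG (n : ℕ) {L : ℕ} (α : Fin L →₀ ℕ) : Type :=
  {Fl : Fin L → Submodule K (Fin n → K) // Monotone Fl ∧ ∀ i, Module.finrank K (Fl i) = ∑ j ∈ Iic i, α j}

noncomputable instance (n : ℕ) {L : ℕ} (α : Fin L →₀ ℕ) : Fintype (FlagG K n α) :=
  haveI : Finite (Fin L → Submodule K (Fin n → K)) := inferInstance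
  haveI : Finite (FlagG K n α) := Subtype.finite
  Fintype.ofFinite _

variable {K}
theorem FlagG.ext {n L : ℕ} {α : Fin L →₀ ℕ} {c d : FlagG K n α} (h : c.1 = d.1) : c = d := Subtype.ext h

noncomputable def act {n : ℕ} (g : GL (Fin n) K) (W : Submodule K (Fin n → K)) : Submodule K (Fin n → K) :=
  W.map (Matrix.mulVecLin (g : Matrix (Fin n) (Fin n) K))

theorem act_one {n : ℕ} (W : Submodule K (Fin n → K)) : act (1 : GL (Fin n) K) W = W := by
  simp [act]
theorem act_mul {n : ℕ} (g h : GL (Fin n) K) (W : Submodule K (Fin n → K)) : act (g * h) W = act g (act h W) := by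
  simp [act, Matrix.mulVecLin_mul, Submodule.map_comp]

theorem act_inj {n : ℕ} (g : GL (Fin n) K) : Function.Injective (Matrix.mulVecLin (g : Matrix (Fin n) (Fin n) K)) := by
  intro v w h
  have h1 := congrArg (Matrix.mulVecLin ((g⁻¹ : GL (Fin n) K) : Matrix (Fin n) (Fin n) K)) h
  simpa [Matrix.mulVec_mulVec, ← Matrix.GeneralLinearGroup.coe_mul] using h1

theorem act_finrank {n : ℕ} (g : GL (Fin n) K) (W : Submodule K (Fin n → K)) : Module.finrank K (act g W) = Module.finrank K W :=
  (LinearEquiv.finrank_eq (Submodule.equivMapOfInjective _ (act_inj g) W)).symm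

theorem act_mono {n : ℕ} (g : GL (Fin n) K) {W W' : Submodule K (Fin n → K)} (h : W ≤ W') : act g W ≤ act g W' :=
  Submodule.map_mono h

noncomputable instance (n : ℕ) {L : ℕ} (α : Fin L →₀ ℕ) : MulAction (GL (Fin n) K) (FlagG K n α) where
  smul g c := ⟨fun k => act g (c.1 k), fun i j hij => act_mono g (c.2.1 hij), fun i => by rw [act_finrank]; exact c.2.2 i⟩
  one_smul c := FlagG.ext (by funext k; exact act_one _)
  mul_smul σ τ c := FlagG.ext (by funext k; exact act_mul _ _ _)

theorem FlagG.smul_apply {n L : ℕ} {α : Fin L →₀ ℕ} (g : GL (Fin n) K) (c : FlagG K n α) (k) : (g • c).1 k = act g (c.1 k) := rfl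

/-- coordinate flag -/
noncomputable def cspan {n L : ℕ} (c : Fin n → Fin L) (i : Fin L) : Submodule K (Fin n → K) :=
  Submodule.span K ((Pi.basisFun K (Fin n)) '' {k | c k ≤ i})

theorem card_le_eq {n L : ℕ} (c : Fin n → Fin L) (p : Fin n → Prop) [DecidablePred p] (i : Fin L) : (univ.filter fun k => c k ≤ i ∧ p k).card
    = ∑ j ∈ Iic i, (univ.filter fun k => c k = j ∧ p k).card := by
  rw [Finset.card_eq_sum_card_fiberwise (f := c) (t := Iic i)]
  · refine Finset.sum_congr rfl fun j hj => ?_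
    congr 1; ext k; simp at hj ⊢; constructor
    · rintro ⟨⟨_, h⟩, h'⟩; exact ⟨h', h⟩
    · rintro ⟨h, h'⟩; subst h; exact ⟨⟨hj, h'⟩, rfl⟩
  · intro k hk; simp at hk ⊢; exact hk.1

theorem finrank_basis_span {n : ℕ} {V : Type} [AddCommGroup V] [Module K V] (b : Module.Basis (Fin n) K V) (p : Fin n → Prop) [DecidablePred p] :
    Module.finrank K (Submodule.span K (b '' {k | p k})) = (univ.filter p).card := by
  have h := finrank_span_eq_card (R := K) (b := fun k : {k // p k} => b k) (b.linearIndependent.comp _ Subtype.val_injective)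
  rw [Fintype.card_subtype] at h
  rw [← h]
  have : b '' {k | p k} = Set.range (fun k : {k // p k} => b k) := ?_
  · rw [this]
  ext v; constructor
  · rintro ⟨k, hk, rfl⟩; exact ⟨⟨k, hk⟩, rfl⟩
  · rintro ⟨⟨k, hk⟩, rfl⟩; exact ⟨k, hk, rfl⟩

theorem cspan_inf {n : ℕ} {V : Type} [AddCommGroup V] [Module K V] (b : Module.Basis (Fin n) K V) (p q : Fin n → Prop) :
    Submodule.span K (b '' {k | p k}) ⊓ Submodule.span K (b '' {k | q k}) = Submodule.span K (b '' {k | p k ∧ q k}) := by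
  ext v
  rw [Submodule.mem_inf, Module.Basis.mem_span_image, Module.Basis.mem_span_image, Module.Basis.mem_span_image]
  constructor
  · rintro ⟨h1, h2⟩ k hk; exact ⟨h1 hk, h2 hk⟩
  · intro h; exact ⟨fun k hk => (h hk).1, fun k hk => (h hk).2⟩

noncomputable def toFlag {n L : ℕ} {α : Fin L →₀ ℕ} (c : Col n α) : FlagG K n α :=
  ⟨fun i => cspan c.1 i, fun i j hij => Submodule.span_mono (Set.image_mono fun k hk => le_trans hk hij), fun i => by
    change Module.finrank K (cspan c.1 i : Submodule K (Fin n → K)) = _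
    rw [cspan, finrank_basis_span]
    have := card_le_eq c.1 (fun _ => True) i
    simp only [and_true] at this
    refine Eq.trans ?_ (this.trans ?_)
    · rfl
    exact Finset.sum_congr rfl fun j _ => c.2 j⟩

theorem same_orbit_col {n L L' : ℕ} (c d : Fin n → Fin L) (c' d' : Fin n → Fin L')
    (h : ∀ i j, (univ.filter fun k => c k ≤ i ∧ c' k ≤ j).card = (univ.filter fun k => d k ≤ i ∧ d' k ≤ j).card) :
    ∃ σ : Equiv.Perm (Fin n), ∀ k, d (σ k) = c k ∧ d' (σ k) = c' k := by
  have h1 : ∀ j i, (univ.filter fun k => c k = i ∧ c' k ≤ j).card = (univ.filter fun k => d k = i ∧ d' k ≤ j).card := by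
    intro j i
    refine congrFun (sum_Iic_inj (a := fun i => (univ.filter fun k => c k = i ∧ c' k ≤ j).card) (b := fun i => (univ.filter fun k => d k = i ∧ d' k ≤ j).card) ?_) i
    intro i
    refine ((card_le_eq c (fun k => c' k ≤ j) i).symm.trans ?_).trans (card_le_eq d (fun k => d' k ≤ j) i)
    convert h i j
  have h2 : ∀ i j, (univ.filter fun k => c' k = j ∧ c k = i).card = (univ.filter fun k => d' k = j ∧ d k = i).card := by
    intro i j
    refine congrFun (sum_Iic_inj (a := fun j => (univ.filter fun k => c' k = j ∧ c k = i).card) (b := fun j => (univ.filter fun k => d' k = j ∧ d k = i).card) ?_) j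
    intro j
    refine ((card_le_eq c' (fun k => c k = i) j).symm.trans ?_).trans (card_le_eq d' (fun k => d k = i) j)
    have := h1 j i
    simp only [and_comm] at this ⊢
    convert this
  have h3 : ∀ x : Fin L × Fin L', Nonempty ({k // (c k, c' k) = x} ≃ {k // (d k, d' k) = x}) := by
    rintro ⟨i, j⟩
    rw [← Fintype.card_eq, Fintype.card_subtype, Fintype.card_subtype]
    have := h2 i j
    simpa only [Prod.mk.injEq, and_comm] using this
  let e := Equiv.ofFiberEquiv (fun x => (h3 x).some)
  refine ⟨e, fun k => ?_⟩
  have := Equiv.ofFiberEquiv_map (fun x => (h3 x).some) k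
  exact ⟨congrArg Prod.fst this, congrArg Prod.snd this⟩

noncomputable def glOf {n : ℕ} (e : (Fin n → K) ≃ₗ[K] (Fin n → K)) : GL (Fin n) K :=
  ⟨LinearMap.toMatrix' (e : (Fin n → K) →ₗ[K] (Fin n → K)), LinearMap.toMatrix' (e.symm : (Fin n → K) →ₗ[K] (Fin n → K)),
    by rw [← LinearMap.toMatrix'_comp]; simp, by rw [← LinearMap.toMatrix'_comp]; simp⟩

theorem glOf_apply {n : ℕ} (e : (Fin n → K) ≃ₗ[K] (Fin n → K)) :
    Matrix.mulVecLin (glOf e : Matrix (Fin n) (Fin n) K) = (e : (Fin n → K) →ₗ[K] (Fin n → K)) := by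
  change Matrix.mulVecLin (LinearMap.toMatrix' (e : (Fin n → K) →ₗ[K] (Fin n → K))) = _
  rw [← Matrix.toLin'_apply', Matrix.toLin'_toMatrix']

theorem adapted_basis {n : ℕ} 
    (S T : ℕ → Submodule K (Fin n → K)) (hS : Monotone S) (hT : Monotone T) (N : ℕ)
    (hSN : S N = ⊤) (hTN : T N = ⊤) :
    ∃ b : Module.Basis (Fin n) K (Fin n → K), ∀ i j, 
      S i ⊓ T j = Submodule.span K (b '' {k | b k ∈ S i ∧ b k ∈ T j}) := by
  obtain ⟨B, hB, hs⟩ := adapted S T hS hT N hSN hTN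
  let b0 : Module.Basis B K (Fin n → K) := Module.Basis.mk hB (by
    intro v _
    refine Submodule.span_mono ?_ (hs N N v (by rw [hSN]; trivial) (by rw [hTN]; trivial))
    rintro w ⟨hw, _⟩
    exact ⟨⟨w, hw⟩, rfl⟩)
  have : Fintype B := Fintype.ofFinite _
  have hc : Fintype.card B = n := by
    have := Module.finrank_eq_card_basis b0
    simpa using this.symm
  let e := Fintype.equivFinOfCardEq hc
  refine ⟨b0.reindex e, fun i j => le_antisymm ?_ ?_⟩
  · intro v hv
    refine Submodule.span_mono ?_ (hs i j v hv.1 hv.2)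
    rintro w ⟨hw, h1, h2⟩
    have hw' : (b0.reindex e) (e ⟨w, hw⟩) = w := by simp [b0]
    exact ⟨e ⟨w, hw⟩, by simp only [Set.mem_ofPred_eq, hw']; exact ⟨h1, h2⟩, hw'⟩
  · rw [Submodule.span_le]
    rintro w ⟨k, hk, rfl⟩
    exact hk

theorem top_of {n L : ℕ} {α : Fin L →₀ ℕ} (hα : ∑ i, α i = n) (A : FlagG K n α) (hn : 0 < n) :
    ∃ i : Fin L, A.1 i = ⊤ := by
  rcases L with _ | L
  · simp at hα; omega
  · refine ⟨Fin.last L, Submodule.eq_top_of_finrank_eq ?_⟩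
    rw [A.2.2, ← hα]
    simp
    refine Finset.sum_congr ?_ fun _ _ => rfl
    ext i; simp [Fin.le_last]

noncomputable def extS {n L : ℕ} (A : Fin L → Submodule K (Fin n → K)) (i : ℕ) : Submodule K (Fin n → K) :=
  if h : i < L then A ⟨i, h⟩ else ⊤

theorem extS_mono {n L : ℕ} {A : Fin L → Submodule K (Fin n → K)} (h : Monotone A) : Monotone (extS A) := by
  intro i j hij
  unfold extS
  split_ifs with h1 h2 h2
  · exact h hij
  · exact le_top
  · omega
  · exact le_rfl

theorem extS_top {n L : ℕ} {A : Fin L → Submodule K (Fin n → K)} {N : ℕ} (h : L ≤ N) : extS A N = ⊤ := by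
  unfold extS; rw [dif_neg (by omega)]

theorem extS_val {n L : ℕ} {A : Fin L → Submodule K (Fin n → K)} (i : Fin L) : extS A i = A i := by
  unfold extS; rw [dif_pos i.2]

theorem lev_ex {n L : ℕ} {α : Fin L →₀ ℕ} (hα : ∑ i, α i = n) (A : FlagG K n α) (b : Module.Basis (Fin n) K (Fin n → K))
    (hb : ∀ i, A.1 i = Submodule.span K (b '' {k | b k ∈ A.1 i})) :
    ∃ c : Col n α, ∀ k i, b k ∈ A.1 i ↔ c.1 k ≤ i := by
  have h1 : ∀ k : Fin n, ∃ i : Fin L, ∀ j, b k ∈ A.1 j ↔ i ≤ j := by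
    intro k
    obtain ⟨i, hi⟩ := top_of hα A (k.pos)
    have hne : (univ.filter fun j => b k ∈ A.1 j).Nonempty := ⟨i, by simp [hi]⟩
    refine ⟨(univ.filter fun j => b k ∈ A.1 j).min' hne, fun j => ⟨fun h => Finset.min'_le _ _ (by simp [h]), fun h => ?_⟩⟩
    have := Finset.min'_mem _ hne
    rw [Finset.mem_filter] at this
    exact A.2.1 h this.2
  choose c hc using h1
  refine ⟨⟨c, ?_⟩, fun k i => hc k i⟩
  refine congrFun (sum_Iic_inj (a := fun i => (univ.filter fun k => c k = i).card) (b := α) ?_)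
  intro i
  rw [← A.2.2 i, hb i, finrank_basis_span]
  have := card_le_eq c (fun _ => True) i
  simp only [and_true] at this
  rw [← this]
  congr 1
  ext k; simp [hc]

theorem flags_orbit {n L L' : ℕ} {α : Fin L →₀ ℕ} {β : Fin L' →₀ ℕ} (hα : ∑ i, α i = n) (hβ : ∑ i, β i = n)
    (A : FlagG K n α) (A' : FlagG K n β) :
    ∃ (g : GL (Fin n) K) (c : Col n α) (c' : Col n β), A = g • toFlag c ∧ A' = g • toFlag c' := by
  obtain ⟨b, hb⟩ := adapted_basis (extS A.1) (extS A'.1) (extS_mono A.2.1) (extS_mono A'.2.1) (max L L')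
    (extS_top (by simp)) (extS_top (by simp))
  have hb1 : ∀ i, A.1 i = Submodule.span K (b '' {k | b k ∈ A.1 i}) := by
    intro i
    have := hb i (max L L')
    simpa [extS_val, extS_top] using this
  have hb2 : ∀ i, A'.1 i = Submodule.span K (b '' {k | b k ∈ A'.1 i}) := by
    intro i
    have := hb (max L L') i
    simpa [extS_val, extS_top] using this
  obtain ⟨c, hc⟩ := lev_ex hα A b hb1
  obtain ⟨c', hc'⟩ := lev_ex hβ A' b hb2
  let e := (Pi.basisFun K (Fin n)).equiv b (Equiv.refl _)
  have key : ∀ p : Fin n → Prop, act (glOf e) (Submodule.span K ((Pi.basisFun K (Fin n)) '' {k | p k})) = Submodule.span K (b '' {k | p k}) := by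
    intro p
    rw [act, glOf_apply, Submodule.map_span, ← Set.image_comp]
    congr 1
    refine Set.image_congr fun k _ => ?_
    simp only [Function.comp]
    exact (Pi.basisFun K (Fin n)).equiv_apply k b (Equiv.refl _)
  refine ⟨glOf e, c, c', FlagG.ext ?_, FlagG.ext ?_⟩
  · funext i
    rw [FlagG.smul_apply]
    change _ = act _ (cspan c.1 i)
    rw [cspan, key, hb1 i]
    simp only [hc]
  · funext i
    rw [FlagG.smul_apply]
    change _ = act _ (cspan c'.1 i)
    rw [cspan, key, hb2 i]
    simp only [hc']

theorem act_inf {n : ℕ} (g : GL (Fin n) K) (W W' : Submodule K (Fin n → K)) : act g (W ⊓ W') = act g W ⊓ act g W' :=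
  Submodule.map_inf _ (act_inj g)

theorem toFlag_orbit {n L L' : ℕ} {α : Fin L →₀ ℕ} {β : Fin L' →₀ ℕ} (c d : Col n α) (c' d' : Col n β) :
    (∃ σ : Equiv.Perm (Fin n), σ • c = d ∧ σ • c' = d') ↔
    (∃ g : GL (Fin n) K, g • (toFlag c : FlagG K n α) = toFlag d ∧ g • (toFlag c' : FlagG K n β) = toFlag d') := by
  constructor
  · rintro ⟨σ, rfl, rfl⟩
    let e := (Pi.basisFun K (Fin n)).equiv (Pi.basisFun K (Fin n)) σ
    have key : ∀ p : Fin n → Prop, act (glOf e) (Submodule.span K ((Pi.basisFun K (Fin n)) '' {k | p k})) =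
        Submodule.span K ((Pi.basisFun K (Fin n)) '' {k | p (σ⁻¹ k)}) := by
      intro p
      rw [act, glOf_apply, Submodule.map_span, ← Set.image_comp]
      congr 1
      ext v
      constructor
      · rintro ⟨k, hk, rfl⟩
        exact ⟨σ k, by simpa using hk, by
          simp only [Function.comp]; exact ((Pi.basisFun K (Fin n)).equiv_apply k (Pi.basisFun K (Fin n)) σ).symm⟩
      · rintro ⟨k, hk, rfl⟩
        exact ⟨σ⁻¹ k, hk, by
          simp only [Function.comp]; 
          refine ((Pi.basisFun K (Fin n)).equiv_apply _ (Pi.basisFun K (Fin n)) σ).trans ?_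
          simp⟩
    refine ⟨glOf e, FlagG.ext (funext fun i => ?_), FlagG.ext (funext fun i => ?_)⟩
    · exact key _
    · exact key _
  · rintro ⟨g, h1, h2⟩
    obtain ⟨σ, hσ⟩ := same_orbit_col c.1 d.1 c'.1 d'.1 (by
      intro i j
      have e1 : act g (cspan c.1 i) = cspan d.1 i := congrFun (congrArg Subtype.val h1) i
      have e2 : act g (cspan c'.1 j) = cspan d'.1 j := congrFun (congrArg Subtype.val h2) j
      have e3 : act g (cspan c.1 i ⊓ cspan c'.1 j) = cspan d.1 i ⊓ cspan d'.1 j := by rw [act_inf, e1, e2]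
      have e4 := congrArg (fun W : Submodule K (Fin n → K) => Module.finrank K W) e3
      simp only [act_finrank] at e4
      unfold cspan at e4
      rwa [cspan_inf, cspan_inf, finrank_basis_span, finrank_basis_span] at e4)
    refine ⟨σ, Col.ext (funext fun k => ?_), Col.ext (funext fun k => ?_)⟩
    · rw [Col.smul_apply, ← (hσ _).1]; simp
    · rw [Col.smul_apply, ← (hσ _).2]; simp

noncomputable def piG {n L : ℕ} (α : Fin L →₀ ℕ) (g : GL (Fin n) K) : ℕ := (univ.filter fun x : FlagG K n α => g • x = x).card
noncomputable def piS {n L : ℕ} (α : Fin L →₀ ℕ) (σ : Equiv.Perm (Fin n)) : ℕ := (univ.filter fun x : Col n α => σ • x = x).card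

theorem burnside {Γ X Y : Type} [Group Γ] [Fintype Γ] [Fintype X] [Fintype Y] [MulAction Γ X] [MulAction Γ Y] :
    ∑ g : Γ, (univ.filter fun x : X => g • x = x).card * (univ.filter fun y : Y => g • y = y).card
      = Fintype.card (Quotient (MulAction.orbitRel Γ (X × Y))) * Fintype.card Γ := by
  rw [← MulAction.sum_card_fixedBy_eq_card_orbits_mul_card_group Γ (X × Y)]
  refine Finset.sum_congr rfl fun g _ => ?_
  rw [← Finset.card_product, Fintype.card_subtype]
  congr 1
  ext ⟨x, y⟩
  simp [MulAction.mem_fixedBy, Prod.ext_iff]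

theorem gram {n L L' : ℕ} {α : Fin L →₀ ℕ} {β : Fin L' →₀ ℕ} (hα : ∑ i, α i = n) (hβ : ∑ i, β i = n) :
    ∃ N : ℕ, ∑ g : GL (Fin n) K, piG α g * piG β g = N * Fintype.card (GL (Fin n) K) ∧ 
      ∑ σ : Equiv.Perm (Fin n), piS α σ * piS β σ = N * Fintype.card (Equiv.Perm (Fin n)) := by
  refine ⟨_, burnside, ?_⟩
  unfold piS
  rw [burnside]
  congr 1
  refine Fintype.card_of_bijective (f := Quotient.map' (fun x : Col n α × Col n β => ((toFlag x.1 : FlagG K n α), (toFlag x.2 : FlagG K n β))) ?_) ⟨?_, ?_⟩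
  · rintro ⟨c, c'⟩ ⟨d, d'⟩ ⟨σ, hσ⟩
    obtain ⟨g, hg⟩ := (toFlag_orbit (K := K) d c d' c').1 ⟨σ, congrArg Prod.fst hσ, congrArg Prod.snd hσ⟩
    exact ⟨g, Prod.ext hg.1 hg.2⟩
  · intro x y
    refine Quotient.inductionOn₂' x y ?_
    rintro ⟨c, c'⟩ ⟨d, d'⟩ h
    rw [Quotient.map'_mk'', Quotient.map'_mk'', Quotient.eq''] at h
    obtain ⟨g, hg⟩ := h
    obtain ⟨σ, hσ⟩ := (toFlag_orbit (K := K) d c d' c').2 ⟨g, congrArg Prod.fst hg, congrArg Prod.snd hg⟩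
    exact Quotient.eq''.2 ⟨σ, Prod.ext hσ.1 hσ.2⟩
  · intro y
    refine Quotient.inductionOn' y ?_
    rintro ⟨A, A'⟩
    obtain ⟨g, c, c', h1, h2⟩ := flags_orbit hα hβ A A'
    refine ⟨Quotient.mk'' (c, c'), ?_⟩
    rw [Quotient.map'_mk'', Quotient.eq'']
    refine ⟨g⁻¹, Prod.ext ?_ ?_⟩
    · simp [h1]
    · simp [h2]

end flags
end UT

/- part P10 -/
set_option linter.unusedSectionVars false
set_option linter.unusedSimpArgs false
namespace UT
section hsym
open scoped Classical
open Finset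

/-- complete homogeneous polynomials -/
noncomputable def hh (n k : ℕ) : MvPolynomial (Fin n) ℤ :=
  ∑ d ∈ finsuppAntidiag univ k, MvPolynomial.monomial d 1

theorem hh_zero (n : ℕ) : hh n 0 = 1 := by
  unfold hh
  rw [Finset.finsuppAntidiag_zero]
  simp

noncomputable def Nmat {L L' : ℕ} (β : Fin L →₀ ℕ) (γ : Fin L' →₀ ℕ) : ℕ :=
  ((Fintype.piFinset (fun i : Fin L => finsuppAntidiag (univ : Finset (Fin L')) (β i))).filter (fun M => ∑ i, M i = γ)).card

theorem hh_prod {n L : ℕ} (β : Fin L →₀ ℕ) : ∏ i, hh n (β i) =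
    ∑ M ∈ Fintype.piFinset (fun i : Fin L => finsuppAntidiag (univ : Finset (Fin n)) (β i)), MvPolynomial.monomial (∑ i, M i) 1 := by
  unfold hh
  rw [Finset.prod_univ_sum]
  refine Finset.sum_congr rfl fun M _ => ?_
  rw [MvPolynomial.monomial_sum_one]

theorem coeff_hh_prod {n L : ℕ} (β : Fin L →₀ ℕ) (γ : Fin n →₀ ℕ) : MvPolynomial.coeff γ (∏ i, hh n (β i)) = Nmat β γ := by
  rw [hh_prod, MvPolynomial.coeff_sum, Nmat, Finset.card_filter]
  push_cast
  refine Finset.sum_congr rfl fun M _ => ?_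
  rw [MvPolynomial.coeff_monomial]

theorem hh_homog (n k : ℕ) : (hh n k).IsHomogeneous k := by
  unfold hh
  refine MvPolynomial.IsHomogeneous.sum _ _ _ fun d hd => ?_
  refine MvPolynomial.isHomogeneous_monomial _ ?_
  simp at hd
  rw [← hd]
  simp [Finsupp.degree_eq_sum]

theorem newton_eh (n k : ℕ) : ∑ p ∈ antidiagonal (k+1), (-1) ^ p.1 * MvPolynomial.esymm (Fin n) ℤ p.1 * hh n p.2 = 0 := by
  let E : PowerSeries (MvPolynomial (Fin n) ℤ) := ∏ i : Fin n, (1 + (- PowerSeries.C (MvPolynomial.X i)) * PowerSeries.X)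
  let H : PowerSeries (MvPolynomial (Fin n) ℤ) := ∏ i : Fin n, PowerSeries.mk (fun j => (MvPolynomial.X i)^j)
  have hE : ∀ k, PowerSeries.coeff k E = (-1)^k * MvPolynomial.esymm (Fin n) ℤ k := by
    intro k
    simp only [E]
    rw [Finset.prod_one_add, map_sum, MvPolynomial.esymm, Finset.powersetCard_eq_filter, Finset.mul_sum, Finset.sum_filter]
    refine Finset.sum_congr rfl fun s _ => ?_
    have : ∏ i ∈ s, (- PowerSeries.C (MvPolynomial.X i : MvPolynomial (Fin n) ℤ)) * PowerSeries.X 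
        = PowerSeries.C ((-1)^s.card * ∏ i ∈ s, (MvPolynomial.X i)) * PowerSeries.X ^ s.card := by
      rw [Finset.prod_mul_distrib, Finset.prod_const, Finset.prod_neg, map_mul, map_prod]
      simp
    rw [this, PowerSeries.coeff_C_mul, PowerSeries.coeff_X_pow]
    by_cases h : s.card = k
    · simp [h]
    · rw [if_neg h, if_neg (Ne.symm h), mul_zero]
  have hH : ∀ k, PowerSeries.coeff k H = hh n k := by
    intro k
    simp only [H]
    rw [PowerSeries.coeff_prod, hh]
    refine Finset.sum_congr rfl fun d _ => ?_
    simp only [PowerSeries.coeff_mk]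
    rw [MvPolynomial.monomial_eq]
    simp [Finsupp.prod_fintype]
  have hEH : E * H = 1 := by
    simp only [E, H]
    rw [← Finset.prod_mul_distrib]
    refine Finset.prod_eq_one fun i _ => ?_
    ext1 k
    rw [add_mul, one_mul, map_add, mul_assoc, neg_mul, map_neg, PowerSeries.coeff_C_mul]
    rcases k with _ | k
    · simp
    · rw [PowerSeries.coeff_succ_X_mul]
      simp [pow_succ, PowerSeries.coeff_one]; ring
  have := congrArg (PowerSeries.coeff (k+1)) hEH
  rw [PowerSeries.coeff_mul] at this
  simp only [hE, hH] at this
  rw [this]; simp [PowerSeries.coeff_one]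

theorem esymm_mem (n k : ℕ) : MvPolynomial.esymm (Fin n) ℤ k ∈ Algebra.adjoin ℤ (Set.range (hh n)) := by
  induction k using Nat.strong_induction_on with
  | _ k ih =>
    rcases k with _ | k
    · rw [MvPolynomial.esymm_zero]; exact one_mem _
    · have h := newton_eh n k
      rw [Finset.Nat.sum_antidiagonal_eq_sum_range_succ (fun a b => (-1) ^ a * MvPolynomial.esymm (Fin n) ℤ a * hh n b),
        Finset.sum_range_succ] at h
      simp only [Nat.sub_self, hh_zero, mul_one] at h
      have h2 : (-1) ^ (k+1) * MvPolynomial.esymm (Fin n) ℤ (k+1) ∈ Algebra.adjoin ℤ (Set.range (hh n)) := by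
        rw [← neg_eq_of_add_eq_zero_right h]
        refine neg_mem (sum_mem fun a ha => ?_)
        refine mul_mem (mul_mem (pow_mem (neg_mem (one_mem _)) _) (ih a (by simpa using ha))) (Algebra.subset_adjoin ⟨_, rfl⟩)
      have h3 : MvPolynomial.esymm (Fin n) ℤ (k+1) = (-1)^(k+1) * ((-1) ^ (k+1) * MvPolynomial.esymm (Fin n) ℤ (k+1)) := by
        rw [← mul_assoc, ← mul_pow]; simp
      rw [h3]
      exact mul_mem (pow_mem (neg_mem (one_mem _)) _) h2

theorem symm_mem (n : ℕ) (P : MvPolynomial (Fin n) ℤ) (hP : P.IsSymmetric) : P ∈ Algebra.adjoin ℤ (Set.range (hh n)) := by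
  obtain ⟨Q, hQ⟩ := (MvPolynomial.esymmAlgHom_fin_bijective ℤ n).2 ⟨P, hP⟩
  have h := congrArg Subtype.val hQ
  rw [MvPolynomial.esymmAlgHom_apply] at h
  simp only at h
  rw [← h]
  rw [MvPolynomial.aeval_def, MvPolynomial.eval₂_eq]
  refine sum_mem fun d _ => mul_mem (Subalgebra.algebraMap_mem _ _) (prod_mem fun i _ => pow_mem (esymm_mem _ _) _)

theorem mset_fun (n : ℕ) (m : Multiset ℕ) (hm : m.card = n) : ∃ β : Fin n →₀ ℕ, univ.val.map β = m := by
  obtain ⟨l, rfl⟩ := Quot.exists_rep m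
  have hl : l.length = n := by simpa using hm
  subst hl
  refine ⟨Finsupp.equivFunOnFinite.symm l.get, ?_⟩
  simp [Fin.univ_val_map, List.ofFn_get]

theorem mset_prod (n : ℕ) (m : Multiset ℕ) (hm : m.sum = n) : ∃ β : Fin n →₀ ℕ, ∑ i, β i = n ∧
    (m.map (hh n)).prod = ∏ i, hh n (β i) := by
  have hsplit := Multiset.filter_add_not (fun k => k = 0) m
  have hpos : ∀ m' : Multiset ℕ, (∀ k ∈ m', k ≠ 0) → m'.card ≤ m'.sum := by
    intro m' h
    have := Multiset.card_nsmul_le_sum (s := m') (a := 1) (fun x hx => Nat.pos_of_ne_zero (h x hx))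
    simpa using this
  set z := m.filter (fun k => k = 0)
  set p := m.filter (fun k => ¬ k = 0)
  have hz : z = Multiset.replicate z.card 0 := Multiset.eq_replicate_card.2 (fun b hb => (Multiset.mem_filter.1 hb).2)
  have hp := hpos p (fun k hk => (Multiset.mem_filter.1 hk).2)
  have hps : p.sum = n := by
    rw [← hm, ← hsplit, Multiset.sum_add, hz]; simp
  obtain ⟨β, hβ⟩ := mset_fun n (p + Multiset.replicate (n - p.card) 0) (by simp; omega)
  refine ⟨β, ?_, ?_⟩
  · have := congrArg Multiset.sum hβ
    simp only [Multiset.sum_add, Multiset.sum_replicate, smul_zero, add_zero, hps] at this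
    exact this
  · have := congrArg (fun m => (Multiset.map (hh n) m).prod) hβ
    simp only [Multiset.map_add, Multiset.prod_add, Multiset.map_replicate, hh_zero, Multiset.prod_replicate, one_pow, mul_one, Multiset.map_map] at this
    rw [← hsplit, hz]
    simp only [Multiset.map_add, Multiset.prod_add, Multiset.map_replicate, hh_zero, Multiset.prod_replicate, one_pow, one_mul]
    rw [← this]; rfl

theorem unimod (n : ℕ) (ℓ : (Fin n →₀ ℕ) → ℤ) (hℓ : ∀ (e : Equiv.Perm (Fin n)) γ, ∑ i, γ i = n → ℓ (γ.mapDomain e) = ℓ γ) :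
    ∃ c : (Fin n →₀ ℕ) → ℤ, ∀ γ : Fin n →₀ ℕ, ∑ i, γ i = n → ℓ γ = ∑ β ∈ finsuppAntidiag univ n, c β * Nmat β γ := by
  let P : MvPolynomial (Fin n) ℤ := ∑ γ ∈ finsuppAntidiag univ n, MvPolynomial.monomial γ (ℓ γ)
  have hPc : ∀ γ : Fin n →₀ ℕ, ∑ i, γ i = n → P.coeff γ = ℓ γ := by
    intro γ hγ
    simp only [P, MvPolynomial.coeff_sum, MvPolynomial.coeff_monomial]
    rw [Finset.sum_ite_eq' , if_pos (by simp [hγ])]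
  have hsum : ∀ (e : Equiv.Perm (Fin n)) (γ : Fin n →₀ ℕ), ∑ i, γ.mapDomain e i = ∑ i, γ i := by
    intro e γ
    rw [← Equiv.sum_comp e]
    refine Finset.sum_congr rfl fun i _ => ?_
    exact Finsupp.mapDomain_apply e.injective _ _
  have hP : P.IsSymmetric := by
    intro e
    simp only [P, map_sum, MvPolynomial.rename_monomial]
    refine Finset.sum_bij (fun γ _ => γ.mapDomain e) ?_ ?_ ?_ ?_
    · intro γ hγ; simp at hγ ⊢; exact (Equiv.sum_comp e.symm γ).trans hγ
    · intro a _ b _ h; exact Finsupp.mapDomain_injective e.injective h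
    · intro b hb
      refine ⟨b.mapDomain e.symm, ?_, ?_⟩
      · simp at hb ⊢; exact (Equiv.sum_comp e b).trans hb
      · rw [← Finsupp.mapDomain_comp]; simp [Finsupp.mapDomain_id]
    · intro γ hγ; simp at hγ; rw [hℓ e γ hγ]
  have hmem := symm_mem n P hP
  rw [← Subalgebra.mem_toSubmodule, Algebra.adjoin_eq_span] at hmem
  have main : ∃ c : (Fin n →₀ ℕ) → ℤ, ∀ γ : Fin n →₀ ℕ, ∑ i, γ i = n → P.coeff γ = ∑ β ∈ finsuppAntidiag univ n, c β * Nmat β γ := by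
    clear hP hPc
    clear_value P
    induction hmem using Submodule.span_induction with
    | mem x hx =>
      obtain ⟨s, hs, rfl⟩ := Submonoid.exists_multiset_of_mem_closure hx
      have : ∃ m : Multiset ℕ, s = m.map (hh n) := by
        clear hx
        induction s using Multiset.induction_on with
        | empty => exact ⟨0, rfl⟩
        | cons a s ih =>
          obtain ⟨m, hm⟩ := ih (fun y hy => hs y (Multiset.mem_cons_of_mem hy))
          obtain ⟨k, hk⟩ := hs a (Multiset.mem_cons_self _ _)
          exact ⟨k ::ₘ m, by simp [hm, hk]⟩
      obtain ⟨m, rfl⟩ := this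
      have hhom : (m.map (hh n)).prod.IsHomogeneous m.sum := by
        clear hx hs
        induction m using Multiset.induction_on with
        | empty => simpa using MvPolynomial.isHomogeneous_one _ _
        | cons a s ih => simpa using (hh_homog n a).mul ih
      by_cases hmn : m.sum = n
      · obtain ⟨β, hβ, hprod⟩ := mset_prod n m hmn
        refine ⟨Pi.single β 1, fun γ hγ => ?_⟩
        rw [hprod, coeff_hh_prod, Finset.sum_eq_single β]
        · simp
        · intro b _ hb; simp [hb]
        · intro h; simp [hβ] at h
      · refine ⟨0, fun γ hγ => ?_⟩
        simp only [Pi.zero_apply, zero_mul, Finset.sum_const_zero]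
        refine hhom.coeff_eq_zero ?_
        rw [Finsupp.degree_eq_sum, hγ]
        exact Ne.symm hmn
    | zero => exact ⟨0, by simp⟩
    | add x y _ _ hx hy =>
      obtain ⟨c, hc⟩ := hx
      obtain ⟨d, hd⟩ := hy
      refine ⟨c + d, fun γ hγ => ?_⟩
      rw [MvPolynomial.coeff_add, hc γ hγ, hd γ hγ, ← Finset.sum_add_distrib]
      exact Finset.sum_congr rfl fun β _ => by simp [add_mul]
    | smul a x _ hx =>
      obtain ⟨c, hc⟩ := hx
      refine ⟨a • c, fun γ hγ => ?_⟩
      rw [MvPolynomial.coeff_smul, hc γ hγ, Finset.smul_sum]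
      exact Finset.sum_congr rfl fun β _ => by simp [mul_assoc]
  obtain ⟨c, hc⟩ := main
  exact ⟨c, fun γ hγ => by rw [← hPc γ hγ, hc γ hγ]⟩

theorem card_fib2 {n L L' : ℕ} (c : Fin n → Fin L) (c' : Fin n → Fin L') (i : Fin L) :
    ∑ j, (univ.filter fun k => c k = i ∧ c' k = j).card = (univ.filter fun k => c k = i).card := by
  rw [Finset.card_eq_sum_card_fiberwise (f := c') (t := univ) (by intro; simp)]
  refine Finset.sum_congr rfl fun j _ => ?_
  rw [Finset.filter_filter]

noncomputable def matOf {n L L' : ℕ} (c : Fin n → Fin L) (c' : Fin n → Fin L') (i : Fin L) : Fin L' →₀ ℕ :=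
  Finsupp.equivFunOnFinite.symm fun j => (univ.filter fun k => c k = i ∧ c' k = j).card

theorem gramS {n L L' : ℕ} {α : Fin L →₀ ℕ} {β : Fin L' →₀ ℕ} (hα : ∑ i, α i = n) :
      ∑ σ : Equiv.Perm (Fin n), piS α σ * piS β σ = Nmat α β * Fintype.card (Equiv.Perm (Fin n)) := by
  unfold piS
  rw [burnside]
  congr 1
  unfold Nmat
  rw [← Fintype.card_coe]
  have hmem : ∀ x : Col n α × Col n β, matOf x.1.1 x.2.1 ∈ ((Fintype.piFinset (fun i : Fin L => finsuppAntidiag (univ : Finset (Fin L')) (α i))).filter (fun M => ∑ i, M i = β)) := by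
    rintro ⟨c, c'⟩
    rw [Finset.mem_filter, Fintype.mem_piFinset]
    constructor
    · intro i
      simp only [mem_finsuppAntidiag, subset_univ, and_true]
      exact (card_fib2 c.1 c'.1 i).trans (c.2 i)
    · ext j
      rw [Finsupp.finsetSum_apply]
      refine Eq.trans ?_ (c'.2 j)
      rw [← card_fib2 c'.1 c.1 j]
      refine Finset.sum_congr rfl fun i _ => ?_
      simp [matOf, and_comm]
  let f : Quotient (MulAction.orbitRel (Equiv.Perm (Fin n)) (Col n α × Col n β)) → ((Fintype.piFinset (fun i : Fin L => finsuppAntidiag (univ : Finset (Fin L')) (α i))).filter (fun M => ∑ i, M i = β)) :=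
    Quotient.lift (fun x => ⟨matOf x.1.1 x.2.1, hmem x⟩) (by
      rintro ⟨c, c'⟩ ⟨d, d'⟩ ⟨σ, hσ⟩
      have h1 : σ • d = c := congrArg Prod.fst hσ
      have h2 : σ • d' = c' := congrArg Prod.snd hσ
      subst h1 h2
      apply Subtype.ext
      funext i
      ext j
      simp only [matOf, Finsupp.equivFunOnFinite_symm_apply_apply, Col.smul_apply]
      refine Finset.card_bij (fun k _ => σ⁻¹ k) (by simp) (by simp) (fun b hb => ⟨σ b, by simpa using hb, by simp⟩))
  refine Fintype.card_of_bijective (f := f) ⟨?_, ?_⟩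
  · intro x y
    refine Quotient.inductionOn₂' x y ?_
    rintro ⟨c, c'⟩ ⟨d, d'⟩ h
    have h0 : matOf c.1 c'.1 = matOf d.1 d'.1 := congrArg Subtype.val h
    have h1 : ∀ i j, (univ.filter fun k => c.1 k = i ∧ c'.1 k = j).card = (univ.filter fun k => d.1 k = i ∧ d'.1 k = j).card := by
      intro i j
      have := DFunLike.congr_fun (congrFun h0 i) j
      simpa [matOf] using this
    have h3 : ∀ x : Fin L × Fin L', Nonempty ({k // (d.1 k, d'.1 k) = x} ≃ {k // (c.1 k, c'.1 k) = x}) := by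
      rintro ⟨i, j⟩
      rw [← Fintype.card_eq, Fintype.card_subtype, Fintype.card_subtype]
      have := (h1 i j).symm
      simpa only [Prod.mk.injEq] using this
    let e := Equiv.ofFiberEquiv (fun x => (h3 x).some)
    have he : ∀ k, (c.1 (e k), c'.1 (e k)) = (d.1 k, d'.1 k) := fun k => Equiv.ofFiberEquiv_map (fun x => (h3 x).some) k
    refine Quotient.eq''.2 ⟨e, Prod.ext (Col.ext (funext fun k => ?_)) (Col.ext (funext fun k => ?_))⟩
    · change d.1 (e⁻¹ k) = c.1 k
      exact (congrArg Prod.fst (he (e.symm k))).symm.trans (congrArg c.1 (e.apply_symm_apply k))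
    · change d'.1 (e⁻¹ k) = c'.1 k
      exact (congrArg Prod.snd (he (e.symm k))).symm.trans (congrArg c'.1 (e.apply_symm_apply k))
  · rintro ⟨M, hM⟩
    have hM' := hM
    rw [Finset.mem_filter, Fintype.mem_piFinset] at hM'
    obtain ⟨hr, hc⟩ := hM'
    simp only [mem_finsuppAntidiag, subset_univ, and_true] at hr
    have hcard : Fintype.card (Σ x : Fin L × Fin L', Fin (M x.1 x.2)) = n := by
      rw [Fintype.card_sigma, Fintype.sum_prod_type]
      simp only [Fintype.card_fin]
      rw [← hα]
      exact Finset.sum_congr rfl fun i _ => hr i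
    let e := Fintype.equivFinOfCardEq hcard
    have hcount : ∀ i j, (univ.filter fun k => (e.symm k).1.1 = i ∧ (e.symm k).1.2 = j).card = M i j := by
      intro i j
      rw [← Fintype.card_fin (M i j), ← Finset.card_univ]
      symm
      refine Finset.card_bij (fun a _ => e ⟨(i, j), a⟩) (by simp) ?_ ?_
      · intro a _ b _ h
        have := e.injective h
        simpa using this
      · intro k hk
        obtain ⟨⟨⟨i', j'⟩, a⟩, rfl⟩ := e.surjective k
        simp at hk
        obtain ⟨rfl, rfl⟩ := hk
        exact ⟨a, by simp, rfl⟩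
    let c : Col n α := ⟨fun k => (e.symm k).1.1, fun i => by
      rw [← card_fib2 _ (fun k => (e.symm k).1.2)]
      simp only [hcount]; exact hr i⟩
    let c' : Col n β := ⟨fun k => (e.symm k).1.2, fun j => by
      rw [← card_fib2 _ (fun k => (e.symm k).1.1)]
      rw [← hc, Finsupp.finsetSum_apply]
      refine Finset.sum_congr rfl fun i _ => ?_
      rw [← hcount]; simp only [and_comm]⟩
    refine ⟨Quotient.mk'' (c, c'), Subtype.ext (funext fun i => Finsupp.ext fun j => ?_)⟩
    exact hcount i j

theorem gramG {K : Type} [Field K] [Fintype K] {n L L' : ℕ} {α : Fin L →₀ ℕ} {β : Fin L' →₀ ℕ} (hα : ∑ i, α i = n) (hβ : ∑ i, β i = n) :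
      ∑ g : GL (Fin n) K, piG α g * piG β g = Nmat α β * Fintype.card (GL (Fin n) K) := by
  obtain ⟨N, h1, h2⟩ := gram (K := K) hα hβ
  rw [gramS hα] at h2
  rw [h1, Nat.eq_of_mul_eq_mul_right Fintype.card_pos h2]

end hsym
end UT

/- part P11 -/
set_option linter.unusedSectionVars false
set_option linter.unusedSimpArgs false
namespace UT
section gramlin
open scoped Classical
open Finset
variable {Γ : Type} [Group Γ] [Fintype Γ]

theorem IsChar.zero : IsChar (fun _ : Γ => (0 : ℂ)) := by
  refine ⟨0, 1, fun g => ?_⟩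
  simp [Representation.character]

theorem IsChar.add {φ ψ : Γ → ℂ} (hφ : IsChar φ) (hψ : IsChar ψ) : IsChar (fun g => φ g + ψ g) := by
  obtain ⟨d, ρ, h⟩ := hφ
  obtain ⟨d', ρ', h'⟩ := hψ
  let R : Representation ℂ Γ ((Fin d → ℂ) × (Fin d' → ℂ)) :=
    { toFun := fun g => (ρ g).prodMap (ρ' g)
      map_one' := by simp
      map_mul' := fun g h => by simp [LinearMap.prodMap_mul] }
  have := IsChar.of R
  convert this using 2 with g
  simp only [h, h', Representation.character]
  exact (LinearMap.trace_prodMap' _ _).symm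

theorem IsChar.nsmul {φ : Γ → ℂ} (hφ : IsChar φ) (k : ℕ) : IsChar (fun g => (k : ℂ) * φ g) := by
  induction k with
  | zero => simpa using IsChar.zero
  | succ k ih => 
    have := ih.add hφ
    convert this using 2 with g
    push_cast; ring

theorem IsChar.sum {ι : Type} (s : Finset ι) (φ : ι → Γ → ℂ) (h : ∀ i ∈ s, IsChar (φ i)) : IsChar (fun g => ∑ i ∈ s, φ i g) := by
  induction s using Finset.induction_on with
  | empty => simpa using IsChar.zero
  | insert a s ha ih =>
    have := (h a (by simp)).add (ih fun i hi => h i (by simp [hi]))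
    convert this using 2 with g
    rw [Finset.sum_insert ha]

theorem ip_comm' (φ ψ : Γ → ℂ) : ip φ ψ = ip ψ φ := by
  unfold ip
  rw [← Equiv.sum_comp (Equiv.inv Γ)]
  congr 1
  refine Finset.sum_congr rfl fun g _ => ?_
  simp [mul_comm]

theorem ip_add_left (φ φ' ψ : Γ → ℂ) : ip (φ + φ') ψ = ip φ ψ + ip φ' ψ := by
  simp [ip, add_mul, Finset.sum_add_distrib, mul_add]
theorem ip_smul_left (c : ℂ) (φ ψ : Γ → ℂ) : ip (c • φ) ψ = c * ip φ ψ := by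
  simp [ip, Finset.mul_sum, mul_left_comm, mul_assoc]
theorem ip_sub_left (φ φ' ψ : Γ → ℂ) : ip (φ - φ') ψ = ip φ ψ - ip φ' ψ := by
  simp [ip, sub_mul, Finset.sum_sub_distrib, mul_sub]
theorem ip_sum_left {ι : Type} (s : Finset ι) (φ : ι → Γ → ℂ) (ψ : Γ → ℂ) : ip (∑ i ∈ s, φ i) ψ = ∑ i ∈ s, ip (φ i) ψ := by
  induction s using Finset.induction_on with
  | empty => simp [ip]
  | insert a s ha ih => rw [Finset.sum_insert ha, Finset.sum_insert ha, ip_add_left, ih]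

theorem ip_self_re {φ : Γ → ℂ} (h : ∀ g, φ g⁻¹ = star (φ g)) : ∃ r : ℝ, 0 ≤ r ∧ ip φ φ = r ∧ (r = 0 → φ = 0) := by
  refine ⟨(Fintype.card Γ : ℝ)⁻¹ * ∑ g, ‖φ g‖^2, by positivity, ?_, ?_⟩
  · unfold ip
    push_cast
    congr 1
    refine Finset.sum_congr rfl fun g _ => ?_
    rw [h]
    exact Complex.mul_conj' (φ g)
  · intro h0
    rcases mul_eq_zero.1 h0 with h1 | h1
    · simp at h1
    · rw [Finset.sum_eq_zero_iff_of_nonneg (fun _ _ => by positivity)] at h1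
      funext g
      simpa using h1 g (mem_univ g)

/-- index of formal combinations -/
def J (n : ℕ) : Type := Σ L : ℕ, {α : Fin L →₀ ℕ // ∑ i, α i = n}

/-- constructor -/
def Jm {n L : ℕ} (α : Fin L →₀ ℕ) (h : ∑ i, α i = n) : J n := ⟨L, α, h⟩

def Col.mk' {n L : ℕ} {α : Fin L →₀ ℕ} (c : Fin n → Fin L) (h : ∀ i, (univ.filter fun k => c k = i).card = α i) : Col n α := ⟨c, h⟩

variable {K : Type} [Field K] [Fintype K]

noncomputable def PiG (K : Type) [Field K] [Fintype K] (n : ℕ) : (J n →₀ ℝ) →ₗ[ℝ] (GL (Fin n) K → ℝ) :=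
  Finsupp.linearCombination ℝ (fun j g => (piG j.2.1 g : ℝ))
noncomputable def PiS (n : ℕ) : (J n →₀ ℝ) →ₗ[ℝ] (Equiv.Perm (Fin n) → ℝ) :=
  Finsupp.linearCombination ℝ (fun j g => (piS j.2.1 g : ℝ))

theorem PiG_apply {n : ℕ} (b : J n →₀ ℝ) (g) : PiG K n b g = b.sum fun j r => r * (piG j.2.1 g : ℝ) := by
  simp [PiG, Finsupp.linearCombination_apply, Finsupp.sum]
theorem PiS_apply {n : ℕ} (b : J n →₀ ℝ) (g) : PiS n b g = b.sum fun j r => r * (piS j.2.1 g : ℝ) := by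
  simp [PiS, Finsupp.linearCombination_apply, Finsupp.sum]

theorem PiG_single {n : ℕ} (j : J n) (r : ℝ) (g) : PiG K n (Finsupp.single j r) g = r * (piG j.2.1 g : ℝ) := by
  rw [PiG_apply, Finsupp.sum_single_index (by simp)]
theorem PiS_single {n : ℕ} (j : J n) (r : ℝ) (g) : PiS n (Finsupp.single j r) g = r * (piS j.2.1 g : ℝ) := by
  rw [PiS_apply, Finsupp.sum_single_index (by simp)]

theorem PiG_gram {n : ℕ} (b b' : J n →₀ ℝ) : ∑ g, PiG K n b g * PiG K n b' g =
    (Fintype.card (GL (Fin n) K) : ℝ) * b.sum fun j r => b'.sum fun j' r' => r * r' * (Nmat j.2.1 j'.2.1 : ℝ) := by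
  simp only [PiG_apply, Finsupp.sum, Finset.sum_mul_sum]
  simp only [Finset.mul_sum]
  rw [Finset.sum_comm]
  refine Finset.sum_congr rfl fun j _ => ?_
  rw [Finset.sum_comm]
  refine Finset.sum_congr rfl fun j' _ => ?_
  have := gramG (K := K) j.2.2 j'.2.2
  have h2 : ∑ g : GL (Fin n) K, (piG j.2.1 g : ℝ) * (piG j'.2.1 g : ℝ) = Nmat j.2.1 j'.2.1 * Fintype.card (GL (Fin n) K) := by exact_mod_cast this
  rw [mul_comm, mul_assoc, ← h2, Finset.mul_sum]
  exact Finset.sum_congr rfl fun g _ => by ring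

theorem PiS_gram {n : ℕ} (b b' : J n →₀ ℝ) : ∑ g, PiS n b g * PiS n b' g =
    (Fintype.card (Equiv.Perm (Fin n)) : ℝ) * b.sum fun j r => b'.sum fun j' r' => r * r' * (Nmat j.2.1 j'.2.1 : ℝ) := by
  simp only [PiS_apply, Finsupp.sum, Finset.sum_mul_sum]
  simp only [Finset.mul_sum]
  rw [Finset.sum_comm]
  refine Finset.sum_congr rfl fun j _ => ?_
  rw [Finset.sum_comm]
  refine Finset.sum_congr rfl fun j' _ => ?_
  have := gramS (β := j'.2.1) j.2.2
  have h2 : ∑ g : Equiv.Perm (Fin n), (piS j.2.1 g : ℝ) * (piS j'.2.1 g : ℝ) = Nmat j.2.1 j'.2.1 * Fintype.card (Equiv.Perm (Fin n)) := by exact_mod_cast this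
  rw [mul_comm, mul_assoc, ← h2, Finset.mul_sum]
  exact Finset.sum_congr rfl fun g _ => by ring

theorem ker_iff {n : ℕ} (b : J n →₀ ℝ) : PiG K n b = 0 ↔ PiS n b = 0 := by
  have h1 := PiG_gram (K := K) b b
  have h2 := PiS_gram b b
  have hG : ∀ (Δ : Type) [Fintype Δ] (f : Δ → ℝ), f = 0 ↔ ∑ g, f g * f g = 0 := by
    intro Δ _ f
    rw [Finset.sum_eq_zero_iff_of_nonneg (fun _ _ => mul_self_nonneg _)]
    constructor
    · rintro rfl; simp
    · intro h; funext g; simpa using h g (mem_univ g)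
  rw [hG, hG, h1, h2]
  simp

theorem piS_mapDomain {n L : ℕ} (e : Equiv.Perm (Fin L)) (γ : Fin L →₀ ℕ) (σ : Equiv.Perm (Fin n)) : piS (γ.mapDomain e) σ = piS γ σ := by
  unfold piS
  symm
  refine Finset.card_bij (fun c _ => (Col.mk' (fun k => e (c.1 k)) (fun i => ?_) : Col n (γ.mapDomain e))) ?_ ?_ ?_
  · rw [← e.apply_symm_apply i, Finsupp.mapDomain_apply e.injective, ← c.2]
    simp [Equiv.eq_symm_apply]
  · intro c hc
    rw [mem_filter] at hc ⊢
    replace hc := hc.2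
    refine ⟨mem_univ _, Col.ext (funext fun k => ?_)⟩
    have := congrFun (congrArg Subtype.val hc) k
    exact congrArg e this
  · intro c _ d _ h
    refine Col.ext (funext fun k => ?_)
    exact e.injective (congrFun (congrArg Subtype.val h) k)
  · intro c hc
    refine ⟨Col.mk' (fun k => e.symm (c.1 k)) (fun i => ?_), ?_, Col.ext (funext fun k => e.apply_symm_apply _)⟩
    · rw [← Finsupp.mapDomain_apply (f := e) e.injective, ← c.2]
      congr 1
      ext k; simp [Equiv.symm_apply_eq]
    · rw [mem_filter] at hc ⊢
      replace hc := hc.2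
      refine ⟨mem_univ _, ?_⟩
      refine Col.ext (funext fun k => ?_)
      have := congrFun (congrArg Subtype.val hc) k
      exact congrArg e.symm this

theorem piG_mapDomain {n L : ℕ} (e : Equiv.Perm (Fin L)) (γ : Fin L →₀ ℕ) (hγ : ∑ i, γ i = n) (g : GL (Fin n) K) : piG (γ.mapDomain e) g = piG γ g := by
  have hγ' : ∑ i, γ.mapDomain e i = n := by
    rw [← hγ, ← Equiv.sum_comp e]
    exact Finset.sum_congr rfl fun i _ => Finsupp.mapDomain_apply e.injective _ _
  have := (ker_iff (K := K) (Finsupp.single (Jm _ hγ') 1 - Finsupp.single (Jm _ hγ) 1)).2 (by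
    funext σ
    rw [map_sub, Pi.sub_apply, PiS_single, PiS_single]
    simp [Jm, piS_mapDomain])
  have h2 := congrFun this g
  rw [map_sub, Pi.sub_apply, PiG_single, PiG_single] at h2
  simp [Jm, sub_eq_zero] at h2
  exact_mod_cast h2

theorem fix_inv {X : Type} [Fintype X] [MulAction Γ X] (g : Γ) : (univ.filter fun x : X => g⁻¹ • x = x) = (univ.filter fun x : X => g • x = x) := by
  ext x; simp only [mem_filter, mem_univ, true_and, inv_smul_eq_iff]; exact eq_comm

theorem piG_inv {n L : ℕ} (α : Fin L →₀ ℕ) (g : GL (Fin n) K) : piG α g⁻¹ = piG α g := by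
  unfold piG; rw [fix_inv]
theorem piS_inv {n L : ℕ} (α : Fin L →₀ ℕ) (g : Equiv.Perm (Fin n)) : piS α g⁻¹ = piS α g := by
  unfold piS; rw [fix_inv]

noncomputable def pG {n L : ℕ} (α : Fin L →₀ ℕ) : GL (Fin n) K → ℂ := fun g => (piG α g : ℂ)
noncomputable def pS {n L : ℕ} (α : Fin L →₀ ℕ) : Equiv.Perm (Fin n) → ℂ := fun g => (piS α g : ℂ)

theorem pG_char {n L : ℕ} (α : Fin L →₀ ℕ) : IsChar (pG α : GL (Fin n) K → ℂ) := perm_isChar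
theorem pS_char {n L : ℕ} (α : Fin L →₀ ℕ) : IsChar (pS α : Equiv.Perm (Fin n) → ℂ) := perm_isChar

theorem ip_pG {n L L' : ℕ} {α : Fin L →₀ ℕ} {β : Fin L' →₀ ℕ} (hα : ∑ i, α i = n) (hβ : ∑ i, β i = n) :
    ip (pG α : GL (Fin n) K → ℂ) (pG β) = Nmat α β := by
  unfold ip pG
  simp only [piG_inv]
  have h : ∑ g : GL (Fin n) K, (piG α g : ℂ) * (piG β g : ℂ) = Nmat α β * Fintype.card (GL (Fin n) K) := by
    exact_mod_cast gramG (K := K) hα hβ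
  rw [h]; field_simp

theorem ip_pS {n L L' : ℕ} {α : Fin L →₀ ℕ} {β : Fin L' →₀ ℕ} (hα : ∑ i, α i = n) :
    ip (pS α : Equiv.Perm (Fin n) → ℂ) (pS β) = Nmat α β := by
  unfold ip pS
  simp only [piS_inv]
  have h : ∑ g : Equiv.Perm (Fin n), (piS α g : ℂ) * (piS β g : ℂ) = Nmat α β * Fintype.card (Equiv.Perm (Fin n)) := by
    exact_mod_cast gramS (β := β) hα
  have h0 : (Fintype.card (Equiv.Perm (Fin n)) : ℂ) ≠ 0 := by simp
  rw [h, mul_comm, mul_assoc, mul_inv_cancel₀ h0, mul_one]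

end gramlin
end UT

/- part P12 -/
set_option linter.unusedSectionVars false
set_option linter.unusedSimpArgs false
namespace UT
section irr
open scoped Classical ComplexOrder
open Finset
variable {K : Type} [Field K] [Fintype K]

/-- the composition 1^n -/
noncomputable def ones (n : ℕ) : Fin n →₀ ℕ := Finsupp.equivFunOnFinite.symm fun _ => 1
theorem ones_sum (n : ℕ) : ∑ i, ones n i = n := by simp [ones]
noncomputable def colId (n : ℕ) : Col n (ones n) := Col.mk' id (fun i => by simp [ones, Finset.filter_eq'])

theorem stab_colId {n : ℕ} (g : GL (Fin n) K) (hg : g • (toFlag (colId n) : FlagG K n (ones n)) = toFlag (colId n)) (i j : Fin n) (hij : j < i) :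
    (g : Matrix (Fin n) (Fin n) K) i j = 0 := by
  have h1 : act g (cspan id j) = cspan id j := congrFun (congrArg Subtype.val hg) j
  have h2 : Matrix.mulVecLin (g : Matrix (Fin n) (Fin n) K) (Pi.basisFun K (Fin n) j) ∈ (cspan id j : Submodule K (Fin n → K)) := by
    rw [← h1]
    exact Submodule.mem_map_of_mem (Submodule.subset_span ⟨j, le_refl j, rfl⟩)
  rw [cspan, Module.Basis.mem_span_image] at h2
  by_contra hne
  have h3 : i ∈ ((Pi.basisFun K (Fin n)).repr (Matrix.mulVecLin (g : Matrix (Fin n) (Fin n) K) (Pi.basisFun K (Fin n) j))).support := by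
    simp [Finsupp.mem_support_iff, hne]
  have h4 : i ≤ j := h2 h3
  exact absurd hij (not_lt.2 h4)

theorem irr_form {n d : ℕ} (ρ : Representation ℂ (GL (Fin n) K) (Fin d → ℂ))
    (hirr : ∀ W : Submodule ℂ (Fin d → ℂ), (∀ (g : GL (Fin n) K), ∀ v ∈ W, ρ g v ∈ W) → W = ⊥ ∨ W = ⊤)
    (v : Fin d → ℂ) (hv : v ≠ 0) (hfix : ∀ g : GL (Fin n) K, (∀ i j : Fin n, j < i → (g : Matrix (Fin n) (Fin n) K) i j = 0) → ρ g v = v) :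
    ∃ b : J n →₀ ℝ, (∀ g, ρ.character g = (PiG K n b g : ℂ)) ∧ IsChar (fun σ => (PiS n b σ : ℂ)) := by
  have hd : d ≠ 0 := by
    rintro rfl; exact hv (Subsingleton.elim _ _)
  set ψ := ρ.character with hψ
  have hψc : IsChar ψ := IsChar.of ρ
  choose ℓ hℓ using fun γ : Fin n →₀ ℕ => hψc.ip_nat (pG_char (K := K) (n := n) γ)
  have h1 : ℓ (ones n) ≠ 0 := by
    have := perm_pair ρ (toFlag (colId n) : FlagG K n (ones n)) v hv (fun g hg => hfix g (fun i j h => stab_colId g hg i j h))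
    intro h0
    apply this
    have h2 := hℓ (ones n)
    rw [h0] at h2
    exact_mod_cast h2
  obtain ⟨c, hc⟩ := unimod n (fun γ => (ℓ γ : ℤ)) (by
    intro e γ hγ
    have : (pG (γ.mapDomain e) : GL (Fin n) K → ℂ) = pG γ := by
      funext g; simp [pG, piG_mapDomain e γ hγ g]
    have h2 := hℓ (γ.mapDomain e)
    rw [this, hℓ γ] at h2
    exact_mod_cast h2.symm)
  set A := finsuppAntidiag (univ : Finset (Fin n)) n with hA
  have hAm : ∀ β ∈ A, ∑ i, β i = n := by intro β hβ; simpa [hA] using hβ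
  let a : GL (Fin n) K → ℂ := ∑ β ∈ A, (c β : ℂ) • pG β
  let s : Equiv.Perm (Fin n) → ℂ := ∑ β ∈ A, (c β : ℂ) • pS β
  have haγ : ∀ γ ∈ A, ip a (pG γ) = ℓ γ := by
    intro γ hγ
    simp only [a]
    rw [ip_sum_left]
    have := hc γ (hAm γ hγ)
    have h3 : (ℓ γ : ℂ) = ∑ β ∈ A, (c β : ℂ) * Nmat β γ := by exact_mod_cast this
    rw [h3]
    refine Finset.sum_congr rfl fun β hβ => ?_
    rw [ip_smul_left, ip_pG (hAm β hβ) (hAm γ hγ)]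
  have hsγ : ∀ γ ∈ A, ip s (pS γ) = ℓ γ := by
    intro γ hγ
    simp only [s]
    rw [ip_sum_left]
    have := hc γ (hAm γ hγ)
    have h3 : (ℓ γ : ℂ) = ∑ β ∈ A, (c β : ℂ) * Nmat β γ := by exact_mod_cast this
    rw [h3]
    refine Finset.sum_congr rfl fun β hβ => ?_
    rw [ip_smul_left, ip_pS (hAm β hβ)]
  have honesA : ones n ∈ A := by simp [hA, ones_sum]
  have haa : ip a a = ((∑ β ∈ A, c β * ℓ β : ℤ) : ℂ) := by
    have : ip a a = ∑ β ∈ A, (c β : ℂ) * ip a (pG β) := by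
      conv_lhs => rw [ip_comm']; simp only [a]
      rw [ip_sum_left]
      refine Finset.sum_congr rfl fun β hβ => ?_
      rw [ip_smul_left, ip_comm']
    rw [this]; push_cast
    exact Finset.sum_congr rfl fun β hβ => by rw [haγ β hβ]
  have hss : ip s s = ((∑ β ∈ A, c β * ℓ β : ℤ) : ℂ) := by
    have : ip s s = ∑ β ∈ A, (c β : ℂ) * ip s (pS β) := by
      conv_lhs => rw [ip_comm']; simp only [s]
      rw [ip_sum_left]
      refine Finset.sum_congr rfl fun β hβ => ?_
      rw [ip_smul_left, ip_comm']
    rw [this]; push_cast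
    exact Finset.sum_congr rfl fun β hβ => by rw [hsγ β hβ]
  have hψa : ip ψ a = ip a a := by
    have : ip ψ a = ∑ β ∈ A, (c β : ℂ) * ip ψ (pG β) := by
      rw [ip_comm']; simp only [a]
      rw [ip_sum_left]
      refine Finset.sum_congr rfl fun β hβ => ?_
      rw [ip_smul_left, ip_comm']
    rw [this, haa]; push_cast
    exact Finset.sum_congr rfl fun β hβ => by rw [hℓ β]
  have hψψ : ip ψ ψ = 1 := by
    have := irr_orth ρ ρ hirr hd hirr hd
    simpa using this
  have hainv : ∀ g, a g⁻¹ = star (a g) := by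
    intro g
    simp [a, pG, piG_inv]
  have hdiff : ip (ψ - a) (ψ - a) = 1 - ip a a := by
    have e1 : ∀ x : GL (Fin n) K → ℂ, ip x (ψ - a) = ip x ψ - ip x a := by
      intro x; rw [ip_comm', ip_sub_left, ip_comm' ψ, ip_comm' a]
    rw [ip_sub_left, e1, e1, hψψ, hψa, ip_comm' a ψ, hψa]; ring
  obtain ⟨r, hr0, hr, _⟩ := ip_self_re hainv
  have hane : a ≠ 0 := by
    intro h0
    have := haγ _ honesA
    rw [h0] at this
    simp [ip] at this
    exact h1 (by exact_mod_cast this.symm)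
  obtain ⟨r', hr0', hr', hz'⟩ := ip_self_re (φ := ψ - a) (by
    intro g; simp only [Pi.sub_apply, star_sub]; rw [hψc.inv, hainv])
  rw [hdiff, hr] at hr'
  have hreq : 1 - r = r' := by exact_mod_cast hr'
  rw [hr] at haa
  have hrint : r = ((∑ β ∈ A, c β * ℓ β : ℤ) : ℝ) := by exact_mod_cast haa
  have hrne : r ≠ 0 := by
    intro h0
    obtain ⟨r2, _, h5, h6⟩ := ip_self_re hainv
    rw [hr] at h5
    have : r = r2 := by exact_mod_cast h5
    exact hane (h6 (this ▸ h0))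
  have hZ : (∑ β ∈ A, c β * ℓ β : ℤ) = 1 := by
    have hpos : 0 < r := lt_of_le_of_ne hr0 (Ne.symm hrne)
    have hle : r ≤ 1 := by linarith
    rw [hrint] at hpos hle
    have p1 : (0:ℤ) < ∑ β ∈ A, c β * ℓ β := by exact_mod_cast hpos
    have p2 : (∑ β ∈ A, c β * ℓ β : ℤ) ≤ 1 := by exact_mod_cast hle
    omega
  have hr1 : r = 1 := by rw [hrint, hZ]; simp
  have hψeq : ψ = a := by
    have := hz' (by linarith)
    exact sub_eq_zero.1 this
  -- the symmetric side
  let b : J n →₀ ℝ := ∑ β ∈ A.attach, Finsupp.single (Jm β.1 (hAm β.1 β.2)) (c β.1 : ℝ)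
  have hbG : ∀ g, (PiG K n b g : ℂ) = a g := by
    intro g
    simp only [b, a, map_sum, Finset.sum_apply, PiG_single]
    rw [← Finset.sum_attach A]
    push_cast
    exact Finset.sum_congr rfl fun β _ => rfl
  have hbS : ∀ g, (PiS n b g : ℂ) = s g := by
    intro g
    simp only [b, s, map_sum, Finset.sum_apply, PiS_single]
    rw [← Finset.sum_attach A]
    push_cast
    exact Finset.sum_congr rfl fun β _ => rfl
  refine ⟨b, fun g => by rw [hbG, hψeq], ?_⟩
  have hbS' : (fun σ => (PiS n b σ : ℂ)) = s := funext hbS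
  rw [hbS']
  have hp : IsChar (fun g : Equiv.Perm (Fin n) => ∑ β ∈ A, ((c β).toNat : ℂ) * pS β g) := IsChar.sum A _ fun β _ => (pS_char β).nsmul _
  have hm : IsChar (fun g : Equiv.Perm (Fin n) => ∑ β ∈ A, ((-c β).toNat : ℂ) * pS β g) := IsChar.sum A _ fun β _ => (pS_char β).nsmul _
  have hs : s = (fun g : Equiv.Perm (Fin n) => ∑ β ∈ A, ((c β).toNat : ℂ) * pS β g) - (fun g : Equiv.Perm (Fin n) => ∑ β ∈ A, ((-c β).toNat : ℂ) * pS β g) := by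
    funext g
    simp only [s, Pi.sub_apply, Finset.sum_apply, Pi.smul_apply, smul_eq_mul, ← Finset.sum_sub_distrib, ← sub_mul]
    refine Finset.sum_congr rfl fun β _ => ?_
    congr 1
    have : c β = ((c β).toNat : ℤ) - ((-c β).toNat : ℤ) := by omega
    exact_mod_cast congrArg (Int.cast : ℤ → ℂ) this
  have hss1 : ip s s = 1 := by rw [hss, hZ]; simp
  have := norm_one hp hm (by rw [← hs, hss1])
  rcases this with h | h
  · rw [hs]; exact h
  · exfalso
    have h7 : -s = (fun g : Equiv.Perm (Fin n) => ∑ β ∈ A, ((-c β).toNat : ℂ) * pS β g) - (fun g : Equiv.Perm (Fin n) => ∑ β ∈ A, ((c β).toNat : ℂ) * pS β g) := by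
      rw [hs]; ring
    rw [← h7] at h
    obtain ⟨k, hk⟩ := h.ip_nat (pS_char (ones n))
    have h8 : ip (-s) (pS (ones n)) = - ip s (pS (ones n)) := by
      have := ip_smul_left (-1) s (pS (ones n))
      simpa using this
    rw [h8, hsγ _ honesA] at hk
    have : ((k + ℓ (ones n) : ℕ) : ℂ) = 0 := by push_cast; rw [← hk]; ring
    have h9 : k + ℓ (ones n) = 0 := by exact_mod_cast this
    omega

end irr
end UT

/- part P12b -/
set_option linter.unusedSectionVars false
set_option linter.unusedSimpArgs false
namespace UT
section chiform
open scoped Classical ComplexOrder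
open Finset
variable {K : Type} [Field K] [Fintype K]

theorem chi_form {n k : ℕ} (χ : GL (Fin n) K → ℂ) (c : Fin k → ℂ) (d : Fin k → ℕ)
    (ρ : ∀ i, Representation ℂ (GL (Fin n) K) (Fin (d i) → ℂ))
    (hirr : ∀ i, ∀ W : Submodule ℂ (Fin (d i) → ℂ), (∀ (g : GL (Fin n) K), ∀ v ∈ W, ρ i g v ∈ W) → W = ⊥ ∨ W = ⊤)
    (hvec : ∀ i, ∃ v : Fin (d i) → ℂ, v ≠ 0 ∧ ∀ g : GL (Fin n) K, (∀ i j : Fin n, j < i → (g : Matrix (Fin n) (Fin n) K) i j = 0) → ρ i g v = v)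
    (hχ : ∀ g, χ g = ∑ i, c i * (ρ i).character g)
    (hpd : ∀ x : GL (Fin n) K → ℂ, 0 ≤ ∑ g, ∑ h, star (x g) * x h * χ (g⁻¹ * h)) :
    ∃ b : J n →₀ ℝ, (∀ g, χ g = (PiG K n b g : ℂ)) ∧
      ∀ x : Equiv.Perm (Fin n) → ℝ, 0 ≤ ∑ σ, ∑ τ, x σ * x τ * PiS n b (σ⁻¹ * τ) := by
  have hd : ∀ i, d i ≠ 0 := by
    intro i h0
    obtain ⟨v, hv, _⟩ := hvec i
    have : IsEmpty (Fin (d i)) := by rw [h0]; infer_instance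
    exact hv (Subsingleton.elim _ _)
  have hform : ∀ i, ∃ b : J n →₀ ℝ, (∀ g, (ρ i).character g = (PiG K n b g : ℂ)) ∧ IsChar (fun σ => (PiS n b σ : ℂ)) := by
    intro i
    obtain ⟨v, hv, hf⟩ := hvec i
    exact irr_form (ρ i) (hirr i) v hv hf
  choose b hbG hbS using hform
  -- index of a representative
  let r : Fin k → Fin k := fun i => Classical.choose (⟨i, rfl⟩ : ∃ j, (ρ j).character = (ρ i).character)
  have hr : ∀ i, (ρ (r i)).character = (ρ i).character := fun i => Classical.choose_spec (⟨i, rfl⟩ : ∃ j, (ρ j).character = (ρ i).character)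
  have hrr : ∀ i j, (ρ i).character = (ρ j).character → r i = r j := by
    intro i j h
    simp only [r]
    congr 1
    simp only [h]
  let R : Finset (Fin k) := univ.image r
  let C : Fin k → ℂ := fun j => ∑ i with r i = j, c i
  have hχ2 : χ = ∑ j ∈ R, C j • (ρ j).character := by
    funext g
    rw [hχ]
    simp only [Finset.sum_apply, Pi.smul_apply, smul_eq_mul, C, Finset.sum_mul]
    rw [← Finset.sum_fiberwise_of_maps_to (s := univ) (t := R) (g := r) (fun i _ => Finset.mem_image_of_mem _ (mem_univ _))]
    refine Finset.sum_congr rfl fun j _ => Finset.sum_congr rfl fun i hi => ?_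
    rw [← (mem_filter.1 hi).2, hr]
  have hC : ∀ j ∈ R, ∃ t : ℝ, 0 ≤ t ∧ C j = t := by
    intro j hj
    have h1 : ip χ (ρ j).character = C j := by
      rw [hχ2, ip_sum_left, Finset.sum_eq_single j]
      · rw [ip_smul_left, irr_orth _ _ (hirr j) (hd j) (hirr j) (hd j)]; simp
      · intro i hi hij
        rw [ip_smul_left, irr_orth _ _ (hirr i) (hd i) (hirr j) (hd j), if_neg, mul_zero]
        intro h
        obtain ⟨i', -, rfl⟩ := mem_image.1 hi
        obtain ⟨j', -, rfl⟩ := mem_image.1 hj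
        rw [hr, hr] at h
        exact hij (hrr _ _ h)
      · intro h; exact absurd hj h
    have h2 : 0 ≤ C j := by rw [← h1]; exact ip_nonneg (IsChar.of _) hpd
    refine ⟨(C j).re, (Complex.nonneg_iff.1 h2).1, ?_⟩
    exact Complex.ext rfl (by simpa using (Complex.nonneg_iff.1 h2).2.symm)
  choose! t ht0 ht using hC
  refine ⟨∑ j ∈ R, t j • b j, fun g => ?_, fun x => ?_⟩
  · rw [hχ2]
    simp only [map_sum, map_smul, Finset.sum_apply, Pi.smul_apply, smul_eq_mul]
    push_cast
    exact Finset.sum_congr rfl fun j hj => by rw [ht j hj, hbG]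
  · have : ∑ σ, ∑ τ, x σ * x τ * PiS n (∑ j ∈ R, t j • b j) (σ⁻¹ * τ) = ∑ j ∈ R, t j * ∑ σ, ∑ τ, x σ * x τ * PiS n (b j) (σ⁻¹ * τ) := by
      simp only [map_sum, map_smul, Finset.sum_apply, Pi.smul_apply, smul_eq_mul, Finset.mul_sum]
      rw [Finset.sum_comm (s := R)]
      refine Finset.sum_congr rfl fun σ _ => ?_
      rw [Finset.sum_comm (s := R)]
      refine Finset.sum_congr rfl fun τ _ => Finset.sum_congr rfl fun j _ => by ring
    rw [this]
    refine Finset.sum_nonneg fun j hj => mul_nonneg (ht0 j hj) ?_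
    have h3 := (hbS j).pd (fun σ => (x σ : ℂ))
    have h4 : ∑ g, ∑ h, star ((x g : ℝ) : ℂ) * (x h : ℂ) * ((PiS n (b j) (g⁻¹ * h) : ℝ) : ℂ) = ((∑ σ, ∑ τ, x σ * x τ * PiS n (b j) (σ⁻¹ * τ) : ℝ) : ℂ) := by
      push_cast
      simp
    rw [h4] at h3
    exact_mod_cast h3
end chiform
end UT

/- part P13 -/
set_option linter.unusedSectionVars false
set_option linter.unusedSimpArgs false
namespace UT
section extcount
open scoped Classical
open Finset
variable {K : Type} [Field K] [Fintype K]

/-- inclusion `K^n → K^{n+1}` -/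
def inc (K : Type) [Field K] (n : ℕ) : (Fin n → K) →ₗ[K] (Fin (n + 1) → K) where
  toFun w := Fin.snoc (α := fun _ => K) w 0
  map_add' a b := by ext i; refine Fin.lastCases ?_ (fun i => ?_) i <;> simp
  map_smul' a b := by ext i; refine Fin.lastCases ?_ (fun i => ?_) i <;> simp

def ev {n : ℕ} (x : Fin n → K) : Fin (n + 1) → K := Fin.snoc (α := fun _ => K) x 1

def ini {n : ℕ} (y : Fin (n + 1) → K) : Fin n → K := fun i => y i.castSucc

@[simp] theorem inc_last {n : ℕ} (w : Fin n → K) : inc K n w (Fin.last n) = 0 := by simp [inc]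
@[simp] theorem inc_cs {n : ℕ} (w : Fin n → K) (i) : inc K n w (Fin.castSucc i) = w i := by simp [inc]
@[simp] theorem ev_last {n : ℕ} (w : Fin n → K) : ev w (Fin.last n) = 1 := by simp [ev]
@[simp] theorem ev_cs {n : ℕ} (w : Fin n → K) (i) : ev w (Fin.castSucc i) = w i := by simp [ev]

theorem inc_inj {n : ℕ} : Function.Injective (inc K n) := by
  intro a b h; ext i; simpa using congrFun h i.castSucc

theorem decomp {n : ℕ} (x : Fin n → K) (y : Fin (n + 1) → K) :
    y = inc K n (ini y - y (Fin.last n) • x) + y (Fin.last n) • ev x := by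
  ext i; refine Fin.lastCases ?_ (fun i => ?_) i <;> simp [ini]

theorem decomp0 {n : ℕ} (y : Fin (n + 1) → K) (h : y (Fin.last n) = 0) : y = inc K n (ini y) := by
  ext i; refine Fin.lastCases ?_ (fun i => ?_) i <;> simp [ini, h]

theorem ev_sub {n : ℕ} (x x' : Fin n → K) : ev x' = inc K n (x' - x) + ev x := by
  ext i; refine Fin.lastCases ?_ (fun i => ?_) i <;> simp [ini]

noncomputable def up {n : ℕ} (U : Submodule K (Fin n → K)) (x : Fin n → K) : Submodule K (Fin (n + 1) → K) :=
  U.map (inc K n) ⊔ Submodule.span K {ev x}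

theorem ev_mem_up {n : ℕ} (U : Submodule K (Fin n → K)) (x : Fin n → K) : ev x ∈ up U x :=
  Submodule.mem_sup_right (Submodule.mem_span_singleton_self _)

theorem up_of_mem {n : ℕ} {A : Submodule K (Fin (n + 1) → K)} {x : Fin n → K} (h : ev x ∈ A) :
    A = up (A.comap (inc K n)) x := by
  apply le_antisymm
  · intro y hy
    rw [decomp x y]
    refine add_mem (Submodule.mem_sup_left (Submodule.mem_map_of_mem ?_)) (Submodule.smul_mem _ _ (ev_mem_up _ _))
    rw [Submodule.mem_comap]
    have := sub_mem hy (A.smul_mem (y (Fin.last n)) h)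
    have e := decomp x y
    rw [← sub_eq_iff_eq_add] at e
    rwa [← e]
  · refine sup_le (Submodule.map_comap_le _ _) ?_
    rw [Submodule.span_singleton_le_iff_mem]; exact h

theorem low_of {n : ℕ} {A : Submodule K (Fin (n + 1) → K)} (h : ∀ y ∈ A, y (Fin.last n) = 0) :
    A = (A.comap (inc K n)).map (inc K n) := by
  apply le_antisymm
  · intro y hy
    refine ⟨ini y, ?_, (decomp0 y (h y hy)).symm⟩
    change inc K n (ini y) ∈ A
    rwa [← decomp0 y (h y hy)]
  · exact Submodule.map_comap_le _ _

theorem low_map {n : ℕ} (U : Submodule K (Fin n → K)) : ∀ y ∈ U.map (inc K n), y (Fin.last n) = 0 := by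
  rintro _ ⟨w, _, rfl⟩; simp

theorem comap_low {n : ℕ} (U : Submodule K (Fin n → K)) : (U.map (inc K n)).comap (inc K n) = U :=
  Submodule.comap_map_eq_of_injective inc_inj U

theorem comap_up {n : ℕ} (U : Submodule K (Fin n → K)) (x) : (up U x).comap (inc K n) = U := by
  apply le_antisymm
  · intro w hw
    rw [Submodule.mem_comap, up, Submodule.mem_sup] at hw
    obtain ⟨a, ⟨u, hu, rfl⟩, b, hb, hab⟩ := hw
    obtain ⟨t, rfl⟩ := Submodule.mem_span_singleton.1 hb
    have h1 := congrFun hab (Fin.last n)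
    simp at h1
    rw [h1, zero_smul, add_zero] at hab
    rwa [← inc_inj hab]
  · intro w hw
    exact Submodule.mem_sup_left (Submodule.mem_map_of_mem hw)

theorem ev_mem_up_iff {n : ℕ} (U : Submodule K (Fin n → K)) (x x') : ev x' ∈ up U x ↔ x' - x ∈ U := by
  rw [ev_sub x x', Submodule.add_mem_iff_left _ (ev_mem_up U x), ← Submodule.mem_comap, comap_up]

theorem up_eq_iff {n : ℕ} (U U' : Submodule K (Fin n → K)) (x x') : up U' x' = up U x ↔ U' = U ∧ x' - x ∈ U := by
  constructor
  · intro h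
    refine ⟨by rw [← comap_up U' x', h, comap_up], ?_⟩
    rw [← ev_mem_up_iff, ← h]; exact ev_mem_up _ _
  · rintro ⟨rfl, h⟩
    rw [← ev_mem_up_iff] at h
    have := up_of_mem h
    rw [comap_up] at this
    exact this.symm

theorem finrank_low {n : ℕ} (U : Submodule K (Fin n → K)) : Module.finrank K (U.map (inc K n)) = Module.finrank K U :=
  (LinearEquiv.finrank_eq (Submodule.equivMapOfInjective _ inc_inj U)).symm

theorem finrank_up {n : ℕ} (U : Submodule K (Fin n → K)) (x) : Module.finrank K (up U x) = Module.finrank K U + 1 := by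
  have h := Submodule.finrank_sup_add_finrank_inf_eq (U.map (inc K n)) (Submodule.span K {ev x})
  have h0 : U.map (inc K n) ⊓ Submodule.span K {ev x} = ⊥ := by
    rw [eq_bot_iff]
    rintro y ⟨h1, h2⟩
    obtain ⟨t, rfl⟩ := Submodule.mem_span_singleton.1 h2
    have := low_map U _ h1
    simp at this
    simp [this]
  have hne : ev x ≠ 0 := by
    intro h; have := congrFun h (Fin.last n); simp at this
  rw [h0, finrank_bot, finrank_low, finrank_span_singleton hne] at h
  rw [up]; omega

theorem up_mono {n : ℕ} {U U' : Submodule K (Fin n → K)} (h : U ≤ U') (x) : up U x ≤ up U' x :=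
  sup_le_sup_right (Submodule.map_mono h) _

theorem low_or {n : ℕ} (A : Submodule K (Fin (n + 1) → K)) : (∀ y ∈ A, y (Fin.last n) = 0) ∨ ∃ x, ev x ∈ A := by
  by_contra! h
  obtain ⟨⟨y, hy, h0⟩, h2⟩ := h
  refine h2 (ini ((y (Fin.last n))⁻¹ • y)) ?_
  have : ev (ini ((y (Fin.last n))⁻¹ • y)) = (y (Fin.last n))⁻¹ • y := by
    ext i; refine Fin.lastCases ?_ (fun i => ?_) i <;> simp [ini, h0]
  rw [this]; exact A.smul_mem _ hy

theorem sum_sub_single {L : ℕ} (α : Fin L →₀ ℕ) (i0 : Fin L) (hp : 0 < α i0) (i : Fin L) :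
    ∑ j ∈ Iic i, α j = ∑ j ∈ Iic i, (α - Finsupp.single i0 1 : Fin L →₀ ℕ) j + if i0 ≤ i then 1 else 0 := by
  have : ∀ j, α j = (α - Finsupp.single i0 1 : Fin L →₀ ℕ) j + if i0 = j then 1 else 0 := by
    intro j
    rw [Finsupp.tsub_apply, Finsupp.single_apply]
    split_ifs with h
    · subst h; omega
    · omega
  rw [Finset.sum_congr rfl fun j _ => this j, Finset.sum_add_distrib, Finset.sum_ite_eq]
  simp

noncomputable def mkF {n L : ℕ} (i0 : Fin L) (x : Fin n → K) (G : Fin L → Submodule K (Fin n → K)) (i : Fin L) :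
    Submodule K (Fin (n + 1) → K) := if i0 ≤ i then up (G i) x else (G i).map (inc K n)

theorem mkF_mono {n L : ℕ} (i0 : Fin L) (x : Fin n → K) {G : Fin L → Submodule K (Fin n → K)} (hG : Monotone G) : Monotone (mkF i0 x G) := by
  intro i j hij
  have hG := hG hij
  unfold mkF
  by_cases h1 : i0 ≤ i
  · rw [if_pos h1, if_pos (h1.trans hij)]; exact up_mono hG x
  · by_cases h2 : i0 ≤ j
    · rw [if_neg h1, if_pos h2]; exact (Submodule.map_mono hG).trans le_sup_left
    · rw [if_neg h1, if_neg h2]; exact Submodule.map_mono hG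

theorem mkF_dim {n L : ℕ} (i0 : Fin L) (x : Fin n → K) (G : Fin L → Submodule K (Fin n → K)) (i : Fin L) :
    Module.finrank K (mkF i0 x G i) = Module.finrank K (G i) + if i0 ≤ i then 1 else 0 := by
  unfold mkF
  by_cases h : i0 ≤ i
  · rw [if_pos h, if_pos h]; exact finrank_up _ _
  · rw [if_neg h, if_neg h]; exact finrank_low _

noncomputable def mkFl {n L : ℕ} {α : Fin L →₀ ℕ} {i0 : Fin L} (hp : 0 < α i0) (x : Fin n → K)
    (G : FlagG K n (α - Finsupp.single i0 1)) : FlagG K (n + 1) α :=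
  ⟨mkF i0 x G.1, mkF_mono i0 x G.2.1, fun i => by
    rw [sum_sub_single α i0 hp i, ← G.2.2 i, mkF_dim]⟩

theorem mkFl_apply {n L : ℕ} {α : Fin L →₀ ℕ} {i0 : Fin L} (hp : 0 < α i0) (x : Fin n → K)
    (G : FlagG K n (α - Finsupp.single i0 1)) (i) : (mkFl hp x G).1 i = if i0 ≤ i then up (G.1 i) x else (G.1 i).map (inc K n) := rfl

def Lv {n L : ℕ} {α : Fin L →₀ ℕ} (Fl : FlagG K (n + 1) α) (i0 : Fin L) : Prop :=
  (∃ x, ev x ∈ Fl.1 i0) ∧ ∀ i < i0, ∀ y ∈ Fl.1 i, y (Fin.last n) = 0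

noncomputable def resFl {n L : ℕ} {α : Fin L →₀ ℕ} {i0 : Fin L} (hp : 0 < α i0) 
    (Fl : FlagG K (n + 1) α) (h : Lv Fl i0) : FlagG K n (α - Finsupp.single i0 1) :=
  ⟨fun i => (Fl.1 i).comap (inc K n), fun i j hij => Submodule.comap_mono (Fl.2.1 hij), by
    intro i
    have h1 := Fl.2.2 i
    change Module.finrank K ((Fl.1 i).comap (inc K n)) = _
    rw [sum_sub_single α i0 hp i] at h1
    by_cases hi : i0 ≤ i
    · obtain ⟨x, hx⟩ := h.1
      rw [up_of_mem (Fl.2.1 hi hx), finrank_up] at h1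
      rw [if_pos hi] at h1
      omega
    · rw [low_of (h.2 i (not_le.1 hi)), finrank_low, if_neg hi] at h1
      exact h1⟩

theorem resFl_apply {n L : ℕ} {α : Fin L →₀ ℕ} {i0 : Fin L} (hp : 0 < α i0) 
    (Fl : FlagG K (n + 1) α) (h : Lv Fl i0) (i) : (resFl hp Fl h).1 i = (Fl.1 i).comap (inc K n) := rfl

theorem Lv_ex {n L : ℕ} {α : Fin L →₀ ℕ} (hα : ∑ i, α i = n + 1) (Fl : FlagG K (n + 1) α) : ∃ i, Lv Fl i := by
  obtain ⟨i, hi⟩ := top_of hα Fl (Nat.succ_pos n)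
  have hne : (univ.filter fun i => ∃ x, ev x ∈ Fl.1 i).Nonempty := ⟨i, by simp [hi]⟩
  refine ⟨_, (mem_filter.1 (Finset.min'_mem _ hne)).2, fun j hj => ?_⟩
  rcases low_or (Fl.1 j) with h | h
  · exact h
  · exact absurd (Finset.min'_le _ j (mem_filter.2 ⟨mem_univ _, h⟩)) (not_le.2 hj)

theorem Lv_unique {n L : ℕ} {α : Fin L →₀ ℕ} {Fl : FlagG K (n + 1) α} {i j} (hi : Lv Fl i) (hj : Lv Fl j) : i = j := by
  rcases lt_trichotomy i j with h | h | h
  · obtain ⟨x, hx⟩ := hi.1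
    have := hj.2 i h _ hx; simp at this
  · exact h
  · obtain ⟨x, hx⟩ := hj.1
    have := hi.2 j h _ hx; simp at this

theorem Lv_pos {n L : ℕ} {α : Fin L →₀ ℕ} {Fl : FlagG K (n + 1) α} {i} (hi : Lv Fl i) : 0 < α i := by
  by_contra h0
  have h0 : α i = 0 := by omega
  obtain ⟨x, hx⟩ := hi.1
  have hd := Fl.2.2 i
  by_cases hz : i.1 = 0
  · have : (Iic i) = {i} := by
      ext j; simp only [mem_Iic, mem_singleton, Fin.le_def, Fin.ext_iff]; omega
    rw [this, Finset.sum_singleton, h0, Submodule.finrank_eq_zero] at hd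
    rw [hd, Submodule.mem_bot] at hx
    have := congrFun hx (Fin.last n); simp at this
  · let j : Fin L := ⟨i.1 - 1, by omega⟩
    have hji : j < i := by simp only [Fin.lt_def, j]; omega
    have hsum : ∑ k ∈ Iic i, α k = ∑ k ∈ Iic j, α k := by
      have : Iic i = insert i (Iic j) := by
        ext k; simp only [mem_Iic, mem_insert, Fin.le_def, Fin.ext_iff, j]; omega
      rw [this, Finset.sum_insert (by simp [hji]), h0, zero_add]
    have hj := Fl.2.2 j
    rw [hsum, ← hj] at hd
    have := Submodule.eq_of_le_of_finrank_eq (Fl.2.1 hji.le) hd.symm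
    rw [← this] at hx
    have := hi.2 j hji _ hx; simp at this

variable {n : ℕ} {g : GL (Fin n) K} {v : Fin n → K} {h : GL (Fin (n + 1)) K}

def Hl (g : GL (Fin n) K) (v : Fin n → K) (h : GL (Fin (n + 1)) K) : Prop :=
  (∀ w, Matrix.mulVecLin (h : Matrix (Fin (n + 1)) (Fin (n + 1)) K) (inc K n w) = inc K n (Matrix.mulVecLin (g : Matrix (Fin n) (Fin n) K) w)) ∧
  (∀ x, Matrix.mulVecLin (h : Matrix (Fin (n + 1)) (Fin (n + 1)) K) (ev x) = ev (Matrix.mulVecLin (g : Matrix (Fin n) (Fin n) K) x + v))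

theorem act_low (H : Hl g v h) (U : Submodule K (Fin n → K)) : act h (U.map (inc K n)) = (act g U).map (inc K n) := by
  rw [act, act, ← Submodule.map_comp, ← Submodule.map_comp]
  congr 1
  exact LinearMap.ext H.1

theorem act_up (H : Hl g v h) (U : Submodule K (Fin n → K)) (x) :
    act h (up U x) = up (act g U) (Matrix.mulVecLin (g : Matrix (Fin n) (Fin n) K) x + v) := by
  rw [up, up, ← act_low H, act, act, Submodule.map_sup, Submodule.map_span, Set.image_singleton]
  simp only [← H.2]

theorem fix_mk {L : ℕ} {α : Fin L →₀ ℕ} {i0 : Fin L} (hp : 0 < α i0) (H : Hl g v h) (x : Fin n → K) (G : FlagG K n (α - Finsupp.single i0 1)) :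
    h • mkFl hp x G = mkFl hp x G ↔ g • G = G ∧ Matrix.mulVecLin (g : Matrix (Fin n) (Fin n) K) x + v - x ∈ G.1 i0 := by
  constructor
  · intro e
    have key : ∀ i, act h ((mkFl hp x G).1 i) = (mkFl hp x G).1 i := fun i => congrFun (congrArg Subtype.val e) i
    constructor
    · refine FlagG.ext (funext fun i => ?_)
      have := key i
      rw [FlagG.smul_apply]
      rw [mkFl_apply] at this
      split_ifs at this with hi
      · rw [act_up H, up_eq_iff] at this; exact this.1
      · rw [act_low H] at this
        exact Submodule.map_injective_of_injective inc_inj this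
    · have := key i0
      rw [mkFl_apply, if_pos le_rfl, act_up H, up_eq_iff] at this
      exact this.2
  · rintro ⟨e, hx⟩
    have key : ∀ i, act g (G.1 i) = G.1 i := fun i => congrFun (congrArg Subtype.val e) i
    refine FlagG.ext (funext fun i => ?_)
    rw [FlagG.smul_apply, mkFl_apply]
    split_ifs with hi
    · rw [act_up H, up_eq_iff]; exact ⟨key i, G.2.1 hi hx⟩
    · rw [act_low H, key]

theorem card_coset {n : ℕ} (U : Submodule K (Fin n → K)) (p : (Fin n → K) → Prop) (x0 : Fin n → K) (hp : ∀ x, p x ↔ x - x0 ∈ U) :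
    (univ.filter p).card = Fintype.card K ^ Module.finrank K U := by
  rw [← Module.card_eq_pow_finrank (K := K) (V := U), ← Fintype.card_subtype]
  exact Fintype.card_congr ⟨fun x => ⟨x.1 - x0, (hp _).1 x.2⟩, fun u => ⟨u.1 + x0, by rw [hp]; simp⟩,
    fun x => by simp, fun u => by simp⟩

theorem level_count {L : ℕ} {α : Fin L →₀ ℕ} (i0 : Fin L) (hp : 0 < α i0) (h : (Fin n → K) → GL (Fin (n + 1)) K)
    (H : ∀ v, Hl g v (h v)) :
    ∑ v, (univ.filter fun Fl : FlagG K (n + 1) α => h v • Fl = Fl ∧ Lv Fl i0).card = Fintype.card K ^ n * piG (α - Finsupp.single i0 1) g := by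
  set α' := α - Finsupp.single i0 1 with hα'
  set d := ∑ j ∈ Iic i0, α' j with hd
  have hq : 0 < Fintype.card K ^ d := pow_pos Fintype.card_pos _
  apply Nat.eq_of_mul_eq_mul_right hq
  have s1 : ∀ v, (univ.filter fun Fl : FlagG K (n + 1) α => h v • Fl = Fl ∧ Lv Fl i0).card * Fintype.card K ^ d =
      ∑ x : Fin n → K, (univ.filter fun Fl : FlagG K (n + 1) α => (h v • Fl = Fl ∧ Lv Fl i0) ∧ ev x ∈ Fl.1 i0).card := by
    intro v
    simp only [Finset.card_eq_sum_ones (univ.filter fun Fl : FlagG K (n + 1) α => (_ ∧ _) ∧ _)]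
    simp only [← Finset.filter_filter (fun Fl : FlagG K (n + 1) α => h v • Fl = Fl ∧ Lv Fl i0)]
    simp only [Finset.sum_filter (fun Fl : FlagG K (n + 1) α => ev _ ∈ _)]
    rw [Finset.sum_comm, ← smul_eq_mul, ← Finset.sum_const]
    refine Finset.sum_congr rfl fun Fl hFl => ?_
    obtain ⟨-, -, hL⟩ := mem_filter.1 hFl
    obtain ⟨x0, hx0⟩ := hL.1
    rw [← Finset.sum_filter, ← Finset.card_eq_sum_ones, card_coset ((Fl.1 i0).comap (inc K n)) _ x0]
    · exact congrArg (Fintype.card K ^ ·) ((resFl hp Fl hL).2.2 i0).symm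
    · intro x
      rw [ev_sub x0 x, Submodule.add_mem_iff_left _ hx0]; rfl
  have s2 : ∀ v x, (univ.filter fun Fl : FlagG K (n + 1) α => (h v • Fl = Fl ∧ Lv Fl i0) ∧ ev x ∈ Fl.1 i0).card =
      (univ.filter fun G : FlagG K n α' => g • G = G ∧ Matrix.mulVecLin (g : Matrix (Fin n) (Fin n) K) x + v - x ∈ G.1 i0).card := by
    intro v x
    symm
    refine Finset.card_bij (fun G _ => mkFl hp x G) ?_ ?_ ?_
    · intro G hG
      rw [mem_filter] at hG ⊢
      refine ⟨mem_univ _, ⟨(fix_mk hp (H v) x G).2 hG.2, ⟨x, ?_⟩, ?_⟩, ?_⟩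
      · rw [mkFl_apply, if_pos le_rfl]; exact ev_mem_up _ _
      · intro i hi; rw [mkFl_apply, if_neg (not_le.2 hi)]; exact low_map _
      · rw [mkFl_apply, if_pos le_rfl]; exact ev_mem_up _ _
    · intro G _ G' _ e
      refine FlagG.ext (funext fun i => ?_)
      have := congrArg (Submodule.comap (inc K n)) (congrFun (congrArg Subtype.val e) i)
      rw [mkFl_apply, mkFl_apply] at this
      split_ifs at this
      · rwa [comap_up, comap_up] at this
      · rwa [comap_low, comap_low] at this
    · intro Fl hFl
      obtain ⟨-, ⟨h1, h2⟩, h3⟩ := mem_filter.1 hFl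
      have e : mkFl hp x (resFl hp Fl h2) = Fl := by
        refine FlagG.ext (funext fun i => ?_)
        rw [mkFl_apply, resFl_apply]
        split_ifs with hi
        · exact (up_of_mem (Fl.2.1 hi h3)).symm
        · exact (low_of (h2.2 i (not_le.1 hi))).symm
      refine ⟨resFl hp Fl h2, mem_filter.2 ⟨mem_univ _, (fix_mk hp (H v) x _).1 ?_⟩, e⟩
      rw [e, h1]
  rw [Finset.sum_mul, Finset.sum_congr rfl fun v _ => (s1 v).trans (Finset.sum_congr rfl fun x _ => s2 v x), Finset.sum_comm]
  have s3 : ∀ x, ∑ v, (univ.filter fun G : FlagG K n α' => g • G = G ∧ Matrix.mulVecLin (g : Matrix (Fin n) (Fin n) K) x + v - x ∈ G.1 i0).card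
      = piG α' g * Fintype.card K ^ d := by
    intro x
    simp only [Finset.card_eq_sum_ones (univ.filter fun G : FlagG K n α' => _ ∧ _)]
    simp only [← Finset.filter_filter (fun G : FlagG K n α' => g • G = G)]
    simp only [Finset.sum_filter (fun G : FlagG K n α' => _ ∈ _)]
    rw [Finset.sum_comm, piG, ← smul_eq_mul (α := ℕ), ← Finset.sum_const]
    refine Finset.sum_congr rfl fun G hG => ?_
    rw [← Finset.sum_filter, ← Finset.card_eq_sum_ones, card_coset (G.1 i0) _ (x - Matrix.mulVecLin (g : Matrix (Fin n) (Fin n) K) x), G.2.2 i0]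
    intro v
    rw [show Matrix.mulVecLin (g : Matrix (Fin n) (Fin n) K) x + v - x = v - (x - Matrix.mulVecLin (g : Matrix (Fin n) (Fin n) K) x) by abel]
  rw [Finset.sum_congr rfl fun x _ => s3 x, Finset.sum_const]
  simp [Finset.card_univ, mul_assoc]

theorem ext_count {L : ℕ} {α : Fin L →₀ ℕ} (hα : ∑ i, α i = n + 1) (h : (Fin n → K) → GL (Fin (n + 1)) K)
    (H : ∀ v, Hl g v (h v)) :
    ∑ v, piG α (h v) = Fintype.card K ^ n * ∑ i, if 0 < α i then piG (α - Finsupp.single i 1) g else 0 := by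
  have s1 : ∀ v, piG α (h v) = ∑ i, (univ.filter fun Fl : FlagG K (n + 1) α => h v • Fl = Fl ∧ Lv Fl i).card := by
    intro v
    simp only [Finset.card_eq_sum_ones (univ.filter fun Fl : FlagG K (n + 1) α => _ ∧ _)]
    simp only [← Finset.filter_filter (fun Fl : FlagG K (n + 1) α => h v • Fl = Fl)]
    simp only [Finset.sum_filter (fun Fl : FlagG K (n + 1) α => Lv _ _)]
    rw [Finset.sum_comm, piG, Finset.card_eq_sum_ones]
    refine Finset.sum_congr rfl fun Fl hFl => ?_
    obtain ⟨i, hi⟩ := Lv_ex hα Fl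
    rw [Finset.sum_eq_single i, if_pos hi]
    · intro j _ hj
      rw [if_neg]; intro hj'; exact hj (Lv_unique hj' hi)
    · simp
  rw [Finset.sum_congr rfl fun v _ => s1 v, Finset.sum_comm, Finset.mul_sum]
  refine Finset.sum_congr rfl fun i _ => ?_
  split_ifs with hp
  · exact level_count i hp h H
  · rw [mul_zero]
    refine Finset.sum_eq_zero fun v _ => ?_
    rw [Finset.card_eq_zero, Finset.filter_eq_empty_iff]
    rintro Fl _ ⟨_, h2⟩
    exact hp (Lv_pos h2)
end extcount
end UT

/- part P14 -/
set_option linter.unusedSectionVars false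
set_option linter.unusedSimpArgs false
namespace UT
section sside
open scoped Classical
open Finset

noncomputable def PS {L : ℕ} (α : Fin L →₀ ℕ) (m : Multiset ℕ) : ℝ :=
  MvPolynomial.coeff α (m.map (MvPolynomial.psum (Fin L) ℝ)).prod

theorem PS_cons {L : ℕ} (α : Fin L →₀ ℕ) (m : Multiset ℕ) :
    PS α (1 ::ₘ m) = ∑ i, if 0 < α i then PS (α - Finsupp.single i 1) m else 0 := by
  unfold PS
  rw [Multiset.map_cons, Multiset.prod_cons, MvPolynomial.psum]
  simp only [pow_one]
  rw [Finset.sum_mul, MvPolynomial.coeff_sum]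
  refine Finset.sum_congr rfl fun i _ => ?_
  rw [MvPolynomial.coeff_X_mul']
  simp only [Finsupp.mem_support_iff, Nat.pos_iff_ne_zero]

theorem PS_sum {L n : ℕ} (σ : Equiv.Perm (Fin n)) : ((ct σ).map (MvPolynomial.psum (Fin L) ℝ)).prod =
    ∑ c : CQ σ → Fin L, MvPolynomial.monomial (∑ k, Finsupp.single (c (cmk σ k)) 1) (1 : ℝ) := by
  rw [← cycProd_one_eq, cycProd]
  simp only [MvPolynomial.psum]
  rw [Finset.prod_univ_sum]
  simp only [Fintype.piFinset_univ]
  refine Finset.sum_congr rfl fun c _ => ?_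
  rw [MvPolynomial.monomial_sum_one]
  rw [← Finset.prod_fiberwise univ (cmk σ)]
  refine Finset.prod_congr rfl fun o _ => ?_
  rw [Finset.prod_congr rfl (g := fun _ => (MvPolynomial.X (c o) : MvPolynomial (Fin L) ℝ))]
  · rw [Finset.prod_const]; simp
  · intro k hk
    rw [(mem_filter.1 hk).2]; rfl

theorem piS_eq {L n : ℕ} (α : Fin L →₀ ℕ) (σ : Equiv.Perm (Fin n)) : (piS α σ : ℝ) = PS α (ct σ) := by
  unfold PS
  rw [PS_sum, MvPolynomial.coeff_sum]
  simp only [MvPolynomial.coeff_monomial]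
  rw [← Finset.sum_filter, Finset.sum_const, nsmul_eq_mul, mul_one, Nat.cast_inj, piS]
  have hcnt : ∀ (c : Fin n → Fin L), (∑ k, Finsupp.single (c k) 1) = α ↔ ∀ i, (univ.filter fun k => c k = i).card = α i := by
    intro c
    rw [Finsupp.ext_iff]
    refine forall_congr' fun i => ?_
    rw [Finsupp.finsetSum_apply, Finset.card_filter]
    simp only [Finsupp.single_apply]
  symm
  refine Finset.card_bij (fun (c : CQ σ → Fin L) hc => Col.mk' (fun k => c (cmk σ k)) ((hcnt _).1 (mem_filter.1 hc).2)) ?_ ?_ ?_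
  · intro c hc
    refine mem_filter.2 ⟨mem_univ _, Col.ext (funext fun k => ?_)⟩
    rw [Col.smul_apply]
    change c (cmk σ (σ⁻¹ k)) = c (cmk σ k)
    congr 1
    rw [cmk_eq]
    simp
  · intro c hc d hd e
    funext o
    obtain ⟨k, rfl⟩ := cmk_surj σ o
    exact congrFun (congrArg Subtype.val e) k
  · intro x hx
    have hx := (mem_filter.1 hx).2
    have h1 : ∀ k, x.1 (σ k) = x.1 k := by
      intro k
      have := congrFun (congrArg Subtype.val hx) (σ k)
      rw [Col.smul_apply] at this
      simpa using this.symm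
    have h2 : ∀ a b, Equiv.Perm.SameCycle σ a b → x.1 a = x.1 b := by
      intro a b hab
      obtain ⟨i, hi⟩ := hab.exists_nat_pow_eq
      rw [← hi]
      clear hi hab
      induction i with
      | zero => simp
      | succ i ih => rw [pow_succ', Equiv.Perm.mul_apply, h1]; exact ih
    let c : CQ σ → Fin L := Quotient.lift (s := Equiv.Perm.SameCycle.setoid σ) x.1 h2
    have hc : ∀ k, c (cmk σ k) = x.1 k := fun k => rfl
    refine ⟨c, mem_filter.2 ⟨mem_univ _, (hcnt _).2 ?_⟩, Col.ext rfl⟩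
    exact x.2

noncomputable def PiSm (n : ℕ) (b : J n →₀ ℝ) (m : Multiset ℕ) : ℝ := b.sum fun j r => r * PS j.2.1 m

theorem PiS_eq {n : ℕ} (b : J n →₀ ℝ) (σ : Equiv.Perm (Fin n)) : PiS n b σ = PiSm n b (ct σ) := by
  rw [PiS_apply, PiSm]
  simp only [piS_eq]

theorem PiSm_add {n : ℕ} (b c : J n →₀ ℝ) (m) : PiSm n (b + c) m = PiSm n b m + PiSm n c m := by
  unfold PiSm
  rw [Finsupp.sum_add_index'] <;> intros <;> ring

theorem PiSm_single {n : ℕ} (j : J n) (r : ℝ) (m) : PiSm n (Finsupp.single j r) m = r * PS j.2.1 m := by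
  unfold PiSm
  rw [Finsupp.sum_single_index]; ring

theorem PiSm_zero {n : ℕ} (m) : PiSm n 0 m = 0 := by simp [PiSm]

theorem PiSm_sum {n : ℕ} {ι : Type} (s : Finset ι) (b : ι → J n →₀ ℝ) (m) : PiSm n (∑ i ∈ s, b i) m = ∑ i ∈ s, PiSm n (b i) m := by
  induction s using Finset.induction_on with
  | empty => simp [PiSm_zero]
  | insert a s ha ih => rw [Finset.sum_insert ha, Finset.sum_insert ha, PiSm_add, ih]

theorem sub_sum {L n : ℕ} {α : Fin L →₀ ℕ} (hα : ∑ i, α i = n + 1) {i : Fin L} (hi : 0 < α i) :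
    ∑ j, (α - Finsupp.single i 1 : Fin L →₀ ℕ) j = n := by
  have h : ∑ j, α j = ∑ j, (α - Finsupp.single i 1 : Fin L →₀ ℕ) j + ∑ j, (if i = j then 1 else 0) := by
    rw [← Finset.sum_add_distrib]
    refine Finset.sum_congr rfl fun j _ => ?_
    rw [Finsupp.tsub_apply, Finsupp.single_apply]
    split_ifs with h
    · subst h; omega
    · omega
  rw [hα] at h
  simp at h
  simpa using h.symm

noncomputable def Dj {n : ℕ} (j : J (n + 1)) : J n →₀ ℝ :=
  ∑ i : Fin j.1, if h : 0 < j.2.1 i then Finsupp.single (Jm (j.2.1 - Finsupp.single i 1) (sub_sum j.2.2 h)) 1 else 0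

noncomputable def Db {n : ℕ} (b : J (n + 1) →₀ ℝ) : J n →₀ ℝ := ∑ j ∈ b.support, b j • Dj j

theorem PiSm_smul {n : ℕ} (r : ℝ) (b : J n →₀ ℝ) (m) : PiSm n (r • b) m = r * PiSm n b m := by
  unfold PiSm
  rw [Finsupp.sum_smul_index' (by intro; simp), Finsupp.mul_sum]
  simp [mul_assoc]

theorem PiSm_Db {n : ℕ} (b : J (n + 1) →₀ ℝ) (m) : PiSm n (Db b) m = PiSm (n + 1) b (1 ::ₘ m) := by
  rw [Db, PiSm_sum]
  conv_rhs => rw [PiSm, Finsupp.sum]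
  refine Finset.sum_congr rfl fun j _ => ?_
  rw [PiSm_smul, PS_cons, Dj, PiSm_sum]
  congr 1
  refine Finset.sum_congr rfl fun i _ => ?_
  split_ifs with h
  · rw [PiSm_single]; simp [Jm]
  · exact PiSm_zero _

variable {K : Type} [Field K] [Fintype K]

theorem PiG_Db {n : ℕ} (b : J (n + 1) →₀ ℝ) (g : GL (Fin n) K) (h : (Fin n → K) → GL (Fin (n + 1)) K)
    (H : ∀ v, Hl g v (h v)) : ∑ v, PiG K (n + 1) b (h v) = (Fintype.card K : ℝ) ^ n * PiG K n (Db b) g := by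
  simp only [PiG_apply (n := n + 1), Finsupp.sum]
  rw [Finset.sum_comm, Db, map_sum, Finset.sum_apply, Finset.mul_sum]
  refine Finset.sum_congr rfl fun j _ => ?_
  rw [← Finset.mul_sum, map_smul, Pi.smul_apply, smul_eq_mul]
  have h1 := ext_count j.2.2 h H
  have h2 : PiG K n (Dj j) g = ∑ i, if 0 < j.2.1 i then (piG (j.2.1 - Finsupp.single i 1) g : ℝ) else 0 := by
    rw [Dj, map_sum, Finset.sum_apply]
    refine Finset.sum_congr rfl fun i _ => ?_
    split_ifs with h
    · rw [PiG_single]; simp [Jm]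
    · simp
  rw [h2, ← Nat.cast_sum, h1]
  push_cast
  ring

/-- The central coherence statement. -/
theorem coherent (b : ∀ n, J n →₀ ℝ) (h0 : PiG K 0 (b 0) 1 = 1)
    (hc : ∀ n (g : GL (Fin n) K), ∃ h : (Fin n → K) → GL (Fin (n + 1)) K, (∀ v, Hl g v (h v)) ∧
      ∑ v, PiG K (n + 1) (b (n + 1)) (h v) = (Fintype.card K : ℝ) ^ n * PiG K n (b n) g)
    (hpd : ∀ n (x : Equiv.Perm (Fin n) → ℝ), 0 ≤ ∑ σ, ∑ τ, x σ * x τ * PiS n (b n) (σ⁻¹ * τ)) :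
    ∃ f ∈ KK, ∀ n (σ : Equiv.Perm (Fin n)), PiS n (b n) σ = f (ct σ) := by
  let f : Multiset ℕ → ℝ := fun m => if 0 ∈ m then 0 else PiSm m.sum (b m.sum) m
  have hf : ∀ n (σ : Equiv.Perm (Fin n)), PiS n (b n) σ = f (ct σ) := by
    intro n σ
    simp only [f, if_neg (ct_pos σ)]
    rw [PiS_eq]
    have : (ct σ).sum = n := by rw [ct_sum]; simp
    rw [this]
  have hD : ∀ n, PiS n (Db (b (n + 1))) = PiS n (b n) := by
    intro n
    rw [← sub_eq_zero, ← map_sub, ← ker_iff (K := K), map_sub, sub_eq_zero]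
    funext g
    obtain ⟨h, H, e⟩ := hc n g
    rw [PiG_Db _ g h H] at e
    exact mul_left_cancel₀ (pow_ne_zero _ (by exact_mod_cast Fintype.card_ne_zero)) e
  refine ⟨f, ⟨?_, ⟨?_, ?_, ?_⟩⟩, hf⟩
  · have e0 : PiG K 0 (b 0) = PiG K 0 (Finsupp.single (Jm (0 : Fin 0 →₀ ℕ) (by simp)) 1) := by
      funext g
      rw [Subsingleton.elim g 1, h0, PiG_single, one_mul]
      have : piG (0 : Fin 0 →₀ ℕ) (1 : GL (Fin 0) K) = 1 := by
        rw [piG, Finset.filter_true_of_mem (fun x _ => one_smul _ x), Finset.card_univ, Fintype.card_eq_one_iff]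
        exact ⟨⟨fun i => i.elim0, fun i => i.elim0, fun i => i.elim0⟩, fun y => FlagG.ext (funext fun i => i.elim0)⟩
      simp [Jm, this]
    rw [← sub_eq_zero, ← map_sub, ker_iff, map_sub, sub_eq_zero] at e0
    have h1 := hf 0 1
    rw [ct_one] at h1
    simp only [Fintype.card_fin, Multiset.replicate_zero] at h1
    rw [← h1, e0, PiS_single, piS_eq, ct_one]
    simp [PS, Jm]
    change MvPolynomial.coeff 0 1 = 1
    simp
  · intro m
    by_cases hm : 0 ∈ m
    · simp [f, hm]
    · obtain ⟨n, σ, hσ⟩ := ct_realize m hm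
      have hs : m.sum = n := by rw [← hσ, ct_sum]; simp
      have h1 : f (1 ::ₘ m) = PiSm (n + 1) (b (n + 1)) (1 ::ₘ m) := by
        simp only [f]
        rw [if_neg (by simp [hm])]
        have : (1 ::ₘ m).sum = n + 1 := by rw [Multiset.sum_cons, hs, add_comm]
        rw [this]
      rw [h1, ← PiSm_Db, ← hσ, ← PiS_eq, hD, hf]
  · intro m hm; simp [f, hm]
  · intro n x
    have := hpd n x
    simpa only [hf] using this
end sside
end UT

/- part P15 -/
set_option linter.unusedSectionVars false
set_option linter.unusedSimpArgs false
namespace UT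
section zmat
open scoped Classical
open Finset
variable {S : Type} [Fintype S] [DecidableEq S]

theorem desc_neg_one (j : ℕ) : (descPochhammer ℝ j).eval (-1) = (-1) ^ j * (j.factorial : ℝ) := by
  induction j with
  | zero => simp
  | succ j ih => rw [descPochhammer_succ_eval, ih, Nat.factorial_succ]; push_cast; ring

theorem inv_geom {N : Matrix S S ℝ} {D : ℕ} (hN : N ^ D = 0) : (1 + N)⁻¹ = ∑ j ∈ range D, (-1 : ℝ) ^ j • N ^ j := by
  apply Matrix.inv_eq_left_inv
  have h := geom_sum_mul_neg (-N) D
  have h2 : ∀ j, (-N) ^ j = (-1 : ℝ) ^ j • N ^ j := by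
    intro j
    rw [← neg_one_smul ℝ N, smul_pow]
  simp only [h2, hN, smul_zero, sub_zero, sub_neg_eq_add] at h
  exact h

theorem pow_binom {N : Matrix S S ℝ} {D : ℕ} (hN : N ^ D = 0) (r : ℕ) : (1 + N) ^ r = ∑ j ∈ range D, (r.choose j : ℝ) • N ^ j := by
  rw [add_comm, (Commute.one_right N).add_pow]
  simp only [one_pow, mul_one]
  have e1 : ∑ j ∈ range (r + 1), N ^ j * (r.choose j : Matrix S S ℝ) = ∑ j ∈ range (r + 1), (r.choose j : ℝ) • N ^ j := by
    refine Finset.sum_congr rfl fun j _ => ?_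
    rw [← nsmul_eq_mul', Nat.cast_smul_eq_nsmul]
  rw [e1]
  have e2 : ∀ M, r + 1 ≤ M → ∑ j ∈ range (r + 1), (r.choose j : ℝ) • N ^ j = ∑ j ∈ range M, (r.choose j : ℝ) • N ^ j := by
    intro M hM
    refine Finset.sum_subset (Finset.range_mono hM) fun j _ hj => ?_
    rw [Nat.choose_eq_zero_of_lt (by simpa using hj)]; simp
  have e3 : ∀ M, D ≤ M → ∑ j ∈ range D, (r.choose j : ℝ) • N ^ j = ∑ j ∈ range M, (r.choose j : ℝ) • N ^ j := by
    intro M hM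
    refine Finset.sum_subset (Finset.range_mono hM) fun j _ hj => ?_
    rw [pow_eq_zero_of_le (by simpa using hj) hN, smul_zero]
  rw [e2 _ (le_max_left _ D), e3 _ (le_max_right (r + 1) D)]

theorem poly_pow {N : Matrix S S ℝ} {D : ℕ} (hN : N ^ D = 0) (A B : Matrix S S ℝ) (s t : S) :
    ∃ P : Polynomial ℝ, (∀ r : ℕ, P.eval (r : ℝ) = (A * (1 + N) ^ r * B) s t) ∧ P.eval (-1) = (A * (1 + N)⁻¹ * B) s t := by
  refine ⟨∑ j ∈ range D, Polynomial.C ((A * N ^ j * B) s t / (j.factorial : ℝ)) * descPochhammer ℝ j, fun r => ?_, ?_⟩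
  · rw [pow_binom hN, Polynomial.eval_finsetSum, Finset.mul_sum, Finset.sum_mul, Matrix.sum_apply]
    refine Finset.sum_congr rfl fun j _ => ?_
    rw [Polynomial.eval_mul, Polynomial.eval_C, descPochhammer_eval_eq_descFactorial, Nat.descFactorial_eq_factorial_mul_choose]
    have : (j.factorial : ℝ) ≠ 0 := by exact_mod_cast j.factorial_ne_zero
    simp only [Matrix.mul_smul, Matrix.smul_mul, Matrix.smul_apply, smul_eq_mul]
    push_cast
    field_simp
  · rw [inv_geom hN, Polynomial.eval_finsetSum, Finset.mul_sum, Finset.sum_mul, Matrix.sum_apply]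
    refine Finset.sum_congr rfl fun j _ => ?_
    rw [Polynomial.eval_mul, Polynomial.eval_C, desc_neg_one]
    have : (j.factorial : ℝ) ≠ 0 := by exact_mod_cast j.factorial_ne_zero
    simp only [Matrix.mul_smul, Matrix.smul_mul, Matrix.smul_apply, smul_eq_mul]
    field_simp

noncomputable def pw (A : List ℝ) (k : ℕ) : ℝ := (A.map (fun a => a ^ k)).sum

theorem super_val {Z : ℝ → Matrix S S ℝ} {D : ℕ} (hZ : ∀ y, (Z y - 1) ^ D = 0) (s t : S) (V : (ℕ → ℝ) → ℝ)
    (hV : ∀ p q : ℕ → ℝ, ∃ P : Polynomial ℝ, ∀ r : ℝ, P.eval r = V (fun k => p k + r * q k))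
    (hbase : ∀ A : List ℝ, V (pw A) = (A.map Z).prod s t) (B : List ℝ) :
    ∀ A : List ℝ, V (fun k => pw A k - pw B k) = ((A.map Z).prod * (B.map (fun y => (Z y)⁻¹)).prod) s t := by
  induction B with
  | nil =>
    intro A
    have e : (fun k => pw A k - pw [] k) = pw A := by funext k; simp [pw]
    rw [e]; simpa using hbase A
  | cons y B ih =>
    intro A
    obtain ⟨P, hP⟩ := hV (fun k => pw A k - pw B k) (fun k => y ^ k)
    obtain ⟨Q, hQ, hQ'⟩ := poly_pow (hZ y) (A.map Z).prod (B.map (fun y => (Z y)⁻¹)).prod s t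
    simp only [add_sub_cancel] at hQ hQ'
    have hPQ : P = Q := by
      refine Polynomial.eq_of_infinite_eval_eq P Q (Set.Infinite.mono (s := Set.range (fun r : ℕ => (r : ℝ))) ?_ (Set.infinite_range_of_injective Nat.cast_injective))
      rintro _ ⟨r, rfl⟩
      change P.eval (r : ℝ) = Q.eval (r : ℝ)
      rw [hP, hQ]
      have := ih (A ++ List.replicate r y)
      simp only [List.map_append, List.prod_append, List.map_replicate, List.prod_replicate] at this
      rw [← this]
      congr 1
      funext k
      simp [pw]; ring
    have h1 := hP (-1)
    rw [hPQ, hQ'] at h1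
    rw [List.map_cons, List.prod_cons, ← mul_assoc, h1]
    congr 1
    funext k
    simp [pw]; ring

variable [PartialOrder S]
noncomputable def Zm (d : S → ℕ) (x : ℝ) : Matrix S S ℝ := Matrix.of fun a b => if a ≤ b then x ^ (d b - d a) else 0

theorem Zm_nil {d : S → ℕ} (hd : StrictMono d) {D : ℕ} (hD : ∀ s, d s < D) (x : ℝ) : (Zm d x - 1) ^ D = 0 := by
  have key : ∀ j a b, ((Zm d x - 1) ^ j) a b ≠ 0 → d a + j ≤ d b := by
    intro j
    induction j with
    | zero =>
      intro a b h
      rw [pow_zero, Matrix.one_apply] at h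
      have : a = b := by by_contra h'; simp [h'] at h
      rw [this]; simp
    | succ j ih =>
      intro a b h
      rw [pow_succ, Matrix.mul_apply] at h
      obtain ⟨c, _, hc⟩ := Finset.exists_ne_zero_of_sum_ne_zero h
      have h1 := ih a c (left_ne_zero_of_mul hc)
      have h2 := right_ne_zero_of_mul hc
      rw [Matrix.sub_apply, Zm, Matrix.of_apply, Matrix.one_apply] at h2
      have : c < b := by
        by_cases hcb : c = b
        · subst hcb; simp at h2
        · refine lt_of_le_of_ne ?_ hcb
          by_contra h3; simp [h3, hcb] at h2
      have := hd this
      omega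
  ext a b
  by_contra h
  have := key D a b h
  have := hD b
  omega

theorem Zm_nonneg {d : S → ℕ} {x : ℝ} (hx : 0 ≤ x) (a b : S) : 0 ≤ Zm d x a b := by
  rw [Zm, Matrix.of_apply]; split_ifs <;> positivity
end zmat

section weisner
open scoped Classical
open Finset
variable {S : Type} [Fintype S] [DecidableEq S] [Lattice S]

/-- Möbius function, recursively -/
theorem exists_mob (a : S) : ∃ μ : S → ℝ, ∀ b, a ≤ b → ∑ x with a ≤ x ∧ x ≤ b, μ x = if a = b then 1 else 0 := by
  letI : LocallyFiniteOrder S := Fintype.toLocallyFiniteOrder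
  refine ⟨fun x => IncidenceAlgebra.mu ℝ a x, fun b hab => ?_⟩
  have := IncidenceAlgebra.sum_Icc_mu_right (𝕜 := ℝ) a b
  rw [← this]
  refine Finset.sum_congr ?_ fun _ _ => rfl
  ext x; simp

theorem weisner {a c : S} (hac : a < c) {μ : S → ℝ} (hμ : ∀ b, a ≤ b → ∑ x with a ≤ x ∧ x ≤ b, μ x = if a = b then 1 else 0) :
    ∀ b, c ≤ b → ∑ x with a ≤ x ∧ x ⊔ c = b, μ x = 0 := by
  intro b
  induction b using WellFoundedLT.induction with
  | ind b ih =>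
    intro hcb
    have h1 := hμ b (hac.le.trans hcb)
    rw [if_neg (hac.trans_le hcb).ne] at h1
    have h2 : ∑ y with c ≤ y ∧ y ≤ b, ∑ x with a ≤ x ∧ x ⊔ c = y, μ x = ∑ x with a ≤ x ∧ x ≤ b, μ x := by
      rw [← Finset.sum_fiberwise_of_maps_to (s := univ.filter fun x => a ≤ x ∧ x ≤ b) (t := univ.filter fun y => c ≤ y ∧ y ≤ b) (g := fun x => x ⊔ c)]
      · refine Finset.sum_congr rfl fun y hy => Finset.sum_congr ?_ fun _ _ => rfl
        ext x
        simp only [mem_filter, mem_univ, true_and] at hy ⊢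
        constructor
        · rintro ⟨h3, h4⟩; exact ⟨⟨h3, le_trans (h4 ▸ le_sup_left) hy.2⟩, h4⟩
        · rintro ⟨⟨h3, h5⟩, h4⟩; exact ⟨h3, h4⟩
      · intro x hx
        simp only [mem_filter, mem_univ, true_and] at hx ⊢
        exact ⟨le_sup_right, sup_le hx.2 hcb⟩
    rw [h1, Finset.sum_eq_single b] at h2
    · exact h2
    · intro y hy hyb
      simp only [mem_filter, mem_univ, true_and] at hy
      exact ih y (lt_of_le_of_ne hy.2 hyb) hy.1
    · intro h; simp [hcb] at h

theorem mob_sign {d : S → ℕ} (hd : StrictMono d) (hmod : ∀ a b, d (a ⊔ b) + d (a ⊓ b) = d a + d b)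
    (hcov : ∀ a b : S, a < b → ∃ c, a < c ∧ c ≤ b ∧ d c = d a + 1) (a : S)
    {μ : S → ℝ} (hμ : ∀ b, a ≤ b → ∑ x with a ≤ x ∧ x ≤ b, μ x = if a = b then 1 else 0) :
    ∀ b, a ≤ b → 0 ≤ (-1 : ℝ) ^ (d b - d a) * μ b := by
  intro b
  induction b using WellFoundedLT.induction with
  | ind b ih =>
    intro hab
    rcases hab.eq_or_lt with rfl | hlt
    · have := hμ a le_rfl
      rw [if_pos rfl] at this
      have e : (univ.filter fun x => a ≤ x ∧ x ≤ a) = {a} := by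
        ext x; simp [le_antisymm_iff, and_comm]
      rw [e, Finset.sum_singleton] at this
      simp [this]
    · obtain ⟨c, hac, hcb, hdc⟩ := hcov a b hlt
      have hw := weisner hac hμ b hcb
      have hbm : b ∈ univ.filter fun x => a ≤ x ∧ x ⊔ c = b := by simp [hab, hcb]
      rw [← Finset.add_sum_erase _ _ hbm] at hw
      have : μ b = - ∑ x ∈ (univ.filter fun x => a ≤ x ∧ x ⊔ c = b).erase b, μ x := by linarith
      rw [this, mul_neg, ← neg_mul, Finset.mul_sum]
      refine Finset.sum_nonneg fun x hx => ?_
      simp only [mem_erase, mem_filter, mem_univ, true_and] at hx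
      obtain ⟨hxb, hax, hxc⟩ := hx
      have hxlt : x < b := lt_of_le_of_ne (hxc ▸ le_sup_left) hxb
      have h1 := hmod x c
      rw [hxc, hdc] at h1
      have h2 : d a ≤ d (x ⊓ c) := hd.monotone (le_inf hax hac.le)
      have h3 := hd hxlt
      have h4 : d a ≤ d x := hd.monotone hax
      have h5 : d b - d a = (d x - d a) + 1 := by omega
      have := ih x hxlt hax
      rw [h5, pow_succ]
      linarith

theorem Zinv_nonneg {d : S → ℕ} (hd : StrictMono d) (hmod : ∀ a b, d (a ⊔ b) + d (a ⊓ b) = d a + d b)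
    (hcov : ∀ a b : S, a < b → ∃ c, a < c ∧ c ≤ b ∧ d c = d a + 1) {x : ℝ} (hx : 0 ≤ x) (a b : S) : 0 ≤ (Zm d (-x))⁻¹ a b := by
  choose μ hμ using fun a : S => exists_mob a
  let R : Matrix S S ℝ := Matrix.of fun a b => if a ≤ b then (-1) ^ (d b - d a) * μ a b * x ^ (d b - d a) else 0
  have hR : R * Zm d (-x) = 1 := by
    ext a b
    rw [Matrix.mul_apply, Matrix.one_apply]
    have e : ∀ c, R a c * Zm d (-x) c b = if a ≤ c ∧ c ≤ b then (-x) ^ (d b - d a) * μ a c else 0 := by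
      intro c
      simp only [R, Zm, Matrix.of_apply]
      by_cases h1 : a ≤ c
      · by_cases h2 : c ≤ b
        · rw [if_pos h1, if_pos h2, if_pos ⟨h1, h2⟩]
          have : d b - d a = (d c - d a) + (d b - d c) := by
            have := hd.monotone h1; have := hd.monotone h2; omega
          rw [this, pow_add, neg_pow x (d c - d a)]; ring
        · rw [if_neg h2, if_neg (show ¬(a ≤ c ∧ c ≤ b) from fun h => h2 h.2), mul_zero]
      · rw [if_neg h1, if_neg (show ¬(a ≤ c ∧ c ≤ b) from fun h => h1 h.1), zero_mul]
    rw [Finset.sum_congr rfl fun c _ => e c, ← Finset.sum_filter, ← Finset.mul_sum]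
    by_cases hab : a ≤ b
    · rw [hμ a b hab]
      by_cases h : a = b
      · subst h; simp
      · simp [h]
    · rw [Finset.filter_false_of_mem (fun c _ h => hab (h.1.trans h.2)), if_neg (fun h => hab h.le)]
      simp
  rw [Matrix.inv_eq_left_inv hR]
  simp only [R, Matrix.of_apply]
  split_ifs with h
  · exact mul_nonneg (mob_sign hd hmod hcov a (hμ a) b h) (by positivity)
  · exact le_rfl

theorem list_prod_nonneg {l : List (Matrix S S ℝ)} (h : ∀ M ∈ l, ∀ a b, 0 ≤ M a b) : ∀ a b, 0 ≤ l.prod a b := by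
  induction l with
  | nil => intro a b; rw [List.prod_nil, Matrix.one_apply]; split_ifs <;> norm_num
  | cons M l ih =>
    intro a b
    rw [List.prod_cons, Matrix.mul_apply]
    exact Finset.sum_nonneg fun c _ => mul_nonneg (h M (by simp) _ _) (ih (fun M hM => h M (by simp [hM])) _ _)
end weisner
end UT

/- part P16 -/
set_option linter.unusedSectionVars false
set_option linter.unusedSimpArgs false
namespace UT
section paths
open scoped Classical
open Finset
variable {S : Type} [Fintype S] [DecidableEq S]

theorem path_prod (M : ∀ _ : ℝ, Matrix S S ℝ) (t : S) : ∀ (L : ℕ) (x : Fin L → ℝ) (a : S),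
    (List.ofFn fun i => M (x i)).prod a t =
      ∑ Fl : Fin L → S, (∏ i : Fin L, M (x i) ((Fin.cons a Fl : Fin (L + 1) → S) i.castSucc) ((Fin.cons a Fl : Fin (L + 1) → S) i.succ)) *
        (if (Fin.cons a Fl : Fin (L + 1) → S) (Fin.last L) = t then 1 else 0) := by
  intro L
  induction L with
  | zero =>
    intro x a
    simp [Matrix.one_apply]
  | succ L ih =>
    intro x a
    rw [List.ofFn_succ, List.prod_cons, Matrix.mul_apply]
    rw [← (Fin.consEquiv (fun _ : Fin (L + 1) => S)).sum_comp, Fintype.sum_prod_type]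
    refine Finset.sum_congr rfl fun c _ => ?_
    rw [ih, Finset.mul_sum]
    refine Finset.sum_congr rfl fun Fl _ => ?_
    rw [Fin.prod_univ_succ, mul_assoc]
    simp only [Fin.consEquiv_apply, Fin.castSucc_zero, Fin.cons_zero, Fin.cons_succ, ← Fin.succ_castSucc, ← Fin.succ_last]

theorem partial_sum_eq {L : ℕ} {e : Fin (L + 1) → ℕ} (he : Monotone e) (h0 : e 0 = 0) (i : Fin L) :
    ∑ j ∈ Iic i, (e j.succ - e j.castSucc) = e i.succ := by
  rcases L with _ | L
  · exact i.elim0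
  · induction i using Fin.induction with
    | zero =>
      have : Iic (0 : Fin (L + 1)) = {0} := by ext j; simp
      rw [this, Finset.sum_singleton, Fin.castSucc_zero, h0]; simp
    | succ i ih =>
      have : Iic i.succ = insert i.succ (Iic i.castSucc) := by
        ext j; simp only [mem_Iic, mem_insert, Fin.le_def, Fin.ext_iff, Fin.val_succ, Fin.val_castSucc]; omega
      rw [this, Finset.sum_insert (by simp [Fin.le_def]), ih]
      have := he (show i.succ.castSucc ≤ i.succ.succ by simp [Fin.le_def])
      rw [← Fin.succ_castSucc] at *
      omega

theorem total_sum {L : ℕ} {e : Fin (L + 1) → ℕ} (he : Monotone e) (h0 : e 0 = 0) :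
    ∑ j : Fin L, (e j.succ - e j.castSucc) = e (Fin.last L) := by
  rcases L with _ | L
  · simpa using h0.symm
  · have := partial_sum_eq he h0 (Fin.last L)
    rw [Fin.succ_last] at this
    rw [← this]
    refine Finset.sum_congr ?_ fun _ _ => rfl
    ext j; simp [Fin.le_last]

end paths

section stab
open scoped Classical
open Finset
variable {K : Type} [Field K] [Fintype K]

def Stab {n : ℕ} (u : GL (Fin n) K) : Sublattice (Submodule K (Fin n → K)) where
  carrier := {W | act u W = W}
  supClosed' := by
    intro a ha b hb
    change act u a = a at ha
    change act u b = b at hb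
    change act u (a ⊔ b) = a ⊔ b
    rw [act, Submodule.map_sup]
    exact congrArg₂ (· ⊔ ·) ha hb
  infClosed' := by
    intro a ha b hb
    change act u a = a at ha
    change act u b = b at hb
    change act u (a ⊓ b) = a ⊓ b
    rw [act_inf, ha, hb]

theorem Stab.mem {n : ℕ} {u : GL (Fin n) K} {W : Submodule K (Fin n → K)} : W ∈ Stab u ↔ act u W = W := Iff.rfl

noncomputable instance {n : ℕ} (u : GL (Fin n) K) : Fintype (Stab u) :=
  haveI : Finite (Submodule K (Fin n → K)) := inferInstance
  Fintype.ofFinite _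

noncomputable def sd {n : ℕ} {u : GL (Fin n) K} (W : Stab u) : ℕ := Module.finrank K W.1

theorem sd_mono {n : ℕ} {u : GL (Fin n) K} : StrictMono (sd : Stab u → ℕ) := by
  intro a b h
  exact Submodule.finrank_lt_finrank_of_lt h

theorem sd_mod {n : ℕ} {u : GL (Fin n) K} (a b : Stab u) : sd (a ⊔ b) + sd (a ⊓ b) = sd a + sd b :=
  Submodule.finrank_sup_add_finrank_inf_eq a.1 b.1

theorem sd_lt {n : ℕ} {u : GL (Fin n) K} (a : Stab u) : sd a < n + 1 := by
  have := Submodule.finrank_le a.1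
  simp at this
  exact Nat.lt_succ_of_le this

theorem stab_of_le {n : ℕ} {u : GL (Fin n) K} {W : Submodule K (Fin n → K)} (h : act u W ≤ W) : act u W = W :=
  Submodule.eq_of_le_of_finrank_eq h (act_finrank u W)

theorem sd_cov {n : ℕ} {u : GL (Fin n) K} (hu : ∃ N, (Matrix.mulVecLin (u : Matrix (Fin n) (Fin n) K) - 1 : Module.End K (Fin n → K)) ^ N = 0)
    (a b : Stab u) (hab : a < b) : ∃ c, a < c ∧ c ≤ b ∧ sd c = sd a + 1 := by
  obtain ⟨N, hN⟩ := hu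
  obtain ⟨T, hT⟩ : ∃ T : Module.End K (Fin n → K), T = Matrix.mulVecLin (u : Matrix (Fin n) (Fin n) K) := ⟨_, rfl⟩
  obtain ⟨D, hD⟩ : ∃ D : Module.End K (Fin n → K), D = T - 1 := ⟨_, rfl⟩
  rw [← hT, ← hD] at hN
  obtain ⟨v, hvb, hva⟩ := SetLike.exists_of_lt (show a.1 < b.1 from hab)
  have hsb : ∀ w ∈ b.1, T w ∈ b.1 := by
    intro w hw
    have := b.2
    rw [Stab.mem] at this
    rw [← this, hT]
    exact Submodule.mem_map_of_mem hw
  have hsb' : ∀ j, (D ^ j) v ∈ b.1 := by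
    intro j
    induction j with
    | zero => simpa using hvb
    | succ j ih =>
      rw [pow_succ', Module.End.mul_apply]
      rw [hD] at ih ⊢
      exact b.1.sub_mem (hsb _ ih) ih
  have hex : ∃ j, (D ^ j) v ∈ a.1 := ⟨N, by rw [hN]; simp⟩
  obtain ⟨j, hj, hj'⟩ : ∃ j, (D ^ j) v ∉ a.1 ∧ (D ^ (j + 1)) v ∈ a.1 := by
    by_contra hcon
    push Not at hcon
    have : ∀ j, (D ^ j) v ∉ a.1 := by
      intro j
      induction j with
      | zero => simpa using hva
      | succ j ih => exact hcon j ih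
    obtain ⟨j, hj⟩ := hex
    exact this j hj
  set x := (D ^ j) v with hx
  have hTx : T x - x ∈ a.1 := by
    rw [pow_succ', Module.End.mul_apply, ← hx, hD] at hj'
    exact hj'
  let c : Submodule K (Fin n → K) := a.1 ⊔ Submodule.span K {x}
  have hc : act u c = c := by
    refine stab_of_le ?_
    rw [act, Submodule.map_sup]
    refine sup_le ?_ ?_
    · have := a.2
      rw [Stab.mem, act] at this
      rw [this]; exact le_sup_left
    · rw [Submodule.map_span, Submodule.span_le]
      rintro _ ⟨_, rfl, rfl⟩
      have : T x = (T x - x) + x := by abel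
      rw [← hT]
      change T x ∈ c
      rw [this]
      exact c.add_mem ((le_sup_left : a.1 ≤ c) hTx) ((le_sup_right : _ ≤ c) (Submodule.mem_span_singleton_self x))
  refine ⟨⟨c, hc⟩, ?_, ?_, ?_⟩
  · change a.1 < c
    refine lt_of_le_of_ne le_sup_left fun h => hj ?_
    rw [h]; exact (le_sup_right : _ ≤ c) (Submodule.mem_span_singleton_self x)
  · change c ≤ b.1
    refine sup_le hab.le ?_
    rw [Submodule.span_le]
    rintro _ rfl
    exact hsb' j
  · change Module.finrank K c = Module.finrank K a.1 + 1
    have h1 := Submodule.finrank_sup_add_finrank_inf_eq a.1 (Submodule.span K {x})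
    have h2 : a.1 ⊓ Submodule.span K {x} = ⊥ := by
      rw [Submodule.eq_bot_iff]
      rintro y ⟨hy1, hy2⟩
      obtain ⟨r, rfl⟩ := Submodule.mem_span_singleton.1 hy2
      by_cases hr : r = 0
      · simp [hr]
      · exact absurd ((Submodule.smul_mem_iff _ hr).1 hy1) hj
    have h3 : x ≠ 0 := fun h => hj (h ▸ a.1.zero_mem)
    rw [h2, finrank_bot, finrank_span_singleton h3] at h1
    exact h1

def sbot {n : ℕ} (u : GL (Fin n) K) : Stab u := ⟨⊥, by rw [Stab.mem, act, Submodule.map_bot]⟩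
def stabTop {n : ℕ} (u : GL (Fin n) K) : Stab u := ⟨⊤, by
  rw [Stab.mem]; exact Submodule.eq_top_of_finrank_eq (by rw [act_finrank]; simp)⟩

theorem flag_sum {n : ℕ} (u : GL (Fin n) K) {L : ℕ} (x : Fin L → ℝ) :
    (List.ofFn fun i => Zm (sd : Stab u → ℕ) (x i)).prod (sbot u) (stabTop u) =
      ∑ α ∈ Finset.finsuppAntidiag (univ : Finset (Fin L)) n, (∏ i, x i ^ α i) * (piG α u : ℝ) := by
  refine (path_prod (fun y => Zm (sd : Stab u → ℕ) y) (stabTop u) L x (sbot u)).trans ?_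
  let p (Fl : Fin L → Stab u) : Fin (L + 1) → Stab u := Fin.cons (sbot u) Fl
  let δ (Fl : Fin L → Stab u) : Fin L →₀ ℕ := Finsupp.equivFunOnFinite.symm fun i => sd (p Fl i.succ) - sd (p Fl i.castSucc)
  let G : Finset (Fin L → Stab u) := univ.filter fun Fl => Monotone (p Fl) ∧ p Fl (Fin.last L) = stabTop u
  have hsb : sd (sbot u) = 0 := finrank_bot K _
  have hst : sd (stabTop u) = n := by change Module.finrank K (⊤ : Submodule K (Fin n → K)) = n; simp
  have h1 : ∀ Fl : Fin L → Stab u, (∏ i : Fin L, Zm (sd : Stab u → ℕ) (x i) (p Fl i.castSucc) (p Fl i.succ)) *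
        (if p Fl (Fin.last L) = stabTop u then 1 else 0) = if Monotone (p Fl) ∧ p Fl (Fin.last L) = stabTop u then ∏ i, x i ^ (δ Fl i) else 0 := by
    intro Fl
    by_cases hl : p Fl (Fin.last L) = stabTop u
    · rw [if_pos hl, mul_one]
      by_cases hm : Monotone (p Fl)
      · rw [if_pos ⟨hm, hl⟩]
        refine Finset.prod_congr rfl fun i _ => ?_
        rw [Zm, Matrix.of_apply, if_pos (hm (Fin.castSucc_le_succ i))]
        rfl
      · rw [if_neg (fun h => hm h.1)]
        rw [Fin.monotone_iff_le_succ] at hm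
        push Not at hm
        obtain ⟨i, hi⟩ := hm
        exact Finset.prod_eq_zero (mem_univ i) (by rw [Zm, Matrix.of_apply, if_neg hi])
    · rw [if_neg hl, mul_zero, if_neg (fun h => hl h.2)]
  refine (Finset.sum_congr rfl fun Fl _ => h1 Fl).trans ?_
  rw [← Finset.sum_filter]
  have he : ∀ Fl, Monotone (p Fl) → Monotone (fun i => sd (p Fl i)) := fun Fl h => sd_mono.monotone.comp h
  have he0 : ∀ Fl, sd (p Fl 0) = 0 := fun Fl => hsb
  rw [← Finset.sum_fiberwise_of_maps_to (t := Finset.finsuppAntidiag (univ : Finset (Fin L)) n) (g := δ)]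
  · refine Finset.sum_congr rfl fun α hα => ?_
    rw [Finset.sum_congr rfl (g := fun _ => ∏ i, x i ^ α i) (fun Fl h => by rw [(mem_filter.1 h).2])]
    rw [Finset.sum_const, nsmul_eq_mul, mul_comm, piG]
    congr 2
    have hαn : ∑ i, α i = n := by simpa using (Finset.mem_finsuppAntidiag.1 hα).1
    have hfr : ∀ Fl : Fin L → Stab u, Monotone (p Fl) → δ Fl = α → ∀ i, Module.finrank K (Fl i).1 = ∑ j ∈ Iic i, α j := by
      rintro Fl hm rfl i
      exact (partial_sum_eq (he Fl hm) (he0 Fl) i).symm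
    refine Finset.card_bij (fun Fl hFl => (⟨fun i => (Fl i).1, ?_, ?_⟩ : FlagG K n α)) ?_ ?_ ?_
    · have hm := (mem_filter.1 (mem_filter.1 hFl).1).2.1
      intro i j hij
      exact hm (Fin.succ_le_succ_iff.2 hij)
    · exact hfr Fl (mem_filter.1 (mem_filter.1 hFl).1).2.1 (mem_filter.1 hFl).2
    · intro Fl hFl
      refine mem_filter.2 ⟨mem_univ _, FlagG.ext (funext fun i => ?_)⟩
      exact (Fl i).2
    · intro Fl hFl Fl' hFl' e
      funext i
      exact Subtype.ext (congrFun (congrArg Subtype.val e) i)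
    · intro y hy
      have hy := (mem_filter.1 hy).2
      have hst' : ∀ i, act u (y.1 i) = y.1 i := fun i => congrFun (congrArg Subtype.val hy) i
      let Fl : Fin L → Stab u := fun i => ⟨y.1 i, hst' i⟩
      have hm : Monotone (p Fl) := by
        intro i j hij
        induction i using Fin.cases with
        | zero => exact (bot_le : (⊥ : Submodule K (Fin n → K)) ≤ (p Fl j).1)
        | succ i =>
          induction j using Fin.cases with
          | zero => simp [Fin.le_def] at hij
          | succ j => exact y.2.1 (Fin.succ_le_succ_iff.1 hij)
      have hδ : δ Fl = α := by
        refine DFunLike.coe_injective (sum_Iic_inj fun i => ?_)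
        exact (partial_sum_eq (he Fl hm) (he0 Fl) i).trans (y.2.2 i)
      refine ⟨Fl, mem_filter.2 ⟨mem_filter.2 ⟨mem_univ _, hm, ?_⟩, hδ⟩, FlagG.ext rfl⟩
      have h2 : ∑ j : Fin L, δ Fl j = sd (p Fl (Fin.last L)) := total_sum (he Fl hm) (he0 Fl)
      rw [hδ, hαn] at h2
      refine Subtype.ext (Submodule.eq_top_of_finrank_eq ?_)
      exact h2.symm.trans (by simp)
  · intro Fl hFl
    have hFl := (mem_filter.1 hFl).2
    rw [Finset.mem_finsuppAntidiag]
    refine ⟨?_, by simp⟩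
    have h2 : ∑ j : Fin L, δ Fl j = sd (p Fl (Fin.last L)) := total_sum (he Fl hFl.1) (he0 Fl)
    rw [hFl.2, hst] at h2
    exact h2
end stab
end UT

/- part P17 -/
set_option linter.unusedSectionVars false
set_option linter.unusedSimpArgs false
namespace UT
section pos
open scoped Classical
open Finset
variable {K : Type} [Field K] [Fintype K]

theorem exists_w {n : ℕ} (u : GL (Fin n) K) : ∃ w : Equiv.Perm (Fin n) → ℝ, ∀ b : J n →₀ ℝ, PiG K n b u = ∑ σ, w σ * PiS n b σ := by
  let φ : Module.Dual ℝ (J n →₀ ℝ) := (LinearMap.proj u).comp (PiG K n)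
  have h : φ ∈ LinearMap.range (PiS n).dualMap := by
    rw [LinearMap.range_dualMap_eq_dualAnnihilator_ker, Submodule.mem_dualAnnihilator]
    intro b hb
    rw [LinearMap.mem_ker, ← ker_iff (K := K)] at hb
    change PiG K n b u = 0
    rw [hb]; rfl
  obtain ⟨ψ, hψ⟩ := h
  refine ⟨fun σ => ψ (fun τ => if σ = τ then 1 else 0), fun b => ?_⟩
  have h1 : PiG K n b u = ψ (PiS n b) := (congrFun (congrArg DFunLike.coe hψ) b).symm
  rw [h1, LinearMap.pi_apply_eq_sum_univ ψ (PiS n b)]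
  refine Finset.sum_congr rfl fun σ _ => ?_
  rw [smul_eq_mul, mul_comm]

theorem eval_psum {n L : ℕ} (x : Fin L → ℝ) (σ : Equiv.Perm (Fin n)) :
    ((ct σ).map (pw (List.ofFn x))).prod = ∑ α ∈ Finset.finsuppAntidiag (univ : Finset (Fin L)) n, (piS α σ : ℝ) * ∏ i, x i ^ α i := by
  have h1 : ((ct σ).map (pw (List.ofFn x))).prod = MvPolynomial.eval x ((ct σ).map (MvPolynomial.psum (Fin L) ℝ)).prod := by
    rw [map_multiset_prod, Multiset.map_map]
    congr 1
    refine Multiset.map_congr rfl fun k _ => ?_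
    simp [pw, MvPolynomial.psum, List.map_ofFn, List.sum_ofFn]
  rw [h1, MvPolynomial.eval_eq']
  simp only [piS_eq]
  refine Finset.sum_subset ?_ ?_
  · intro α hα
    rw [PS_sum] at hα
    obtain ⟨c, _, hc⟩ := Finset.mem_biUnion.1 (MvPolynomial.support_sum hα)
    have hc := Finset.mem_singleton.1 (MvPolynomial.support_monomial_subset hc)
    rw [Finset.mem_finsuppAntidiag]
    refine ⟨?_, by simp⟩
    subst hc
    simp only [Finsupp.finsetSum_apply]
    rw [Finset.sum_comm]
    simp [Finsupp.single_apply]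
  · intro α _ hα
    rw [MvPolynomial.notMem_support_iff] at hα
    simp [hα]

noncomputable def Vw {n : ℕ} (w : Equiv.Perm (Fin n) → ℝ) (p : ℕ → ℝ) : ℝ := ∑ σ, w σ * ((ct σ).map p).prod

theorem Vw_poly {n : ℕ} (w : Equiv.Perm (Fin n) → ℝ) (p q : ℕ → ℝ) : ∃ P : Polynomial ℝ, ∀ r : ℝ, P.eval r = Vw w (fun k => p k + r * q k) := by
  refine ⟨∑ σ, Polynomial.C (w σ) * ((ct σ).map fun k => Polynomial.C (p k) + Polynomial.X * Polynomial.C (q k)).prod, fun r => ?_⟩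
  rw [Polynomial.eval_finsetSum, Vw]
  refine Finset.sum_congr rfl fun σ _ => ?_
  rw [Polynomial.eval_mul, Polynomial.eval_C, Polynomial.eval_multiset_prod, Multiset.map_map]
  congr 2
  refine Multiset.map_congr rfl fun k _ => ?_
  simp
  ring

theorem Vw_base {n : ℕ} {u : GL (Fin n) K} {w : Equiv.Perm (Fin n) → ℝ} (hw : ∀ b : J n →₀ ℝ, PiG K n b u = ∑ σ, w σ * PiS n b σ)
    (A : List ℝ) : Vw w (pw A) = (A.map (Zm (sd : Stab u → ℕ))).prod (sbot u) (stabTop u) := by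
  obtain ⟨L, x, rfl⟩ : ∃ L, ∃ x : Fin L → ℝ, A = List.ofFn x := ⟨A.length, A.get, (List.ofFn_get A).symm⟩
  rw [List.map_ofFn]
  refine Eq.trans ?_ (flag_sum u x).symm
  unfold Vw
  simp only [eval_psum, Finset.mul_sum]
  rw [Finset.sum_comm]
  refine Finset.sum_congr rfl fun α hα => ?_
  have hαn : ∑ i, α i = n := by simpa using (Finset.mem_finsuppAntidiag.1 hα).1
  have := hw (Finsupp.single (Jm α hαn) 1)
  simp only [PiG_single, PiS_single, one_mul] at this
  change (piG α u : ℝ) = ∑ σ, w σ * (piS α σ : ℝ) at this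
  rw [this, Finset.mul_sum]
  refine Finset.sum_congr rfl fun σ _ => ?_
  ring

theorem Vw_nonneg {n : ℕ} {u : GL (Fin n) K} {w : Equiv.Perm (Fin n) → ℝ} (hw : ∀ b : J n →₀ ℝ, PiG K n b u = ∑ σ, w σ * PiS n b σ)
    (hu : ∃ N, (Matrix.mulVecLin (u : Matrix (Fin n) (Fin n) K) - 1 : Module.End K (Fin n → K)) ^ N = 0)
    (A B : List ℝ) (hA : ∀ a ∈ A, 0 ≤ a) (hB : ∀ b ∈ B, 0 ≤ b) : 0 ≤ Vw w (fun k => pw A k - pw (B.map fun b => -b) k) := by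
  rw [super_val (Z := Zm (sd : Stab u → ℕ)) (D := n + 1) (fun y => Zm_nil sd_mono sd_lt y) (sbot u) (stabTop u) (Vw w) (Vw_poly w) (Vw_base hw)]
  rw [Matrix.mul_apply]
  refine Finset.sum_nonneg fun c _ => mul_nonneg ?_ ?_
  · refine list_prod_nonneg ?_ _ _
    intro M hM
    obtain ⟨a, ha, rfl⟩ := List.mem_map.1 hM
    exact Zm_nonneg (hA a ha)
  · refine list_prod_nonneg ?_ _ _
    intro M hM
    rw [List.map_map] at hM
    obtain ⟨a, ha, rfl⟩ := List.mem_map.1 hM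
    exact Zinv_nonneg sd_mono sd_mod (sd_cov hu) (hB a ha)

theorem Vw_congr {n : ℕ} (w : Equiv.Perm (Fin n) → ℝ) {p q : ℕ → ℝ} (h : ∀ k, 0 < k → p k = q k) : Vw w p = Vw w q := by
  unfold Vw
  refine Finset.sum_congr rfl fun σ _ => ?_
  congr 2
  refine Multiset.map_congr rfl fun k hk => h k (Nat.pos_of_ne_zero fun h0 => ct_pos σ (h0 ▸ hk))

theorem ext_nonneg {n : ℕ} {u : GL (Fin n) K} {w : Equiv.Perm (Fin n) → ℝ} (hw : ∀ b : J n →₀ ℝ, PiG K n b u = ∑ σ, w σ * PiS n b σ)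
    (hu : ∃ N, (Matrix.mulVecLin (u : Matrix (Fin n) (Fin n) K) - 1 : Module.End K (Fin n → K)) ^ N = 0)
    {f : Multiset ℕ → ℝ} (hf : f ∈ KK.extremePoints ℝ) : 0 ≤ ∑ σ, w σ * f (ct σ) := by
  have e1 : ∑ σ, w σ * f (ct σ) = Vw w (PP f) := by
    unfold Vw
    refine Finset.sum_congr rfl fun σ _ => ?_
    rw [PP_prod hf _ (ct_pos σ)]
  rw [e1]
  choose A B hA hB h using fun N : ℕ => thoma_approx hf (n + 1) (1 / ((N : ℝ) + 1)) (by positivity)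
  let p : ℕ → ℕ → ℝ := fun N k => if k = 0 then 0 else pw (A N).toList k - pw ((B N).toList.map fun b => -b) k
  have hp : ∀ N, 0 ≤ Vw w (p N) := by
    intro N
    rw [Vw_congr w (q := fun k => pw (A N).toList k - pw ((B N).toList.map fun b => -b) k)]
    · exact Vw_nonneg hw hu _ _ (fun a ha => hA N a (Multiset.mem_toList.1 ha)) (fun a ha => hB N a (Multiset.mem_toList.1 ha))
    · intro k hk; simp [p, hk.ne']
  have hpk : ∀ k, 0 < k → k ≤ n → Filter.Tendsto (fun N => p N k) Filter.atTop (nhds (PP f k)) := by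
    intro k hk hkn
    obtain ⟨k, rfl⟩ : ∃ j, k = j + 1 := ⟨k - 1, by omega⟩
    rw [tendsto_iff_dist_tendsto_zero]
    refine squeeze_zero (fun _ => dist_nonneg) (fun N => ?_) tendsto_one_div_add_atTop_nhds_zero_nat
    have := (h N k (by omega)).le
    rw [dist_comm, Real.dist_eq]
    refine le_trans (le_of_eq ?_) this
    congr 2
    simp only [p, pw, if_neg (Nat.succ_ne_zero k), List.map_map]
    have e1 : ((A N).map (fun a => a ^ (k + 1))).sum = ((A N).toList.map fun a => a ^ (k + 1)).sum := by
      conv_lhs => rw [← Multiset.coe_toList (A N)]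
      simp
    have e2 : ((B N).map (fun a => a ^ (k + 1))).sum = ((B N).toList.map fun a => a ^ (k + 1)).sum := by
      conv_lhs => rw [← Multiset.coe_toList (B N)]
      simp
    rw [e1, e2]
    rw [sub_eq_add_neg]
    congr 1
    have e3 : ((fun a : ℝ => a ^ (k + 1)) ∘ fun b => -b) = fun b => (-1) ^ (k + 1) * b ^ (k + 1) := by
      funext b; simp [neg_pow b]
    rw [e3, List.sum_map_mul_left, pow_succ]; ring
  refine ge_of_tendsto' (f := fun N => Vw w (p N)) (a := Vw w (PP f)) (b := 0) (x := Filter.atTop) ?_ hp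
  unfold Vw
  refine tendsto_finsetSum _ fun σ _ => Filter.Tendsto.const_mul _ ?_
  have hm : ∀ m : Multiset ℕ, (∀ k ∈ m, 0 < k ∧ k ≤ n) → Filter.Tendsto (fun N => (m.map (p N)).prod) Filter.atTop (nhds (m.map (PP f)).prod) := by
    intro m
    induction m using Multiset.induction with
    | empty => intro _; simp
    | cons a m ih =>
      intro hm
      simp only [Multiset.map_cons, Multiset.prod_cons]
      have ha := hm a (Multiset.mem_cons_self a m)
      exact (hpk a ha.1 ha.2).mul (ih fun k hk => hm k (Multiset.mem_cons_of_mem hk))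
  refine hm _ fun k hk => ⟨Nat.pos_of_ne_zero fun h0 => ct_pos σ (h0 ▸ hk), ?_⟩
  have h3 := Multiset.le_sum_of_mem hk
  rw [ct_sum] at h3
  simpa using h3

theorem KK_nonneg {n : ℕ} {u : GL (Fin n) K} {w : Equiv.Perm (Fin n) → ℝ} (hw : ∀ b : J n →₀ ℝ, PiG K n b u = ∑ σ, w σ * PiS n b σ)
    (hu : ∃ N, (Matrix.mulVecLin (u : Matrix (Fin n) (Fin n) K) - 1 : Module.End K (Fin n → K)) ^ N = 0)
    {f : Multiset ℕ → ℝ} (hf : f ∈ KK) : 0 ≤ ∑ σ, w σ * f (ct σ) := by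
  rw [← closure_convexHull_extremePoints KK_compact KK_convex] at hf
  let C : Set (Multiset ℕ → ℝ) := {f | 0 ≤ ∑ σ, w σ * f (ct σ)}
  have hC : IsClosed C := isClosed_le continuous_const (by fun_prop)
  have hcv : Convex ℝ C := by
    intro x hx y hy a b ha hb _
    change 0 ≤ ∑ σ, w σ * (a * x (ct σ) + b * y (ct σ))
    have : ∑ σ, w σ * (a * x (ct σ) + b * y (ct σ)) = a * ∑ σ, w σ * x (ct σ) + b * ∑ σ, w σ * y (ct σ) := by
      rw [Finset.mul_sum, Finset.mul_sum, ← Finset.sum_add_distrib]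
      refine Finset.sum_congr rfl fun σ _ => by ring
    rw [this]
    exact add_nonneg (mul_nonneg ha hx) (mul_nonneg hb hy)
  exact closure_minimal (convexHull_min (fun f hf => ext_nonneg hw hu hf) hcv) hC hf

theorem unip_nonneg (b : ∀ n, J n →₀ ℝ) (h0 : PiG K 0 (b 0) 1 = 1)
    (hc : ∀ n (g : GL (Fin n) K), ∃ h : (Fin n → K) → GL (Fin (n+1)) K, (∀ v, Hl g v (h v)) ∧ ∑ v, PiG K (n+1) (b (n+1)) (h v) = (Fintype.card K : ℝ)^n * PiG K n (b n) g)
    (hpd : ∀ n (x : Equiv.Perm (Fin n) → ℝ), 0 ≤ ∑ σ, ∑ τ, x σ * x τ * PiS n (b n) (σ⁻¹ * τ))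
    {n : ℕ} (u : GL (Fin n) K) (hu : ∃ N, (Matrix.mulVecLin (u : Matrix (Fin n) (Fin n) K) - 1 : Module.End K (Fin n → K)) ^ N = 0) :
    0 ≤ PiG K n (b n) u := by
  obtain ⟨f, hf, hfe⟩ := coherent b h0 hc hpd
  obtain ⟨w, hw⟩ := exists_w u
  rw [hw]
  simp only [hfe]
  exact KK_nonneg hw hu hf
end pos
end UT

/- part P18 -/
open scoped ComplexOrder
open MeasureTheory
set_option linter.unusedSectionVars false
set_option linter.unusedSimpArgs false
namespace UT
section lim
open scoped Classical
open Filter Topology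

theorem cyl_lim {X : Type} [TopologicalSpace X] [CompactSpace X] [TopologicalSpace.MetrizableSpace X] [MeasurableSpace X] [BorelSpace X]
    (μ : ℕ → Measure X) (hμ : ∀ n, IsProbabilityMeasure (μ n)) (c : Set X → ℝ) :
    ∃ ρ : Measure X, IsProbabilityMeasure ρ ∧ ∀ s, IsClopen s → (∀ᶠ n in atTop, (μ n s).toReal = c s) → (ρ s).toReal = c s := by
  let ν : ℕ → ProbabilityMeasure X := fun n => ⟨μ n, hμ n⟩
  obtain ⟨ρ, hρ⟩ : ∃ ρ : ProbabilityMeasure X, MapClusterPt ρ atTop ν := exists_clusterPt_of_compactSpace _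
  refine ⟨ρ, inferInstance, fun s hs hev => ?_⟩
  let φ : BoundedContinuousFunction X ℝ := BoundedContinuousFunction.mkOfCompact ⟨s.indicator 1, hs.continuous_indicator continuous_one⟩
  have hc : Continuous (fun ν : ProbabilityMeasure X => ∫ x, φ x ∂(ν : Measure X)) :=
    ProbabilityMeasure.continuous_integral_boundedContinuousFunction φ
  have hi : ∀ m : Measure X, ∫ x, φ x ∂m = (m s).toReal := fun m => integral_indicator_one hs.isOpen.measurableSet
  have h1 : MapClusterPt (∫ x, φ x ∂(ρ : Measure X)) atTop (fun n => ∫ x, φ x ∂(ν n : Measure X)) :=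
    hρ.continuousAt_comp hc.continuousAt
  have h2 : Tendsto (fun n => ∫ x, φ x ∂(ν n : Measure X)) atTop (𝓝 (c s)) := by
    refine tendsto_const_nhds.congr' ?_
    filter_upwards [hev] with n hn
    rw [hi]; exact hn.symm
  rw [← hi]
  exact eq_of_nhds_neBot (ClusterPt.mono h1 h2)
end lim

section uu
open scoped Classical
open Finset
variable {F : Type} [Field F] [Fintype F] [DecidableEq F]

/-- invertible matrix from a unipotent upper triangular one -/
noncomputable def mkU {n : ℕ} (M : Matrix (Fin n) (Fin n) F) (h1 : ∀ i j : Fin n, j < i → M i j = 0) (h2 : ∀ i, M i i = 1) : GLn F n :=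
  Matrix.GeneralLinearGroup.mkOfDetNeZero M (by
    rw [Matrix.det_of_isUpperTriangular (fun i j h => h1 i j h)]
    simp [h2])

theorem mkU_apply {n : ℕ} (M : Matrix (Fin n) (Fin n) F) (h1 h2) (i j) : (mkU M h1 h2 : Matrix (Fin n) (Fin n) F) i j = M i j := rfl

theorem mkU_uut {n : ℕ} (M : Matrix (Fin n) (Fin n) F) (h1 h2) : IsUUT F (mkU M h1 h2) := ⟨h1, h2⟩

/-- corner of an infinite matrix -/
noncomputable def crn (n : ℕ) (X : UU F) : GLn F n :=
  mkU (Matrix.of fun i j => X.1 i j) (fun i j h => X.2.1 i j h) (fun i => X.2.2 i)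

theorem crn_uut (n : ℕ) (X : UU F) : IsUUT F (crn n X) := mkU_uut _ _ _

theorem mem_cyl {n : ℕ} (g : GLn F n) (X : UU F) : X ∈ CylU F g ↔ crn n X = g := by
  constructor
  · intro h
    ext i j
    exact h i j
  · rintro rfl i j
    rfl

/-- completion of a finite matrix -/
noncomputable def compl {n : ℕ} (g : GLn F n) (hg : IsUUT F g) : UU F :=
  ⟨fun i j => if h : i < n ∧ j < n then (g : Matrix (Fin n) (Fin n) F) ⟨i, h.1⟩ ⟨j, h.2⟩ else if i = j then 1 else 0, by
    constructor
    · intro i j hij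
      by_cases h : i < n ∧ j < n
      · simp only [dif_pos h]
        exact hg.1 _ _ hij
      · simp only [dif_neg h]
        rw [if_neg (by omega)]
    · intro i
      by_cases h : i < n
      · simp only [h, and_self, dif_pos]
        exact hg.2 _
      · simp [h]⟩

theorem crn_compl {n : ℕ} (g : GLn F n) (hg : IsUUT F g) : crn n (compl g hg) = g := by
  ext i j
  change (if h : i.1 < n ∧ j.1 < n then (g : Matrix (Fin n) (Fin n) F) ⟨i, h.1⟩ ⟨j, h.2⟩ else if i.1 = j.1 then 1 else 0) = _
  rw [dif_pos ⟨i.2, j.2⟩]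

theorem ext_crn (n : ℕ) (X : UU F) : crn (n + 1) X ∈ ExtUSet F (crn n X) := by
  rw [ExtUSet, mem_filter]
  refine ⟨mem_univ _, fun i j => rfl, fun j => ?_, ?_⟩
  · exact X.2.1 _ _ j.2
  · exact X.2.2 _

theorem crn_of_ext {n : ℕ} {g : GLn F n} {h : GLn F (n + 1)} (hh : h ∈ ExtUSet F g) {X : UU F} (hX : crn (n + 1) X = h) : crn n X = g := by
  rw [ExtUSet, mem_filter] at hh
  ext i j
  rw [← hh.2.1, ← hX]
  rfl

theorem uut_of_ext {n : ℕ} {g : GLn F n} (hg : IsUUT F g) {h : GLn F (n + 1)} (hh : h ∈ ExtUSet F g) : IsUUT F h := by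
  rw [ExtUSet, mem_filter] at hh
  obtain ⟨-, h1, h2, h3⟩ := hh
  constructor
  · intro i j hij
    induction i using Fin.lastCases with
    | last =>
      induction j using Fin.lastCases with
      | last => exact absurd hij (lt_irrefl _)
      | cast j => exact h2 j
    | cast i =>
      induction j using Fin.lastCases with
      | last => exact absurd hij (not_lt.2 (Fin.le_last _))
      | cast j => rw [h1]; exact hg.1 _ _ (by simpa using hij)
  · intro i
    induction i using Fin.lastCases with
    | last => exact h3
    | cast i => rw [h1]; exact hg.2 _

theorem crn_mono {k n : ℕ} (hkn : k ≤ n) {X Y : UU F} (h : crn n X = crn n Y) : crn k X = crn k Y := by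
  ext i j
  have := congrArg (fun g : GLn F n => (g : Matrix (Fin n) (Fin n) F) ⟨i, by omega⟩ ⟨j, by omega⟩) h
  exact this

/-- total mass over a cylinder -/
theorem mass {m : ∀ n, GLn F n → ℝ} (hc : ∀ n g, IsUUT F g → ∑ h ∈ ExtUSet F g, m (n + 1) h = m n g)
    {k : ℕ} (g₀ : GLn F k) (hg₀ : IsUUT F g₀) : ∀ n, k ≤ n →
    ∑ g : {g : GLn F n // IsUUT F g}, (if crn k (compl g.1 g.2) = g₀ then m n g.1 else 0) = m k g₀ := by
  intro n hn
  induction n, hn using Nat.le_induction with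
  | base =>
    rw [Finset.sum_eq_single ⟨g₀, hg₀⟩]
    · rw [if_pos (crn_compl _ _)]
    · intro g _ hne
      rw [if_neg]
      rw [crn_compl]
      exact fun h => hne (Subtype.ext h)
    · intro h; exact absurd (mem_univ _) h
  | succ n hn ih =>
    rw [← ih]
    rw [← Finset.sum_fiberwise univ (fun h : {h : GLn F (n + 1) // IsUUT F h} => (⟨crn n (compl h.1 h.2), crn_uut _ _⟩ : {g : GLn F n // IsUUT F g}))]
    refine Finset.sum_congr rfl fun g _ => ?_
    have e1 : ∀ h : {h : GLn F (n + 1) // IsUUT F h}, (⟨crn n (compl h.1 h.2), crn_uut _ _⟩ : {g : GLn F n // IsUUT F g}) = g →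
        crn k (compl h.1 h.2) = crn k (compl g.1 g.2) := by
      intro h hh
      refine crn_mono hn ?_
      rw [crn_compl]; exact congrArg Subtype.val hh
    rw [Finset.sum_congr rfl (g := fun h => if crn k (compl g.1 g.2) = g₀ then m (n + 1) h.1 else 0) (fun h hh => by rw [e1 h (mem_filter.1 hh).2])]
    by_cases hk : crn k (compl g.1 g.2) = g₀
    · simp only [if_pos hk]
      rw [← hc n g.1 g.2]
      refine Finset.sum_bij (fun h _ => h.1) ?_ ?_ ?_ ?_
      · intro h hh
        have := ext_crn n (compl h.1 h.2)
        rw [crn_compl] at this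
        rw [← congrArg Subtype.val (mem_filter.1 hh).2]
        exact this
      · intro h _ h' _ e; exact Subtype.ext e
      · intro h hh
        have hu := uut_of_ext g.2 hh
        refine ⟨⟨h, hu⟩, mem_filter.2 ⟨mem_univ _, Subtype.ext ?_⟩, rfl⟩
        exact crn_of_ext hh (crn_compl h hu)
      · intro h _; rfl
    · simp only [if_neg hk, Finset.sum_const_zero]

theorem eval_meas (i j : ℕ) (a : F) : MeasurableSet {X : UU F | X.1 i j = a} := by
  let _ : MeasurableSpace F := ⊤
  have h1 : Measurable (fun X : UU F => X.1 i j) :=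
    (measurable_pi_apply j).comp ((measurable_pi_apply i).comp measurable_subtype_coe)
  exact h1 (MeasurableSpace.measurableSet_top (s := {a}))

theorem cyl_meas {n : ℕ} (g : GLn F n) : MeasurableSet (CylU F g) := by
  have : CylU F g = ⋂ i : Fin n, ⋂ j : Fin n, {X : UU F | X.1 i j = (g : Matrix (Fin n) (Fin n) F) i j} := by
    ext X; simp [CylU]
  rw [this]
  exact MeasurableSet.iInter fun i => MeasurableSet.iInter fun j => eval_meas _ _ _

theorem cyl_gen : (inferInstance : MeasurableSpace (UU F)) = MeasurableSpace.generateFrom {s | ∃ n, ∃ g : GLn F n, IsUUT F g ∧ s = CylU F g} := by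
  refine le_antisymm ?_ ?_
  · let _ : MeasurableSpace F := ⊤
    have h : @Measurable (UU F) (ℕ → ℕ → F) (MeasurableSpace.generateFrom {s | ∃ n, ∃ g : GLn F n, IsUUT F g ∧ s = CylU F g}) _ (fun X => X.1) := by
      let _ : MeasurableSpace (UU F) := MeasurableSpace.generateFrom {s | ∃ n, ∃ g : GLn F n, IsUUT F g ∧ s = CylU F g}
      refine measurable_pi_iff.2 fun i => measurable_pi_iff.2 fun j => measurable_to_countable' fun a => ?_
      have : ((fun X : UU F => X.1 i j) ⁻¹' {a}) = ⋃ g : {g : GLn F (max i j + 1) // IsUUT F g ∧ (g : Matrix (Fin (max i j + 1)) (Fin (max i j + 1)) F) ⟨i, by omega⟩ ⟨j, by omega⟩ = a}, CylU F g.1 := by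
        ext X
        simp only [Set.mem_preimage, Set.mem_singleton_iff, Set.mem_iUnion]
        constructor
        · intro h; exact ⟨⟨crn _ X, crn_uut _ X, h⟩, (mem_cyl _ _).2 rfl⟩
        · rintro ⟨g, hg⟩
          rw [← g.2.2]
          exact hg ⟨i, by omega⟩ ⟨j, by omega⟩
      rw [this]
      refine MeasurableSet.iUnion fun g => MeasurableSpace.measurableSet_generateFrom ⟨_, g.1, g.2.1, rfl⟩
    exact measurable_iff_comap_le.1 h
  · refine MeasurableSpace.generateFrom_le ?_
    rintro _ ⟨n, g, _, rfl⟩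
    exact cyl_meas g

theorem cyl_pi : IsPiSystem {s | ∃ n, ∃ g : GLn F n, IsUUT F g ∧ s = CylU F g} := by
  have key : ∀ {k n : ℕ} (g : GLn F k) (h : GLn F n), k ≤ n → (CylU F g ∩ CylU F h).Nonempty → CylU F g ∩ CylU F h = CylU F h := by
    rintro k n g h hkn ⟨X, hX⟩
    refine Set.inter_eq_right.2 fun Y hY => ?_
    rw [mem_cyl] at hY ⊢
    have h1 := (mem_cyl _ _).1 hX.1
    have h2 := (mem_cyl _ _).1 hX.2
    rw [← h1]
    exact crn_mono hkn (hY.trans h2.symm)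
  rintro _ ⟨k, g, hg, rfl⟩ _ ⟨n, h, hh, rfl⟩ hne
  rcases le_total k n with hkn | hkn
  · exact ⟨n, h, hh, key g h hkn hne⟩
  · refine ⟨k, g, hg, ?_⟩
    rw [Set.inter_comm] at hne ⊢
    exact key h g hkn hne

theorem meas_unique (μ ν : Measure (UU F)) [IsProbabilityMeasure μ] [IsProbabilityMeasure ν]
    (h : ∀ (n : ℕ) (g : GLn F n), IsUUT F g → (μ (CylU F g)).toReal = (ν (CylU F g)).toReal) : μ = ν := by
  refine MeasureTheory.ext_of_generate_finite _ cyl_gen cyl_pi ?_ (by simp)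
  rintro _ ⟨n, g, hg, rfl⟩
  exact (ENNReal.toReal_eq_toReal_iff' (measure_ne_top _ _) (measure_ne_top _ _)).1 (h n g hg)

theorem meas_exists {m : ∀ n, GLn F n → ℝ} (hc : ∀ n g, IsUUT F g → ∑ h ∈ ExtUSet F g, m (n + 1) h = m n g)
    (h0 : m 0 1 = 1) (hpos : ∀ n g, IsUUT F g → 0 ≤ m n g) :
    ∃ ρ : Measure (UU F), IsProbabilityMeasure ρ ∧ ∀ (n : ℕ) (g : GLn F n), IsUUT F g → (ρ (CylU F g)).toReal = m n g := by
  let _ : TopologicalSpace F := ⊥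
  have _ : DiscreteTopology F := ⟨rfl⟩
  have _ : SecondCountableTopology F := DiscreteTopology.secondCountableTopology_of_countable
  let _ : MeasurableSpace F := ⊤
  have _ : BorelSpace F := ⟨by
    symm
    exact borel_eq_top_of_discrete⟩
  have hmet : TopologicalSpace.MetrizableSpace {X : ℕ → ℕ → F // (∀ i j : ℕ, j < i → X i j = 0) ∧ ∀ i : ℕ, X i i = 1} :=
    have _ : SecondCountableTopology {X : ℕ → ℕ → F // (∀ i j : ℕ, j < i → X i j = 0) ∧ ∀ i : ℕ, X i i = 1} :=
      TopologicalSpace.secondCountableTopology_induced _ (ℕ → ℕ → F) Subtype.val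
    TopologicalSpace.metrizableSpace_of_t3_secondCountable _
  have hbor : BorelSpace {X : ℕ → ℕ → F // (∀ i j : ℕ, j < i → X i j = 0) ∧ ∀ i : ℕ, X i i = 1} := inferInstance
  let _ : TopologicalSpace (UU F) := instTopologicalSpaceSubtype
  have hev : ∀ i j, Continuous (fun X : UU F => X.1 i j) := fun i j =>
    (continuous_apply j).comp ((continuous_apply i).comp continuous_subtype_val)
  have _ : CompactSpace (UU F) := by
    refine isCompact_iff_compactSpace.1 (IsClosed.isCompact ?_)
    have e : {X : ℕ → ℕ → F | (∀ i j : ℕ, j < i → X i j = 0) ∧ ∀ i : ℕ, X i i = 1} =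
        (⋂ i : ℕ, ⋂ j : ℕ, ⋂ _ : j < i, {X | X i j = 0}) ∩ ⋂ i : ℕ, {X | X i i = 1} := by
      ext X; simp
    have hcl : ∀ i j (a : F), IsClosed {X : ℕ → ℕ → F | X i j = a} := fun i j a =>
      isClosed_eq (by fun_prop) continuous_const
    change IsClosed {X : ℕ → ℕ → F | (∀ i j : ℕ, j < i → X i j = 0) ∧ ∀ i : ℕ, X i i = 1}
    rw [e]
    exact (isClosed_iInter fun i => isClosed_iInter fun j => isClosed_iInter fun _ => hcl i j 0).inter (isClosed_iInter fun i => hcl i i 1)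
  have _ : TopologicalSpace.MetrizableSpace (UU F) := hmet
  have _ : BorelSpace (UU F) := hbor
  have hclopen : ∀ {n : ℕ} (g : GLn F n), IsClopen (CylU F g) := by
    intro n g
    have : CylU F g = ⋂ i : Fin n, ⋂ j : Fin n, {X : UU F | X.1 i j = (g : Matrix (Fin n) (Fin n) F) i j} := by
      ext X; simp [CylU]
    rw [this]
    exact isClopen_iInter_of_finite fun i => isClopen_iInter_of_finite fun j => (isClopen_discrete {(g : Matrix (Fin n) (Fin n) F) i j}).preimage (hev i j)
  let μ : ℕ → Measure (UU F) := fun n => ∑ g : {g : GLn F n // IsUUT F g}, ENNReal.ofReal (m n g.1) • Measure.dirac (compl g.1 g.2)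
  have hval : ∀ {k : ℕ} (g₀ : GLn F k), IsUUT F g₀ → ∀ n, k ≤ n → μ n (CylU F g₀) = ENNReal.ofReal (m k g₀) := by
    intro k g₀ hg₀ n hn
    rw [← mass hc g₀ hg₀ n hn, ENNReal.ofReal_sum_of_nonneg]
    · simp only [μ, Measure.coe_finsetSum, Finset.sum_apply, Measure.smul_apply, smul_eq_mul]
      refine Finset.sum_congr rfl fun g _ => ?_
      rw [Measure.dirac_apply' _ (cyl_meas g₀), Set.indicator_apply]
      simp only [mem_cyl]
      split_ifs <;> simp
    · intro g _
      split_ifs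
      · exact hpos _ _ g.2
      · exact le_rfl
  have h1u : IsUUT F (1 : GLn F 0) := ⟨fun i => i.elim0, fun i => i.elim0⟩
  have huniv : CylU F (1 : GLn F 0) = Set.univ := by
    ext X; simp only [Set.mem_univ, iff_true]; exact fun i => i.elim0
  have hμ : ∀ n, IsProbabilityMeasure (μ n) := by
    intro n
    constructor
    rw [← huniv, hval _ h1u n (Nat.zero_le _), h0, ENNReal.ofReal_one]
  obtain ⟨ρ, hρ, hρ'⟩ := cyl_lim μ hμ (fun s => Filter.limsup (fun n => (μ n s).toReal) Filter.atTop)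
  refine ⟨ρ, hρ, fun n g hg => ?_⟩
  have hev2 : ∀ᶠ k in Filter.atTop, (μ k (CylU F g)).toReal = m n g := by
    filter_upwards [Filter.eventually_ge_atTop n] with k hk
    rw [hval g hg k hk, ENNReal.toReal_ofReal (hpos n g hg)]
  have hl : Filter.limsup (fun n => (μ n (CylU F g)).toReal) Filter.atTop = m n g := by
    rw [Filter.limsup_congr hev2, Filter.limsup_const]
  rw [hρ' _ (hclopen g), hl]
  rw [hl]; exact hev2
end uu
end UT

/- part P19 -/
open scoped ComplexOrder
open MeasureTheory
set_option linter.unusedSectionVars false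
set_option linter.unusedSimpArgs false
namespace UT
section fin
open scoped Classical
open Finset
variable {F : Type} [Field F] [Fintype F] [DecidableEq F]

theorem uut_nil {n : ℕ} {g : GLn F n} (hg : IsUUT F g) :
    ∃ N, (Matrix.mulVecLin (g : Matrix (Fin n) (Fin n) F) - 1 : Module.End F (Fin n → F)) ^ N = 0 := by
  refine ⟨n, ?_⟩
  have h1 := Matrix.aeval_self_charpoly (g : Matrix (Fin n) (Fin n) F)
  rw [Matrix.charpoly_of_isUpperTriangular _ (fun i j h => hg.1 i j h)] at h1
  simp only [hg.2, Finset.prod_const, Finset.card_univ, Fintype.card_fin, map_pow, map_sub, Polynomial.aeval_X, Polynomial.aeval_C, map_one] at h1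
  have h2 := congrArg (Matrix.toLinAlgEquiv' : Matrix (Fin n) (Fin n) F ≃ₐ[F] _) h1
  rw [map_pow, map_sub, map_one, map_zero] at h2
  exact h2

noncomputable def endT {n : ℕ} (g : GLn F n) (v : Fin n → F) : (Fin (n + 1) → F) →ₗ[F] (Fin (n + 1) → F) :=
  (inc F n).comp ((Matrix.mulVecLin (g : Matrix (Fin n) (Fin n) F)).comp (LinearMap.funLeft F F Fin.castSucc)) +
    (LinearMap.proj (Fin.last n)).smulRight (ev v)

theorem endT_apply {n : ℕ} (g : GLn F n) (v : Fin n → F) (y : Fin (n + 1) → F) :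
    endT g v y = inc F n (Matrix.mulVecLin (g : Matrix (Fin n) (Fin n) F) (ini y)) + y (Fin.last n) • ev v := rfl

theorem endT_inj {n : ℕ} (g : GLn F n) (v : Fin n → F) : Function.Injective (endT g v) := by
  rw [injective_iff_map_eq_zero]
  intro y hy
  rw [endT_apply] at hy
  have h1 : y (Fin.last n) = 0 := by simpa using congrFun hy (Fin.last n)
  rw [h1, zero_smul, add_zero] at hy
  have h2 := inc_inj (hy.trans (map_zero _).symm)
  have h3 : ini y = 0 := act_inj g (h2.trans (map_zero _).symm)
  rw [decomp0 y h1, h3, map_zero]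

noncomputable def hOf {n : ℕ} (g : GLn F n) (v : Fin n → F) : GLn F (n + 1) := glOf (LinearEquiv.ofInjectiveEndo (endT g v) (endT_inj g v))

theorem hOf_lin {n : ℕ} (g : GLn F n) (v : Fin n → F) : Matrix.mulVecLin (hOf g v : Matrix (Fin (n + 1)) (Fin (n + 1)) F) = endT g v := by
  rw [hOf, glOf_apply]; rfl

theorem hOf_entry {n : ℕ} (g : GLn F n) (v : Fin n → F) (i j) : (hOf g v : Matrix (Fin (n + 1)) (Fin (n + 1)) F) i j = endT g v (Pi.single j 1) i := by
  rw [← hOf_lin, Matrix.mulVecLin_apply, Matrix.mulVec_single_one]; rfl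

theorem ini_inc {n : ℕ} (w : Fin n → F) : ini (inc F n w) = w := by ext i; simp [ini]
theorem ini_ev {n : ℕ} (w : Fin n → F) : ini (ev w) = w := by ext i; simp [ini]

theorem hOf_Hl {n : ℕ} (g : GLn F n) (v : Fin n → F) : Hl g v (hOf g v) := by
  constructor
  · intro w
    rw [hOf_lin, endT_apply, ini_inc, inc_last, zero_smul, add_zero]
  · intro x
    rw [hOf_lin, endT_apply, ini_ev, ev_last, one_smul]
    ext i; refine Fin.lastCases ?_ (fun i => ?_) i <;> simp

theorem ini_single_cs {n : ℕ} (j : Fin n) : ini (Pi.single j.castSucc 1 : Fin (n + 1) → F) = Pi.single j 1 := by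
  ext i; simp [ini, Pi.single_apply]
theorem ini_single_last {n : ℕ} : ini (Pi.single (Fin.last n) 1 : Fin (n + 1) → F) = 0 := by
  ext i; simp [ini, Pi.single_apply]

theorem hOf_e1 {n : ℕ} (g : GLn F n) (v : Fin n → F) (i j : Fin n) : (hOf g v : Matrix (Fin (n + 1)) (Fin (n + 1)) F) i.castSucc j.castSucc = (g : Matrix (Fin n) (Fin n) F) i j := by
  rw [hOf_entry, endT_apply, ini_single_cs]
  simp [Pi.single_apply, (Fin.castSucc_lt_last j).ne']
theorem hOf_e2 {n : ℕ} (g : GLn F n) (v : Fin n → F) (j : Fin n) : (hOf g v : Matrix (Fin (n + 1)) (Fin (n + 1)) F) (Fin.last n) j.castSucc = 0 := by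
  rw [hOf_entry, endT_apply, ini_single_cs]
  simp [Pi.single_apply, (Fin.castSucc_lt_last j).ne']
theorem hOf_e3 {n : ℕ} (g : GLn F n) (v : Fin n → F) (j : Fin n) : (hOf g v : Matrix (Fin (n + 1)) (Fin (n + 1)) F) j.castSucc (Fin.last n) = v j := by
  rw [hOf_entry, endT_apply, ini_single_last]
  simp
theorem hOf_e4 {n : ℕ} (g : GLn F n) (v : Fin n → F) : (hOf g v : Matrix (Fin (n + 1)) (Fin (n + 1)) F) (Fin.last n) (Fin.last n) = 1 := by
  rw [hOf_entry, endT_apply, ini_single_last]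
  simp

theorem sum_ext {n : ℕ} (g : GLn F n) (f : GLn F (n + 1) → ℂ) : ∑ h ∈ ExtUSet F g, f h = ∑ v : Fin n → F, f (hOf g v) := by
  symm
  refine Finset.sum_bij (fun v _ => hOf g v) ?_ ?_ ?_ ?_
  · intro v _
    rw [ExtUSet, mem_filter]
    exact ⟨mem_univ _, hOf_e1 g v, hOf_e2 g v, hOf_e4 g v⟩
  · intro v _ v' _ e
    funext j
    rw [← hOf_e3 g v j, e, hOf_e3]
  · intro h hh
    rw [ExtUSet, mem_filter] at hh
    obtain ⟨-, h1, h2, h3⟩ := hh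
    refine ⟨fun i => (h : Matrix (Fin (n + 1)) (Fin (n + 1)) F) i.castSucc (Fin.last n), mem_univ _, ?_⟩
    ext i j
    induction i using Fin.lastCases with
    | last =>
      induction j using Fin.lastCases with
      | last => rw [hOf_e4, h3]
      | cast j => rw [hOf_e2, h2]
    | cast i =>
      induction j using Fin.lastCases with
      | last => rw [hOf_e3]
      | cast j => rw [hOf_e1, h1]
  · intro v _; rfl

variable {A : Type} [NonUnitalRing A] [Module ℂ A] [SMulCommClass ℂ A A] [IsScalarTower ℂ A A]
    [StarRing A] [StarModule ℂ A]

theorem paraEmb_single {n : ℕ} (g : GLn F n) : paraEmbU F n (MonoidAlgebra.single g 1) =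
    ((Fintype.card F : ℂ) ^ n)⁻¹ • ∑ h ∈ ExtUSet F g, MonoidAlgebra.single h (1 : ℂ) := by
  simp [paraEmbU]

theorem charFun_single {n d : ℕ} (ρ : Representation ℂ (GLn F n) (Fin d → ℂ)) (g : GLn F n) :
    _root_.charFun F ρ (MonoidAlgebra.single g 1) = ρ.character g := by
  simp [_root_.charFun, Representation.character]

theorem chi_pd (ι : ∀ n : ℕ, GA F n →ₗ[ℂ] A)
    (hmul : ∀ (n : ℕ) (a b : GA F n), ι n (a * b) = ι n a * ι n b)
    (hstar : ∀ (n : ℕ) (g : GLn F n),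
      star (ι n (MonoidAlgebra.single g 1)) = ι n (MonoidAlgebra.single g⁻¹ 1))
    (χ : A →ₗ[ℂ] ℂ) (hpos : ∀ x, 0 ≤ χ (star x * x)) (n : ℕ) (x : GLn F n → ℂ) :
    0 ≤ ∑ g, ∑ h, star (x g) * x h * χ (ι n (MonoidAlgebra.single (g⁻¹ * h) 1)) := by
  have h := hpos (∑ g, x g • ι n (MonoidAlgebra.single g 1))
  rw [star_sum, Finset.sum_mul_sum, map_sum] at h
  convert h using 2 with g _
  rw [map_sum]
  refine Finset.sum_congr rfl fun h _ => ?_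
  rw [star_smul, hstar, smul_mul_smul_comm, ← hmul, MonoidAlgebra.single_mul_single, mul_one, map_smul, smul_eq_mul]

theorem main_vals (ι : ∀ n : ℕ, GA F n →ₗ[ℂ] A)
    (hcomp : ∀ n : ℕ, (ι (n + 1)).comp (paraEmbU F n) = ι n)
    (hmul : ∀ (n : ℕ) (a b : GA F n), ι n (a * b) = ι n a * ι n b)
    (hstar : ∀ (n : ℕ) (g : GLn F n),
      star (ι n (MonoidAlgebra.single g 1)) = ι n (MonoidAlgebra.single g⁻¹ 1))
    (χ : A →ₗ[ℂ] ℂ) (hpos : ∀ x, 0 ≤ χ (star x * x))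
    (hunip : ∀ n : ℕ, IsUnipotentFunctional F (fun a => χ (ι n a)))
    (hnorm : χ (ι 0 1) = 1) :
    ∃ m : ∀ n, GLn F n → ℝ, (∀ n g, χ (ι n (MonoidAlgebra.single g 1)) = m n g) ∧ m 0 1 = 1 ∧
      (∀ n g, ∑ h ∈ ExtUSet F g, m (n + 1) h = (Fintype.card F : ℝ) ^ n * m n g) ∧ ∀ n g, IsUUT F g → 0 ≤ m n g := by
  have hform : ∀ n, ∃ b : J n →₀ ℝ, (∀ g : GLn F n, χ (ι n (MonoidAlgebra.single g 1)) = (PiG F n b g : ℂ)) ∧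
      ∀ x : Equiv.Perm (Fin n) → ℝ, 0 ≤ ∑ σ, ∑ τ, x σ * x τ * PiS n b (σ⁻¹ * τ) := by
    intro n
    obtain ⟨k, c, d, ρ, hirr, hχ⟩ := hunip n
    refine chi_form (fun g => χ (ι n (MonoidAlgebra.single g 1))) c d ρ (fun i => (hirr i).1) (fun i => (hirr i).2) ?_ ?_
    · intro g
      have := hχ (MonoidAlgebra.single g 1)
      simp only [charFun_single] at this
      exact this
    · intro x
      have := chi_pd ι hmul hstar χ hpos n x
      convert this
  choose b hb hpd using hform
  have hq : (Fintype.card F : ℂ) ≠ 0 := by exact_mod_cast Fintype.card_ne_zero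
  have hcons : ∀ n (g : GLn F n), ∑ h ∈ ExtUSet F g, χ (ι (n + 1) (MonoidAlgebra.single h 1)) = (Fintype.card F : ℂ) ^ n * χ (ι n (MonoidAlgebra.single g 1)) := by
    intro n g
    rw [← hcomp n, LinearMap.comp_apply, paraEmb_single, map_smul, map_smul, map_sum, map_sum, smul_eq_mul, mul_inv_cancel_left₀ (pow_ne_zero n hq)]
  have h0 : PiG F 0 (b 0) 1 = 1 := by
    have := hb 0 1
    rw [show (MonoidAlgebra.single (1 : GLn F 0) (1 : ℂ)) = 1 from rfl, hnorm] at this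
    exact_mod_cast this.symm
  refine ⟨fun n g => PiG F n (b n) g, hb, h0, ?_, ?_⟩
  · intro n g
    have := hcons n g
    simp only [hb] at this
    exact_mod_cast this
  · intro n g hg
    refine unip_nonneg b h0 ?_ hpd g (uut_nil hg)
    intro n g
    refine ⟨hOf g, hOf_Hl g, ?_⟩
    have := hcons n g
    rw [sum_ext] at this
    simp only [hb] at this
    exact_mod_cast this

theorem tri_exp (n : ℕ) : (n + 1) * (n + 1 - 1) / 2 = n * (n - 1) / 2 + n := by
  rcases n with _ | n
  · rfl
  · simp only [Nat.add_sub_cancel]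
    have : (n + 1 + 1) * (n + 1) = (n + 1) * n + (n + 1) * 2 := by ring
    rw [this, Nat.add_mul_div_right _ _ (by norm_num)]

end fin
end UT

/-- **Theorem 4.2** (identification of unipotent traces of `A(GLU)` with probability measures
on `𝕌`). Here `A`, together with the compatible system `ι` of injective multiplicative linear
maps from the group algebras `ℂ[GL(n,q)]` (along the embeddings `j_n`) whose images exhaust
`A`, realizes the algebra `A(GLU)` with its canonical involution; `χ` is an extreme unipotent
trace normalized by `χ(I_U) = 1`. Then there is a unique Borel probability measure `ϱ` on `𝕌`
with `χ(I_g^U) = ϱ(Cyl_g)` for all unipotent upper-triangular `g ∈ GL(n,q)`, where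
`I_g^U = q^{-n(n-1)/2}·[e_g]`. -/
theorem unipotent_trace_gives_probability_measure_GLU
    (A : Type) [NonUnitalRing A] [Module ℂ A] [SMulCommClass ℂ A A] [IsScalarTower ℂ A A]
    [StarRing A] [StarModule ℂ A]
    (ι : ∀ n : ℕ, GA F n →ₗ[ℂ] A)
    (hcomp : ∀ n : ℕ, (ι (n + 1)).comp (paraEmbU F n) = ι n)
    (hmul : ∀ (n : ℕ) (a b : GA F n), ι n (a * b) = ι n a * ι n b)
    (hinj : ∀ n : ℕ, Function.Injective (ι n))
    (hexhaust : ∀ x : A, ∃ (n : ℕ) (a : GA F n), ι n a = x)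
    (hstar : ∀ (n : ℕ) (g : GLn F n),
      star (ι n (MonoidAlgebra.single g 1)) = ι n (MonoidAlgebra.single g⁻¹ 1))
    (χ : A →ₗ[ℂ] ℂ)
    (hextreme : IsExtremeTrace χ)
    (hunip : ∀ n : ℕ, IsUnipotentFunctional F (fun a => χ (ι n a)))
    (hnorm : χ (ι 0 1) = 1) :
    ∃! ϱ : Measure (UU F), IsProbabilityMeasure ϱ ∧
      ∀ (n : ℕ) (g : GLn F n), IsUUT F g →
        χ ((((Fintype.card F : ℂ) ^ (n * (n - 1) / 2))⁻¹) • ι n (MonoidAlgebra.single g 1))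
          = ((ϱ (CylU F g)).toReal : ℂ) := by
  obtain ⟨m, hm, h0, hc, hpos⟩ := UT.main_vals ι hcomp hmul hstar χ hextreme.1.2 hunip hnorm
  have hq : (Fintype.card F : ℝ) ≠ 0 := by exact_mod_cast Fintype.card_ne_zero
  obtain ⟨ρ, hρ, hρ'⟩ := UT.meas_exists (F := F) (m := fun n g => ((Fintype.card F : ℝ) ^ (n * (n - 1) / 2))⁻¹ * m n g)
    (by
      intro n g hg
      rw [← Finset.mul_sum, hc, UT.tri_exp, pow_add]
      field_simp)
    (by simp [h0])
    (fun n g hg => mul_nonneg (by positivity) (hpos n g hg))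
  have hval : ∀ (n : ℕ) (g : GLn F n), χ ((((Fintype.card F : ℂ) ^ (n * (n - 1) / 2))⁻¹) • ι n (MonoidAlgebra.single g 1))
      = ((((Fintype.card F : ℝ) ^ (n * (n - 1) / 2))⁻¹ * m n g : ℝ) : ℂ) := by
    intro n g
    rw [map_smul, hm, smul_eq_mul]
    push_cast
    rfl
  refine ⟨ρ, ⟨hρ, fun n g hg => ?_⟩, ?_⟩
  · rw [hval, hρ' n g hg]
  · rintro ν ⟨hν, hν'⟩
    refine UT.meas_unique ν ρ fun n g hg => ?_
    have h1 := hν' n g hg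
    rw [hval] at h1
    rw [hρ' n g hg]
    exact_mod_cast h1.symm
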